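/- Let $1 \leq m \leq n$ and $A, B_1,\dots,B_m$ be convex bodies in $\mathbb{R}^n$. Then $|A|\, V(B_1,\dots,B_m,A[n-m]) \leq 2^{m-1}\, V(B_1,\dots,B_{m-1},A[n-m+1])\, V(B_m, A[n-1])$. -/

import Mathlib

open scoped Pointwise
open MeasureTheory

/-- A convex body in `ℝⁿ`: a compact convex set with nonempty interior. -/
def IsConvexBody {n : ℕ} (K : Set (EuclideanSpace ℝ (Fin n))) : Prop :=
  Convex ℝ K ∧ IsCompact K ∧ (interior K).Nonempty

/-- The mixed volume of `n` convex bodies in `ℝⁿ`, via the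
inclusion-exclusion (polarization) formula for Minkowski sums. -/
noncomputable def mixedVolume {n : ℕ} (K : Fin n → Set (EuclideanSpace ℝ (Fin n))) : ℝ :=
  ((n.factorial : ℝ))⁻¹ *
    ∑ S : Finset (Fin n), (-1 : ℝ) ^ (n + S.card) * (volume (∑ i ∈ S, K i)).toReal

set_option linter.unusedSectionVars false
set_option linter.unusedVariables false
open scoped Pointwise
open MeasureTheory

section diffs
variable {V : Type*} [NormedAddCommGroup V] [NormedSpace ℝ V]

/-- Iterated forward differences. -/
def diffL : List V → (V → ℝ) → (V → ℝ)
  | [], F => F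
  | a :: l, F => diffL l (fun h => F (h + a) - F h)

theorem diffL_sub (l : List V) : ∀ (F G : V → ℝ) (h : V),
    diffL l (fun h => F h - G h) h = diffL l F h - diffL l G h := by
  induction l with
  | nil => intro F G h; rfl
  | cons a l ih =>
    intro F G h
    simp only [diffL]
    rw [← ih]
    congr 1
    funext y
    ring

theorem diffL_const_mul (c : ℝ) (l : List V) : ∀ (F : V → ℝ) (h : V),
    diffL l (fun h => c * F h) h = c * diffL l F h := by
  induction l with
  | nil => intro F h; rfl
  | cons a l ih =>
    intro F h
    simp only [diffL]
    rw [← ih]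
    congr 1
    funext y
    ring

theorem diffL_shift (b : V) (l : List V) : ∀ (F : V → ℝ) (h : V),
    diffL l (fun h => F (h + b)) h = diffL l F (h + b) := by
  induction l with
  | nil => intro F h; rfl
  | cons a l ih =>
    intro F h
    simp only [diffL]
    rw [← ih]
    congr 1
    funext y
    rw [add_right_comm]

theorem diffL_cons (a : V) (l : List V) (F : V → ℝ) (h : V) :
    diffL (a :: l) F h = diffL l F (h + a) - diffL l F h := by
  simp only [diffL]
  rw [diffL_sub, diffL_shift]

theorem diffL_append (l₁ : List V) : ∀ (l₂ : List V) (F : V → ℝ),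
    diffL (l₁ ++ l₂) F = diffL l₂ (diffL l₁ F) := by
  induction l₁ with
  | nil => intro l₂ F; rfl
  | cons a l ih => intro l₂ F; simp only [List.cons_append, diffL]; rw [ih]

theorem diffL_perm {l₁ l₂ : List V} (p : l₁.Perm l₂) : ∀ (F : V → ℝ), diffL l₁ F = diffL l₂ F := by
  induction p with
  | nil => intro F; rfl
  | cons a _ ih => intro F; simp only [diffL]; rw [ih]
  | swap a b l =>
    intro F; simp only [diffL]; congr 1; funext y
    rw [add_right_comm]; ring
  | trans _ _ ih1 ih2 => intro F; rw [ih1, ih2]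

theorem diffL_eq_zero_of_set (S : Set V) (l : List V) : ∀ (F : V → ℝ) (h : V),
    (∀ a ∈ l, ∀ y ∈ S, y + a ∈ S) → (∀ y ∈ S, F y = 0) → h ∈ S → diffL l F h = 0 := by
  induction l with
  | nil => intro F h _ hF hh; exact hF h hh
  | cons a l ih =>
    intro F h hS hF hh
    simp only [diffL]
    refine ih _ h (fun b hb => hS b (List.mem_cons_of_mem _ hb)) ?_ hh
    intro y hy
    rw [hF y hy, hF _ (hS a List.mem_cons_self y hy), sub_zero]

theorem diffL_sum {κ : Type*} (s : Finset κ) (G : κ → V → ℝ) (l : List V) : ∀ (h : V),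
    diffL l (fun h => ∑ k ∈ s, G k h) h = ∑ k ∈ s, diffL l (G k) h := by
  induction l generalizing G with
  | nil => intro h; rfl
  | cons a l ih =>
    intro h
    simp only [diffL]
    rw [← ih]
    congr 1
    funext y
    rw [Finset.sum_sub_distrib]

/-- Parallelepiped spanned by a list. -/
def ptsL : List V → Set V
  | [] => {0}
  | a :: l => (fun t : ℝ => t • a) '' Set.Icc 0 1 + ptsL l

theorem isCompact_ptsL (l : List V) : IsCompact (ptsL l) := by
  induction l with
  | nil => exact isCompact_singleton
  | cons a l ih =>
    exact (isCompact_Icc.image (by fun_prop)).add ih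

theorem ptsL_norm_le (l : List V) : ∀ y ∈ ptsL l, ‖y‖ ≤ (l.map norm).sum := by
  induction l with
  | nil => intro y hy; simp [ptsL] at hy; simp [hy]
  | cons a l ih =>
    rintro y ⟨_, ⟨t, ht, rfl⟩, z, hz, rfl⟩
    simp only [List.map_cons, List.sum_cons]
    refine (norm_add_le _ _).trans (add_le_add ?_ (ih z hz))
    simp only [norm_smul, Real.norm_eq_abs, abs_of_nonneg ht.1]
    exact mul_le_of_le_one_left (norm_nonneg _) ht.2

theorem diffL_subdivide (m : ℕ) (hm : 0 < m) (l : List V) : ∀ (F : V → ℝ) (h : V),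
    (∀ y ∈ ptsL l, diffL (l.map (fun a => (m : ℝ)⁻¹ • a)) F (h + y) = 0) → diffL l F h = 0 := by
  have hm' : (m : ℝ) ≠ 0 := by positivity
  induction l with
  | nil => intro F h H; simpa [ptsL, diffL] using H
  | cons a l ih =>
    intro F h H
    simp only [diffL]
    have key : (fun y => F (y + a) - F y) = fun y => ∑ k ∈ Finset.range m,
        (fun z => F (z + (m : ℝ)⁻¹ • a) - F z) (y + ((k : ℝ) * (m : ℝ)⁻¹) • a) := by
      funext y
      have := Finset.sum_range_sub (fun k : ℕ => F (y + ((k : ℝ) * (m : ℝ)⁻¹) • a)) m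
      simp only [Nat.cast_zero, zero_mul, zero_smul, add_zero, mul_inv_cancel₀ hm', one_smul] at this
      rw [← this]
      refine Finset.sum_congr rfl fun k _ => ?_
      simp only
      congr 2
      push_cast
      rw [add_mul, one_mul, add_smul, add_assoc]
    rw [key, diffL_sum]
    refine Finset.sum_eq_zero fun k hk => ?_
    rw [diffL_shift (((k : ℝ) * (m : ℝ)⁻¹) • a) l (fun z => F (z + (m : ℝ)⁻¹ • a) - F z) h]
    refine ih _ _ fun y hy => ?_
    have hk' : (k : ℝ) ≤ m := by exact_mod_cast (Finset.mem_range.1 hk).le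
    have := H (((k : ℝ) * (m : ℝ)⁻¹) • a + y) ⟨_, ⟨(k : ℝ) * (m : ℝ)⁻¹, ⟨by positivity, ?_⟩, rfl⟩, y, hy, rfl⟩
    · simpa only [List.map_cons, diffL, add_assoc] using this
    · rw [← div_eq_mul_inv]; exact div_le_one_of_le₀ hk' (by positivity)

theorem continuousAt_diffL (l : List V) : ∀ (F : V → ℝ) (h : V),
    (∀ y, ‖y - h‖ ≤ (l.map norm).sum → ContinuousAt F y) → ContinuousAt (diffL l F) h := by
  induction l with
  | nil => intro F h H; exact H h (by simp)
  | cons a l ih =>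
    intro F h H
    have e : diffL (a :: l) F = fun h => diffL l F (h + a) - diffL l F h := by
      funext h; exact diffL_cons a l F h
    simp only [List.map_cons, List.sum_cons] at H
    rw [e]
    refine ContinuousAt.sub ?_ ?_
    · have : ContinuousAt (diffL l F) (h + a) := by
        refine ih F _ fun y hy => H y ?_
        have : y - h = a + (y - (h + a)) := by abel
        rw [this]
        exact (norm_add_le _ _).trans (by linarith)
      exact ContinuousAt.comp (g := diffL l F) (f := fun h => h + a) this (by fun_prop)
    · exact ih F _ fun y hy => H y (by linarith [norm_nonneg a])

theorem diffL_integral {Ω : Type*} [MeasurableSpace Ω] (μ : Measure Ω) (l : List V) :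
    ∀ (G : Ω → V → ℝ), (∀ h, Integrable (fun x => G x h) μ) → ∀ h,
    Integrable (fun x => diffL l (G x) h) μ ∧
    diffL l (fun h => ∫ x, G x h ∂μ) h = ∫ x, diffL l (G x) h ∂μ := by
  induction l with
  | nil => intro G hG h; exact ⟨hG h, rfl⟩
  | cons a l ih =>
    intro G hG h
    simp only [diffL]
    have := ih (fun x h => G x (h + a) - G x h) (fun h => (hG _).sub (hG _)) h
    refine ⟨this.1, ?_⟩
    rw [← this.2]
    congr 1
    funext y
    exact (integral_sub (hG _) (hG _)).symm

/-- Difference over a vector with finitely many coordinates telescopes. -/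
theorem telescoping_zero {κ : Type*} (s : Finset κ) (b : κ → V) (F : V → ℝ) : ∀ (h : V),
    (∀ t ⊆ s, ∀ k ∈ s, F (h + ∑ j ∈ t, b j + b k) = F (h + ∑ j ∈ t, b j)) →
    F (h + ∑ j ∈ s, b j) = F h := by
  classical
  induction s using Finset.induction_on with
  | empty => intro h _; simp
  | insert i s hi ih =>
    intro h H
    have h1 := H s (Finset.subset_insert _ _) i (Finset.mem_insert_self _ _)
    rw [Finset.sum_insert hi, add_comm (b i), ← add_assoc, h1]
    exact ih h fun t ht k hk =>
      H t (ht.trans (Finset.subset_insert _ _)) k (Finset.mem_insert_of_mem hk)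

end diffs

section prods
variable {ι : Type*} [Fintype ι] [DecidableEq ι]

theorem diffL_prod (L : List (ι × ℝ)) : ∀ (φ : ι → ℝ → ℝ) (h : ι → ℝ),
    (L.map Prod.fst).Nodup →
    ∃ ψ : ι → ℝ, diffL (L.map (fun p => (Pi.single p.1 p.2 : ι → ℝ))) (fun h => ∏ k, φ k (h k)) h = ∏ k, ψ k ∧
      (∀ p ∈ L, ψ p.1 = φ p.1 (h p.1 + p.2) - φ p.1 (h p.1)) ∧
      ∀ k, k ∉ L.map Prod.fst → ψ k = φ k (h k) := by
  induction L with
  | nil => intro φ h _; exact ⟨fun k => φ k (h k), rfl, by simp, by simp⟩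
  | cons p L ih =>
    intro φ h hnd
    simp only [List.map_cons, List.nodup_cons] at hnd
    obtain ⟨ψ, h1, h2, h3⟩ := ih (Function.update φ p.1 (fun t => φ p.1 (t + p.2) - φ p.1 t)) h hnd.2
    refine ⟨ψ, ?_, ?_, ?_⟩
    · rw [← h1]
      simp only [List.map_cons, diffL]
      congr 1
      funext y
      rw [← Finset.mul_prod_erase Finset.univ _ (Finset.mem_univ p.1),
        ← Finset.mul_prod_erase Finset.univ (fun k => φ k (y k)) (Finset.mem_univ p.1),
        ← Finset.mul_prod_erase Finset.univ (fun k => (Function.update φ p.1 _) k (y k)) (Finset.mem_univ p.1)]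
      have e1 : ∏ x ∈ Finset.univ.erase p.1, φ x ((y + (Pi.single p.1 p.2 : ι → ℝ)) x)
          = ∏ x ∈ Finset.univ.erase p.1, φ x (y x) := by
        refine Finset.prod_congr rfl fun x hx => ?_
        simp [Finset.ne_of_mem_erase hx]
      have e2 : ∏ x ∈ Finset.univ.erase p.1, (Function.update φ p.1 (fun t => φ p.1 (t + p.2) - φ p.1 t)) x (y x)
          = ∏ x ∈ Finset.univ.erase p.1, φ x (y x) := by
        refine Finset.prod_congr rfl fun x hx => ?_
        simp [Finset.ne_of_mem_erase hx]
      rw [e1, e2]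
      simp
      ring
    · intro q hq
      rcases List.mem_cons.1 hq with rfl | hq
      · rw [h3 _ hnd.1]; simp
      · rw [h2 q hq]
        have : q.1 ≠ p.1 := fun e => hnd.1 (e ▸ List.mem_map_of_mem hq)
        simp [this]
    · intro k hk
      simp only [List.map_cons, List.mem_cons, not_or] at hk
      rw [h3 k hk.2]
      simp [hk.1]
end prods

set_option linter.unusedSectionVars false
set_option linter.unusedVariables false
open scoped Pointwise
open MeasureTheory

/-- A simple complete fan, combinatorially presented, with a nonempty type cone. -/
structure Fan (n : ℕ) (ι : Type*) [Fintype ι] [DecidableEq ι] where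
  u : ι → EuclideanSpace ℝ (Fin n)
  B : Finset (Finset ι)
  X : Finset ι → (ι → ℝ) →ₗ[ℝ] EuclideanSpace ℝ (Fin n)
  tight : ∀ S ∈ B, ∀ i ∈ S, ∀ c, inner ℝ (u i) (X S c) = c i
  card : ∀ S ∈ B, S.card = n
  cover : ∀ w : EuclideanSpace ℝ (Fin n), ∃ S ∈ B, ∃ α : ι → ℝ, (∀ i, 0 ≤ α i) ∧
    (∀ i, i ∉ S → α i = 0) ∧ w = ∑ i, α i • u i
  ne : ∃ c : ι → ℝ, ∀ S ∈ B, ∀ j, j ∉ S → inner ℝ (u j) (X S c) < c j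

namespace Fan
variable {n : ℕ} {ι : Type*} [Fintype ι] [DecidableEq ι] (F : Fan n ι)

/-- The type cone. -/
def T : Set (ι → ℝ) := {c | ∀ S ∈ F.B, ∀ j, j ∉ S → inner ℝ (F.u j) (F.X S c) < c j}

/-- The polytope with given support numbers. -/
def P (c : ι → ℝ) : Set (EuclideanSpace ℝ (Fin n)) := {x | ∀ i, inner ℝ (F.u i) x ≤ c i}

/-- Simplicial complex of the fan. -/
def face (I : Finset ι) : Prop := ∃ S ∈ F.B, I ⊆ S

/-- Lineality vectors. -/
noncomputable def ell (v : EuclideanSpace ℝ (Fin n)) : ι → ℝ := fun i => inner ℝ (F.u i) v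

/-- The volume function. -/
noncomputable def f (c : ι → ℝ) : ℝ := (volume (F.P c)).toReal

theorem isOpen_T : IsOpen F.T := by
  have : F.T = ⋂ S ∈ F.B, ⋂ j, ⋂ (_ : j ∉ S), {c | inner ℝ (F.u j) (F.X S c) < c j} := by
    ext c; simp [T]
  rw [this]
  refine isOpen_biInter_finset fun S _ => isOpen_iInter_of_finite fun j =>
    isOpen_iInter_of_finite fun _ => ?_
  have := (F.X S).continuous_of_finiteDimensional
  exact isOpen_lt (by fun_prop) (by fun_prop)

theorem T_add {c d : ι → ℝ} (hc : c ∈ F.T) (hd : d ∈ F.T) : c + d ∈ F.T := by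
  intro S hS j hj
  rw [map_add, inner_add_right]
  exact add_lt_add (hc S hS j hj) (hd S hS j hj)

theorem T_smul {c : ι → ℝ} (hc : c ∈ F.T) {t : ℝ} (ht : 0 < t) : t • c ∈ F.T := by
  intro S hS j hj
  rw [map_smul, inner_smul_right]
  exact mul_lt_mul_of_pos_left (hc S hS j hj) ht

theorem X_mem {c : ι → ℝ} (hc : c ∈ F.T) {S : Finset ι} (hS : S ∈ F.B) : F.X S c ∈ F.P c := by
  intro i
  by_cases hi : i ∈ S
  · exact (F.tight S hS i hi c).le
  · exact (hc S hS i hi).le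

theorem eq_of_inner {S : Finset ι} (hS : S ∈ F.B) {v w : EuclideanSpace ℝ (Fin n)}
    (h : ∀ i ∈ S, inner ℝ (F.u i) v = inner ℝ (F.u i) w) : v = w := by
  let L : EuclideanSpace ℝ (Fin n) →ₗ[ℝ] (S → ℝ) :=
    { toFun := fun v i => inner ℝ (F.u i) v
      map_add' := fun v w => by funext i; simp [inner_add_right]
      map_smul' := fun t v => by funext i; simp [inner_smul_right] }
  have hsurj : Function.Surjective L := by
    intro g
    refine ⟨F.X S (fun i => if hi : i ∈ S then g ⟨i, hi⟩ else 0), ?_⟩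
    funext i
    change inner ℝ (F.u i) _ = _
    rw [F.tight S hS i i.2]
    simp
  have hd : Module.finrank ℝ (EuclideanSpace ℝ (Fin n)) = Module.finrank ℝ (S → ℝ) := by
    simp [F.card S hS]
  have hinj := (LinearMap.injective_iff_surjective_of_finrank_eq_finrank hd).2 hsurj
  apply hinj
  funext i
  exact h i i.2

theorem X_ell {S : Finset ι} (hS : S ∈ F.B) (v : EuclideanSpace ℝ (Fin n)) : F.X S (F.ell v) = v := by
  apply F.eq_of_inner hS
  intro i hi
  rw [F.tight S hS i hi]
  rfl

theorem T_ell {c : ι → ℝ} (hc : c ∈ F.T) (v : EuclideanSpace ℝ (Fin n)) : c + F.ell v ∈ F.T := by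
  intro S hS j hj
  rw [map_add, F.X_ell hS, inner_add_right]
  exact add_lt_add_left (hc S hS j hj) _

theorem ell_neg (v : EuclideanSpace ℝ (Fin n)) : F.ell (-v) = - F.ell v := by
  funext i; simp [ell]

theorem ell_add (v w : EuclideanSpace ℝ (Fin n)) : F.ell (v + w) = F.ell v + F.ell w := by
  funext i; simp [ell, inner_add_right]

theorem ell_smul (t : ℝ) (v : EuclideanSpace ℝ (Fin n)) : F.ell (t • v) = t • F.ell v := by
  funext i; simp [ell, inner_smul_right]

theorem face_of_tight {c : ι → ℝ} (hc : c ∈ F.T) {x : EuclideanSpace ℝ (Fin n)} (hx : x ∈ F.P c)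
    {I : Finset ι} (hI : ∀ i ∈ I, inner ℝ (F.u i) x = c i) : F.face I := by
  obtain ⟨S, hS, α, h0, hz, hw⟩ := F.cover (∑ i ∈ I, F.u i)
  refine ⟨S, hS, ?_⟩
  by_contra hcon
  obtain ⟨j, hjI, hjS⟩ := Finset.not_subset.1 hcon
  have e1 : inner ℝ (∑ i ∈ I, F.u i) (F.X S c) < ∑ i ∈ I, c i := by
    rw [sum_inner]
    refine Finset.sum_lt_sum (fun i _ => F.X_mem hc hS i) ⟨j, hjI, hc S hS j hjS⟩
  have e2 : inner ℝ (∑ i ∈ I, F.u i) x = ∑ i ∈ I, c i := by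
    rw [sum_inner]
    exact Finset.sum_congr rfl hI
  have e3 : inner ℝ (∑ i ∈ I, F.u i) x ≤ inner ℝ (∑ i ∈ I, F.u i) (F.X S c) := by
    rw [hw, sum_inner, sum_inner]
    refine Finset.sum_le_sum fun i _ => ?_
    rw [real_inner_smul_left, real_inner_smul_left]
    by_cases hi : i ∈ S
    · rw [F.tight S hS i hi]
      exact mul_le_mul_of_nonneg_left (hx i) (h0 i)
    · simp [hz i hi]
  linarith

theorem exists_inner {I : Finset ι} (hI : F.face I) (g : ι → ℝ) :
    ∃ v, ∀ i ∈ I, inner ℝ (F.u i) v = g i := by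
  obtain ⟨S, hS, h⟩ := hI
  exact ⟨F.X S g, fun i hi => F.tight S hS i (h hi) g⟩

theorem exists_relint {c : ι → ℝ} (hc : c ∈ F.T) {I : Finset ι} (hI : F.face I) :
    ∃ p, (∀ i ∈ I, inner ℝ (F.u i) p = c i) ∧ ∀ j, j ∉ I → inner ℝ (F.u j) p < c j := by
  obtain ⟨S, hS, h⟩ := hI
  let b : ι → ℝ := fun i => if i ∈ S \ I then 1 else 0
  have hev : ∀ᶠ ε : ℝ in nhdsWithin 0 (Set.Ioi 0), c - ε • b ∈ F.T := by
    have hcont : Continuous fun ε : ℝ => c - ε • b := by fun_prop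
    refine (hcont.continuousAt.eventually_mem (s := F.T) ?_).filter_mono nhdsWithin_le_nhds
    exact F.isOpen_T.mem_nhds (by simpa using hc)
  obtain ⟨ε, hε, hε0⟩ := (hev.and self_mem_nhdsWithin).exists
  refine ⟨F.X S (c - ε • b), fun i hi => ?_, fun j hj => ?_⟩
  · rw [F.tight S hS i (h hi)]
    simp [b, hi]
  · by_cases hjS : j ∈ S
    · rw [F.tight S hS j hjS]
      simp only [b, Pi.sub_apply, Pi.smul_apply, Finset.mem_sdiff, hjS, hj, not_false_eq_true, and_self,
        if_true, smul_eq_mul, mul_one]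
      have : (0:ℝ) < ε := hε0
      linarith
    · have := hε S hS j hjS
      simpa [b, hjS] using this

theorem face_empty : F.face ∅ := by
  obtain ⟨S, hS, -⟩ := F.cover 0
  exact ⟨S, hS, Finset.empty_subset _⟩

theorem inner_le_of_cover (w : EuclideanSpace ℝ (Fin n)) (c : ι → ℝ) :
    ∃ C, ∀ x ∈ F.P c, inner ℝ w x ≤ C := by
  obtain ⟨S, hS, α, h0, hz, hw⟩ := F.cover w
  refine ⟨∑ i, α i * c i, fun x hx => ?_⟩
  rw [hw, sum_inner]
  refine Finset.sum_le_sum fun i _ => ?_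
  rw [real_inner_smul_left]
  exact mul_le_mul_of_nonneg_left (hx i) (h0 i)

theorem isClosed_P (c : ι → ℝ) : IsClosed (F.P c) := by
  have : F.P c = ⋂ i, {x | inner ℝ (F.u i) x ≤ c i} := by ext; simp [P]
  rw [this]
  exact isClosed_iInter fun i => isClosed_le (by fun_prop) (by fun_prop)

theorem convex_P (c : ι → ℝ) : Convex ℝ (F.P c) := by
  intro x hx y hy a b ha hb hab i
  rw [inner_add_right, inner_smul_right, inner_smul_right]
  have h1 := mul_le_mul_of_nonneg_left (hx i) ha
  have h2 := mul_le_mul_of_nonneg_left (hy i) hb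
  have : a * c i + b * c i = c i := by rw [← add_mul, hab, one_mul]
  linarith

theorem isCompact_P (c : ι → ℝ) : IsCompact (F.P c) := by
  refine Metric.isCompact_of_isClosed_isBounded (F.isClosed_P c) ?_
  choose C hC using fun k : Fin n => F.inner_le_of_cover (EuclideanSpace.single k 1) c
  choose D hD using fun k : Fin n => F.inner_le_of_cover (-EuclideanSpace.single k 1) c
  refine isBounded_iff_forall_norm_le.2 ⟨∑ k, (|C k| + |D k|), fun x hx => ?_⟩
  rw [EuclideanSpace.norm_eq]
  refine Real.sqrt_le_iff.2 ⟨by positivity, ?_⟩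
  refine (Finset.sum_le_sum fun k _ => ?_).trans (Finset.sum_sq_le_sq_sum_of_nonneg (f := fun k => |C k| + |D k|) (fun k _ => by positivity))
  have h1 := hC k x hx
  have h2 := hD k x hx
  simp only [inner_neg_left, EuclideanSpace.inner_single_left, map_one, one_mul] at h1 h2
  refine pow_le_pow_left₀ (norm_nonneg _) ?_ 2
  rw [Real.norm_eq_abs, abs_le]
  constructor
  · have := le_abs_self (D k); have := abs_nonneg (C k); linarith
  · have := le_abs_self (C k); have := abs_nonneg (D k); linarith

theorem f_nonneg (c : ι → ℝ) : 0 ≤ F.f c := ENNReal.toReal_nonneg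

theorem f_mono {c d : ι → ℝ} (h : c ≤ d) : F.f c ≤ F.f d := by
  refine ENNReal.toReal_mono (F.isCompact_P d).measure_lt_top.ne (measure_mono ?_)
  exact fun x hx i => (hx i).trans (h i)

theorem f_ell (c : ι → ℝ) (v : EuclideanSpace ℝ (Fin n)) : F.f (c + F.ell v) = F.f c := by
  have : F.P (c + F.ell v) = (fun x => x + (-v)) ⁻¹' F.P c := by
    ext x
    simp only [P, ell, Set.mem_ofPred_eq, Set.mem_preimage, inner_add_right, inner_neg_right, Pi.add_apply]
    exact forall_congr' fun i => by constructor <;> intro h <;> linarith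
  rw [f, this, measure_preimage_add_right]
  rfl

theorem f_smul (c : ι → ℝ) {t : ℝ} (ht : 0 < t) : F.f (t • c) = t ^ n * F.f c := by
  have : F.P (t • c) = t • F.P c := by
    ext x
    rw [Set.mem_smul_set_iff_inv_smul_mem₀ ht.ne']
    simp only [P, Set.mem_ofPred_eq, inner_smul_right, Pi.smul_apply, smul_eq_mul]
    exact forall_congr' fun i => by rw [inv_mul_le_iff₀ ht]
  rw [f, this, Measure.addHaar_smul, ENNReal.toReal_mul]
  simp only [f, finrank_euclideanSpace, Fintype.card_fin]
  rw [ENNReal.toReal_ofReal (abs_nonneg _), abs_of_pos (pow_pos ht n)]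

/-- The step function whose products give the indicator. -/
noncomputable def stp (t s : ℝ) : ℝ := if t ≤ s then 1 else 0

theorem prod_stp (c : ι → ℝ) (x : EuclideanSpace ℝ (Fin n)) :
    ∏ i, stp (inner ℝ (F.u i) x) (c i) = (F.P c).indicator (fun _ => (1:ℝ)) x := by
  classical
  by_cases hx : x ∈ F.P c
  · rw [Set.indicator_of_mem hx]
    exact Finset.prod_eq_one fun i _ => if_pos (hx i)
  · rw [Set.indicator_of_notMem hx]
    simp only [P, Set.mem_ofPred_eq, not_forall] at hx
    obtain ⟨i, hi⟩ := hx
    exact Finset.prod_eq_zero (Finset.mem_univ i) (if_neg hi)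

theorem f_eq_integral (c : ι → ℝ) :
    F.f c = ∫ x, ∏ i, stp (inner ℝ (F.u i) x) (c i) := by
  simp_rw [F.prod_stp]
  rw [integral_indicator (F.isClosed_P c).measurableSet]
  simp [f, Measure.real]

theorem integrable_stp (c : ι → ℝ) :
    Integrable (fun x => ∏ i, stp (inner ℝ (F.u i) x) (c i)) volume := by
  simp_rw [F.prod_stp]
  rw [integrable_indicator_iff (F.isClosed_P c).measurableSet]
  exact integrableOn_const (F.isCompact_P c).measure_lt_top.ne

/-- Coordinate vectors. -/
def vec (p : ι × ℝ) : ι → ℝ := Pi.single p.1 p.2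

theorem diffL_nodup (L : List (ι × ℝ)) (hL : (L.map Prod.fst).Nodup) (h : ι → ℝ) :
    ∃ ψ : EuclideanSpace ℝ (Fin n) → ι → ℝ,
      Integrable (fun x => ∏ k, ψ x k) volume ∧ diffL (L.map vec) F.f h = ∫ x, ∏ k, ψ x k ∧
      ∀ x, (∀ p ∈ L, ψ x p.1 = stp (inner ℝ (F.u p.1) x) (h p.1 + p.2) - stp (inner ℝ (F.u p.1) x) (h p.1)) ∧
      ∀ k, k ∉ L.map Prod.fst → ψ x k = stp (inner ℝ (F.u k) x) (h k) := by
  have := fun x : EuclideanSpace ℝ (Fin n) => diffL_prod L (fun k => stp (inner ℝ (F.u k) x)) h hL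
  choose ψ h1 h2 h3 using this
  have hf : F.f = fun c => ∫ x, ∏ i, stp (inner ℝ (F.u i) x) (c i) := funext F.f_eq_integral
  have hd := diffL_integral volume (L.map vec) (fun x c => ∏ i, stp (inner ℝ (F.u i) x) (c i))
    F.integrable_stp h
  have he : (fun x => diffL (L.map vec) (fun c => ∏ i, stp (inner ℝ (F.u i) x) (c i)) h) =
    fun x => ∏ k, ψ x k := funext h1
  refine ⟨ψ, ?_, ?_, fun x => ⟨h2 x, h3 x⟩⟩
  · rw [← he]; exact hd.1
  · rw [hf, hd.2, he]

theorem diffL_notface (L : List (ι × ℝ)) (hL : (L.map Prod.fst).Nodup)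
    (hI : ¬ F.face (L.map Prod.fst).toFinset) (h : ι → ℝ) (δ : ℝ) (hδ : 0 ≤ δ)
    (hT : ∀ y, ‖y - h‖ ≤ δ → y ∈ F.T) (hs : ∀ p ∈ L, |p.2| ≤ δ) :
    diffL (L.map vec) F.f h = 0 := by
  obtain ⟨ψ, -, h2, h3⟩ := F.diffL_nodup L hL h
  rw [h2]
  refine (integral_congr_ae (Filter.Eventually.of_forall fun x => ?_)).trans (integral_zero _ ℝ)
  by_contra hne
  apply hI
  have hne' : ∀ k, ψ x k ≠ 0 := fun k => (Finset.prod_ne_zero_iff.1 hne) k (Finset.mem_univ k)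
  refine F.face_of_tight (c := fun i => if i ∈ (L.map Prod.fst).toFinset then inner ℝ (F.u i) x else h i)
    (hT _ ?_) (x := x) ?_ ?_
  · refine (pi_norm_le_iff_of_nonneg hδ).2 fun i => ?_
    by_cases hi : i ∈ L.map Prod.fst
    · obtain ⟨p, hp, rfl⟩ := List.mem_map.1 hi
      have h4 := hne' p.1
      rw [(h3 x).1 p hp] at h4
      have := abs_le.1 (hs p hp)
      simp only [Pi.sub_apply, List.mem_toFinset, hi, if_true, Real.norm_eq_abs]
      rw [abs_le]
      unfold stp at h4
      split_ifs at h4 <;> first | (exfalso; simp at h4; done) | (constructor <;> linarith)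
    · simp [Pi.sub_apply, List.mem_toFinset, hi, hδ]
  · intro i
    by_cases hi : i ∈ L.map Prod.fst
    · simp only [List.mem_toFinset, hi, if_true]; exact le_refl _
    · simp only [List.mem_toFinset, hi, if_false]
      have h4 := hne' i
      rw [(h3 x).2 i hi] at h4
      unfold stp at h4
      by_contra hc
      simp [hc] at h4
  · intro i hi
    simp only [hi, if_true]

theorem diffL_pos {S : Finset ι} (hS : S ∈ F.B) (h : ι → ℝ) (hT : ∀ y, ‖y - h‖ ≤ 1 → y ∈ F.T) :
    0 < diffL ((S.toList.map (fun i => (i, (1:ℝ)))).map vec) F.f h := by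
  have hfst : (S.toList.map (fun i => (i, (1:ℝ)))).map Prod.fst = S.toList := by
    rw [List.map_map]; exact List.map_id _
  obtain ⟨ψ, h1, h2, h3⟩ := F.diffL_nodup (S.toList.map (fun i => (i, (1:ℝ))))
    (by rw [hfst]; exact S.nodup_toList) h
  rw [h2]
  have hval : ∀ x i, i ∈ S → ψ x i = stp (inner ℝ (F.u i) x) (h i + 1) - stp (inner ℝ (F.u i) x) (h i) :=
    fun x i hi => (h3 x).1 (i, 1) (List.mem_map.2 ⟨i, Finset.mem_toList.2 hi, rfl⟩)
  have hval' : ∀ x i, i ∉ S → ψ x i = stp (inner ℝ (F.u i) x) (h i) :=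
    fun x i hi => (h3 x).2 i (by rw [hfst]; simpa using hi)
  have hnn : ∀ x i, 0 ≤ ψ x i := by
    intro x i
    by_cases hi : i ∈ S
    · rw [hval x i hi]
      unfold stp
      split_ifs <;> first | (exfalso; linarith) | norm_num
    · rw [hval' x i hi]
      unfold stp
      split_ifs <;> norm_num
  rw [integral_pos_iff_support_of_nonneg (fun x => Finset.prod_nonneg fun i _ => hnn x i) h1]
  let U : Set (EuclideanSpace ℝ (Fin n)) :=
    ⋂ i, {x | (i ∈ S → h i < inner ℝ (F.u i) x ∧ inner ℝ (F.u i) x < h i + 1) ∧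
      (i ∉ S → inner ℝ (F.u i) x < h i)}
  have hU : IsOpen U := by
    refine isOpen_iInter_of_finite fun i => ?_
    by_cases hi : i ∈ S
    · simp only [hi, not_true_eq_false, true_imp_iff, false_imp_iff, and_true]
      have o1 : IsOpen {x | h i < inner ℝ (F.u i) x} := isOpen_lt (by fun_prop) (by fun_prop)
      have o2 : IsOpen {x | inner ℝ (F.u i) x < h i + 1} := isOpen_lt (by fun_prop) (by fun_prop)
      exact o1.inter o2
    · simp only [hi, not_false_eq_true, true_imp_iff, false_imp_iff, true_and]
      exact isOpen_lt (by fun_prop) (by fun_prop)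
  have hUne : U.Nonempty := by
    refine ⟨F.X S (h + fun i => if i ∈ S then 1/2 else 0), ?_⟩
    have hm : (h + fun i => if i ∈ S then (1:ℝ)/2 else 0) ∈ F.T := by
      apply hT
      rw [add_sub_cancel_left]
      refine (pi_norm_le_iff_of_nonneg zero_le_one).2 fun i => ?_
      split_ifs <;> norm_num
    simp only [U, Set.mem_iInter, Set.mem_ofPred_eq]
    intro i
    refine ⟨fun hi => ?_, fun hi => ?_⟩
    · rw [F.tight S hS i hi]
      simp only [Pi.add_apply, hi, if_true]
      constructor <;> linarith
    · have := hm S hS i hi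
      simpa [hi] using this
  refine (hU.measure_pos volume hUne).trans_le (measure_mono fun x hx => ?_)
  simp only [U, Set.mem_iInter, Set.mem_ofPred_eq] at hx
  refine Finset.prod_ne_zero_iff.2 fun i _ => ?_
  by_cases hi : i ∈ S
  · rw [hval x i hi]
    unfold stp
    rw [if_pos ((hx i).1 hi).2.le, if_neg (not_le.2 ((hx i).1 hi).1)]
    norm_num
  · rw [hval' x i hi]
    unfold stp
    rw [if_pos ((hx i).2 hi).le]
    norm_num

end Fan

set_option linter.unusedSectionVars false
set_option linter.unusedVariables false
open scoped Pointwise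
open MeasureTheory

theorem diffL_eq_zero_of_ball {V : Type*} [NormedAddCommGroup V] [NormedSpace ℝ V] (l : List V) :
    ∀ (G : V → ℝ) (h : V), (∀ y, ‖y - h‖ ≤ (l.map norm).sum → G y = 0) → diffL l G h = 0 := by
  induction l with
  | nil => intro G h H; exact H h (by simp)
  | cons a l ih =>
    intro G h H
    simp only [List.map_cons, List.sum_cons] at H
    rw [diffL_cons, ih G h (fun y hy => H y (by linarith [norm_nonneg a])), sub_zero]
    refine ih G _ fun y hy => H y ?_
    have : y - h = a + (y - (h + a)) := by abel
    rw [this]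
    exact (norm_add_le _ _).trans (by linarith)

theorem list_decomp {ι : Type*} [DecidableEq ι] (L : List (ι × ℝ)) : ∃ L1 L2, L.Perm (L1 ++ L2) ∧
    (L1.map Prod.fst).Nodup ∧ ∀ i, i ∈ L.map Prod.fst ↔ i ∈ L1.map Prod.fst := by
  induction L with
  | nil => exact ⟨[], [], by simp, by simp, by simp⟩
  | cons p L ih =>
    obtain ⟨L1, L2, h1, h2, h3⟩ := ih
    by_cases hp : p.1 ∈ L1.map Prod.fst
    · refine ⟨L1, p :: L2, ?_, h2, ?_⟩
      · exact (h1.cons p).trans List.perm_middle.symm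
      · intro i
        rw [List.map_cons, List.mem_cons, h3]
        constructor
        · rintro (rfl | h)
          · exact hp
          · exact h
        · exact Or.inr
    · refine ⟨p :: L1, L2, h1.cons p, ?_, ?_⟩
      · rw [List.map_cons, List.nodup_cons]; exact ⟨hp, h2⟩
      · intro i
        rw [List.map_cons, List.mem_cons, h3, List.map_cons, List.mem_cons]

namespace Fan
variable {n : ℕ} {ι : Type*} [Fintype ι] [DecidableEq ι] (F : Fan n ι)

theorem norm_vec (p : ι × ℝ) : ‖(vec p : ι → ℝ)‖ = |p.2| := by
  unfold vec
  exact Pi.norm_single (G := fun _ : ι => ℝ) p.2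

theorem diffL_ell (l : List (ι → ℝ)) (h : ι → ℝ) (v : EuclideanSpace ℝ (Fin n)) :
    diffL l F.f (h + F.ell v) = diffL l F.f h := by
  rw [← diffL_shift]
  congr 1
  funext y
  exact F.f_ell y v

theorem face_card {I : Finset ι} (hI : F.face I) : I.card ≤ n := by
  obtain ⟨S, hS, h⟩ := hI
  rw [← F.card S hS]
  exact Finset.card_le_card h

theorem sum_norm_vec_le (L : List (ι × ℝ)) (δ : ℝ) (hs : ∀ p ∈ L, |p.2| ≤ δ) :
    ((L.map (vec (ι := ι))).map norm).sum ≤ L.length * δ := by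
  have := List.sum_le_card_nsmul ((L.map (vec (ι := ι))).map norm) δ (by
    intro x hx
    simp only [List.map_map, List.mem_map, Function.comp] at hx
    obtain ⟨p, hp, rfl⟩ := hx
    rw [norm_vec]; exact hs p hp)
  simpa using this

theorem van_notface (L : List (ι × ℝ)) (hI : ¬ F.face (L.map Prod.fst).toFinset)
    (h : ι → ℝ) (δ : ℝ) (hδ : 0 ≤ δ)
    (hT : ∀ y, ‖y - h‖ ≤ (L.length + 1) * δ → y ∈ F.T) (hs : ∀ p ∈ L, |p.2| ≤ δ) :
    diffL (L.map vec) F.f h = 0 := by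
  obtain ⟨L1, L2, h1, h2, h3⟩ := list_decomp L
  rw [diffL_perm (h1.map vec), List.map_append, diffL_append]
  have hlen : (L2.length : ℝ) ≤ L.length := by
    have := h1.length_eq
    rw [List.length_append] at this
    exact_mod_cast (by omega : L2.length ≤ L.length)
  apply diffL_eq_zero_of_ball
  intro y hy
  have hs2 : ∀ p ∈ L2, |p.2| ≤ δ := fun p hp => hs p (h1.mem_iff.2 (List.mem_append_right _ hp))
  have hy' := hy.trans (sum_norm_vec_le L2 δ hs2)
  have : (L.map Prod.fst).toFinset = (L1.map Prod.fst).toFinset := by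
    ext i; rw [List.mem_toFinset, List.mem_toFinset]; exact h3 i
  refine F.diffL_notface L1 h2 (this ▸ hI) y δ hδ (fun z hz => hT z ?_)
    (fun p hp => hs p (h1.mem_iff.2 (List.mem_append_left _ hp)))
  have e : z - h = (z - y) + (y - h) := by abel
  rw [e]
  refine (norm_add_le _ _).trans ?_
  have := mul_le_mul_of_nonneg_right hlen hδ
  linarith

theorem van_coord (k : ℕ) : ∃ C : ℝ, 0 ≤ C ∧ ∀ L : List (ι × ℝ), L.length = n + 1 →
    n + 1 ≤ (L.map Prod.fst).toFinset.card + k → ∀ (h : ι → ℝ) (δ : ℝ), 0 ≤ δ →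
    (∀ y, ‖y - h‖ ≤ C * δ → y ∈ F.T) → (∀ p ∈ L, |p.2| ≤ δ) → diffL (L.map vec) F.f h = 0 := by
  induction k with
  | zero =>
    refine ⟨n + 2, by positivity, fun L hL hc h δ hδ hT hs => ?_⟩
    refine F.van_notface L (fun hf => ?_) h δ hδ (by rw [hL]; push_cast; convert hT using 4; ring) hs
    have := F.face_card hf
    omega
  | succ k ih =>
    obtain ⟨C, hC, ih⟩ := ih
    have hv : ∀ (I : Finset ι) (i : ι), ∃ v, F.face I →
        ∀ j ∈ I, inner ℝ (F.u j) v = if j = i then (1:ℝ) else 0 := by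
      intro I i
      by_cases hI : F.face I
      · obtain ⟨v, hv⟩ := F.exists_inner hI (fun j => if j = i then (1:ℝ) else 0)
        exact ⟨v, fun _ => hv⟩
      · exact ⟨0, fun h => absurd h hI⟩
    choose v hv using hv
    obtain ⟨D, hD⟩ := Finite.bddAbove_range
      (fun q : Finset ι × ι × ι => |inner ℝ (F.u q.2.2) (v q.1 q.2.1)|)
    have hD' : ∀ I i j, |inner ℝ (F.u j) (v I i)| ≤ |D| + 1 := fun I i j =>
      (hD ⟨(I, i, j), rfl⟩).trans ((le_abs_self D).trans (by linarith))
    set D1 := |D| + 1 with hD1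
    have hD1' : 1 ≤ D1 := by rw [hD1]; linarith [abs_nonneg D]
    refine ⟨C * D1 + Fintype.card ι * D1 + (n + 2), by positivity, fun L hL hc h δ hδ hT hs => ?_⟩
    by_cases hf : F.face (L.map Prod.fst).toFinset
    swap
    · refine F.van_notface L hf h δ hδ (fun y hy => hT y (hy.trans ?_)) hs
      refine mul_le_mul_of_nonneg_right ?_ hδ
      rw [hL]; push_cast
      have : 0 ≤ C * D1 + Fintype.card ι * D1 := by positivity
      linarith
    obtain ⟨L1, L2, h1, h2, h3⟩ := list_decomp L
    set I := (L.map Prod.fst).toFinset with hIdef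
    have hI1 : I = (L1.map Prod.fst).toFinset := by
      ext i; rw [hIdef, List.mem_toFinset, List.mem_toFinset]; exact h3 i
    have hcard := F.face_card hf
    have hl1 : L1.length ≤ n := by
      rw [hI1, List.toFinset_card_of_nodup h2, List.length_map] at hcard
      exact hcard
    have hlen := h1.length_eq
    rw [List.length_append] at hlen
    obtain ⟨p, L3, rfl⟩ : ∃ p L3, L2 = p :: L3 := by
      cases L2 with
      | nil => simp at hlen; omega
      | cons p L3 => exact ⟨p, L3, rfl⟩
    set L' := L1 ++ L3 with hL'
    have hperm : L.Perm (p :: L') := h1.trans List.perm_middle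
    have hpI : p.1 ∈ I := by
      rw [hIdef, List.mem_toFinset]
      exact List.mem_map_of_mem (hperm.mem_iff.2 List.mem_cons_self)
    have hIL' : I = (L'.map Prod.fst).toFinset := by
      ext i
      constructor
      · intro hi
        rw [hI1] at hi
        rw [List.mem_toFinset] at hi ⊢
        rw [hL', List.map_append]
        exact List.mem_append_left _ hi
      · intro hi
        rw [List.mem_toFinset] at hi
        rw [hIdef, List.mem_toFinset]
        obtain ⟨q, hq, rfl⟩ := List.mem_map.1 hi
        exact List.mem_map_of_mem (hperm.mem_iff.2 (List.mem_cons_of_mem _ hq))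
    rw [diffL_perm (hperm.map vec), List.map_cons, diffL_cons]
    set w := v I p.1 with hw
    have hwI : ∀ j ∈ I, inner ℝ (F.u j) w = if j = p.1 then (1:ℝ) else 0 := hv I p.1 hf
    have hps : |p.2| ≤ δ := hs p (hperm.mem_iff.2 List.mem_cons_self)
    let b : ι → (ι → ℝ) := fun j => vec (j, -(p.2 * inner ℝ (F.u j) w))
    have hb : ∀ j, |-(p.2 * inner ℝ (F.u j) w)| ≤ D1 * δ := fun j => by
      rw [abs_neg, abs_mul, mul_comm]
      exact mul_le_mul (hD' I p.1 j) hps (abs_nonneg _) (by linarith)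
    have hvec : h + vec p = (h + ∑ j ∈ Iᶜ, b j) + F.ell (p.2 • w) := by
      rw [add_assoc]
      congr 1
      funext j
      simp only [b, vec, Pi.add_apply, Finset.sum_apply, F.ell_smul, Pi.smul_apply, smul_eq_mul, ell,
        Pi.single_apply]
      rw [Finset.sum_ite_eq]
      by_cases hj : j ∈ I
      · simp [hj, hwI j hj]
      · have : j ≠ p.1 := fun e => hj (e ▸ hpI)
        simp [hj, this]
    rw [hvec, F.diffL_ell, sub_eq_zero]
    apply telescoping_zero
    intro t ht j hj
    have hj' : j ∉ I := Finset.mem_compl.1 hj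
    rw [← sub_eq_zero, ← diffL_cons]
    have hnorm : ‖∑ j ∈ t, b j‖ ≤ Fintype.card ι * D1 * δ := by
      refine (norm_sum_le _ _).trans ?_
      refine (Finset.sum_le_sum (fun j _ => (norm_vec _).trans_le (hb j))).trans ?_
      rw [Finset.sum_const, nsmul_eq_mul, mul_assoc]
      refine mul_le_mul_of_nonneg_right ?_ (by positivity)
      exact_mod_cast Finset.card_le_univ t
    refine ih ((j, _) :: L') (by simp [hL'] at hlen ⊢; omega) ?_ _ (D1 * δ) (by positivity) ?_ ?_
    · rw [List.map_cons, List.toFinset_cons, ← hIL', Finset.card_insert_of_notMem hj']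
      omega
    · intro y hy
      apply hT
      have e : y - h = (y - (h + ∑ j ∈ t, b j)) + ∑ j ∈ t, b j := by abel
      rw [e]
      refine (norm_add_le _ _).trans ?_
      have : (0:ℝ) ≤ (n + 2) * δ := by positivity
      nlinarith
    · intro q hq
      rcases List.mem_cons.1 hq with rfl | hq
      · exact hb j
      · refine (hs q (hperm.mem_iff.2 (List.mem_cons_of_mem _ hq))).trans ?_
        nlinarith

theorem van_small : ∃ C : ℝ, 0 ≤ C ∧ ∀ l : List (ι → ℝ), l.length = n + 1 →
    ∀ (h : ι → ℝ) (δ : ℝ), 0 ≤ δ →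
    (∀ y, ‖y - h‖ ≤ C * δ → y ∈ F.T) → (∀ a ∈ l, ‖a‖ ≤ δ) → diffL l F.f h = 0 := by
  obtain ⟨C, hC, hv⟩ := F.van_coord (n + 1)
  have key : ∀ (l : List (ι → ℝ)) (L : List (ι × ℝ)), L.length + l.length = n + 1 →
      ∀ (h : ι → ℝ) (δ : ℝ), 0 ≤ δ →
      (∀ y, ‖y - h‖ ≤ (C + l.length * Fintype.card ι) * δ → y ∈ F.T) → (∀ a ∈ l, ‖a‖ ≤ δ) →
      (∀ p ∈ L, |p.2| ≤ δ) → diffL (L.map vec ++ l) F.f h = 0 := by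
    intro l
    induction l with
    | nil =>
      intro L hL h δ hδ hT _ hs
      rw [List.append_nil]
      exact hv L (by simpa using hL) (by omega) h δ hδ (by simpa using hT) hs
    | cons a l ih =>
      intro L hL h δ hδ hT ha hs
      rw [diffL_perm List.perm_middle, diffL_cons, sub_eq_zero]
      have hae : a = ∑ j, vec (j, a j) := by
        simp only [vec]; exact (Finset.univ_sum_single a).symm
      have haj : ∀ j, |a j| ≤ δ := fun j => (norm_le_pi_norm a j).trans (ha a List.mem_cons_self)
      conv_lhs => rw [hae]
      apply telescoping_zero
      intro t _ j _
      rw [← sub_eq_zero, ← diffL_cons]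
      have hnorm : ‖∑ j ∈ t, (vec (j, a j) : ι → ℝ)‖ ≤ Fintype.card ι * δ := by
        refine (norm_sum_le _ _).trans ?_
        refine (Finset.sum_le_sum (fun j _ => (norm_vec _).trans_le (haj j))).trans ?_
        rw [Finset.sum_const, nsmul_eq_mul]
        refine mul_le_mul_of_nonneg_right ?_ (by positivity)
        exact_mod_cast Finset.card_le_univ t
      refine ih ((j, a j) :: L) (by simp at hL ⊢; omega) _ δ hδ ?_
        (fun b hb => ha b (List.mem_cons_of_mem _ hb)) ?_
      · intro y hy
        apply hT
        have e : y - h = (y - (h + ∑ j ∈ t, vec (j, a j))) + ∑ j ∈ t, vec (j, a j) := by abel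
        rw [e]
        refine (norm_add_le _ _).trans ?_
        rw [List.length_cons]
        push_cast
        nlinarith
      · intro q hq
        rcases List.mem_cons.1 hq with rfl | hq
        · exact haj j
        · exact hs q hq
  refine ⟨C + (n + 1) * Fintype.card ι, by positivity, fun l hl h δ hδ hT ha => ?_⟩
  exact key l [] (by simpa using hl) h δ hδ (by rw [hl]; push_cast; exact hT) ha (by simp)

theorem van (l : List (ι → ℝ)) (hl : l.length = n + 1) (h : ι → ℝ)
    (hT : ∀ y ∈ ptsL l, h + y ∈ F.T) : diffL l F.f h = 0 := by
  obtain ⟨C, hC, hv⟩ := F.van_small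
  have hcomp : IsCompact ((fun y => h + y) '' ptsL l) := (isCompact_ptsL l).image (by fun_prop)
  obtain ⟨ε, hε, hsub⟩ := hcomp.exists_cthickening_subset_open F.isOpen_T
    (by rintro _ ⟨y, hy, rfl⟩; exact hT y hy)
  set R := (l.map norm).sum with hR
  have hR0 : 0 ≤ R := List.sum_nonneg (by simp)
  obtain ⟨m, hm⟩ := exists_nat_gt (C * R / ε)
  have hmpos : (0:ℝ) < m := lt_of_le_of_lt (by positivity) hm
  refine diffL_subdivide m (by exact_mod_cast hmpos) l F.f h fun y hy => ?_
  refine hv _ (by simpa using hl) _ ((m:ℝ)⁻¹ * R) (by positivity) ?_ ?_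
  · intro z hz
    apply hsub
    refine Metric.mem_cthickening_of_dist_le z (h + y) ε _ ⟨y, hy, rfl⟩ ?_
    rw [dist_eq_norm]
    refine hz.trans ?_
    rw [div_lt_iff₀ hε] at hm
    have : C * ((m:ℝ)⁻¹ * R) = (m:ℝ)⁻¹ * (C * R) := by ring
    rw [this, inv_mul_le_iff₀ hmpos]
    exact hm.le
  · intro a ha
    obtain ⟨b, hb, rfl⟩ := List.mem_map.1 ha
    rw [norm_smul, norm_inv, Real.norm_of_nonneg hmpos.le]
    refine mul_le_mul_of_nonneg_left ?_ (by positivity)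
    exact List.single_le_sum (by simp) _ (List.mem_map_of_mem hb)

end Fan

set_option linter.unusedSectionVars false
set_option linter.unusedVariables false
open scoped Pointwise
open MeasureTheory

namespace Fan
variable {n : ℕ} {ι : Type*} [Fintype ι] [DecidableEq ι] (F : Fan n ι)

theorem exists_ball (R : ℝ) : ∃ h, ∀ y, ‖y - h‖ ≤ R → y ∈ F.T := by
  obtain ⟨c, hc⟩ := F.ne
  have hc : c ∈ F.T := hc
  obtain ⟨ε, hε, hb⟩ := Metric.isOpen_iff.1 F.isOpen_T c hc
  set t := (|R| + 1) / ε with ht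
  have htp : 0 < t := by positivity
  refine ⟨t • c, fun y hy => ?_⟩
  have : y = t • (t⁻¹ • y) := by rw [smul_smul, mul_inv_cancel₀ htp.ne', one_smul]
  rw [this]
  refine F.T_smul (hb ?_) htp
  rw [Metric.mem_ball, dist_eq_norm]
  have e : t⁻¹ • y - c = t⁻¹ • (y - t • c) := by
    rw [smul_sub, smul_smul, inv_mul_cancel₀ htp.ne', one_smul]
  rw [e, norm_smul, norm_inv, Real.norm_of_nonneg htp.le, inv_mul_lt_iff₀ htp, ht,
    div_mul_cancel₀ _ hε.ne']
  linarith [le_abs_self R]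

/-- A point deep in the type cone. -/
noncomputable def base (R : ℝ) : ι → ℝ := (F.exists_ball R).choose

/-- The polarized volume form. -/
noncomputable def M (l : List (ι → ℝ)) : ℝ :=
  diffL l F.f (F.base (l.map norm).sum)

/-- A good base point. -/
def good (l : List (ι → ℝ)) (h : ι → ℝ) : Prop := ∀ y ∈ ptsL l, h + y ∈ F.T

theorem zero_mem_ptsL (l : List (ι → ℝ)) : (0 : ι → ℝ) ∈ ptsL l := by
  induction l with
  | nil => exact rfl
  | cons a l ih => exact ⟨0, ⟨0, by simp, by simp⟩, 0, ih, by simp⟩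

theorem good_of_ball {l : List (ι → ℝ)} {h : ι → ℝ} {R : ℝ} (hR : (l.map norm).sum ≤ R)
    (H : ∀ y, ‖y - h‖ ≤ R → y ∈ F.T) : F.good l h := fun y hy =>
  H _ (by rw [add_sub_cancel_left]; exact (ptsL_norm_le l y hy).trans hR)

theorem diffL_good_add {l : List (ι → ℝ)} (hl : l.length = n) {h h' : ι → ℝ} (hg : F.good l h)
    (hT : h' ∈ F.T) : diffL l F.f (h + h') = diffL l F.f h := by
  rw [← sub_eq_zero, ← diffL_cons]
  apply F.van _ (by simp [hl])
  rintro _ ⟨_, ⟨t, ht, rfl⟩, y, hy, rfl⟩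
  have e : h + (t • h' + y) = (h + y) + t • h' := by abel
  simp only [e]
  rcases ht.1.eq_or_lt with h0 | h0
  · rw [← h0, zero_smul, add_zero]; exact hg y hy
  · exact F.T_add (hg y hy) (F.T_smul hT h0)

theorem good_mem {l : List (ι → ℝ)} {h : ι → ℝ} (hg : F.good l h) : h ∈ F.T := by
  simpa using hg 0 (zero_mem_ptsL l)

theorem M_eq {l : List (ι → ℝ)} (hl : l.length = n) {h : ι → ℝ} (hg : F.good l h) :
    F.M l = diffL l F.f h := by
  have h1 := (F.exists_ball (l.map norm).sum).choose_spec
  have g1 := F.good_of_ball le_rfl h1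
  change F.good l (F.base _) at g1
  rw [M, ← F.diffL_good_add hl hg (F.good_mem g1), add_comm, F.diffL_good_add hl g1 (F.good_mem hg)]

theorem M_perm {l l' : List (ι → ℝ)} (p : l.Perm l') : F.M l = F.M l' := by
  unfold M
  rw [diffL_perm p]
  have : (l.map norm).sum = (l'.map norm).sum := (p.map norm).sum_eq
  rw [this]

theorem M_add {l : List (ι → ℝ)} (hl : l.length + 1 = n) (a b : ι → ℝ) :
    F.M ((a + b) :: l) = F.M (a :: l) + F.M (b :: l) := by
  obtain ⟨h, hh⟩ := F.exists_ball (‖a‖ + ‖b‖ + (l.map norm).sum)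
  have ha := norm_nonneg a
  have hb := norm_nonneg b
  rw [F.M_eq (l := (a + b) :: l) (h := h) (by simpa using hl) (F.good_of_ball (by simpa using norm_add_le a b) hh),
    F.M_eq (l := a :: l) (h := h) (by simpa using hl) (F.good_of_ball (by simp) hh),
    F.M_eq (l := b :: l) (h := h + a) (by simpa using hl)
      (F.good_of_ball (R := ‖b‖ + (l.map norm).sum) (by simp) ?_)]
  · rw [diffL_cons, diffL_cons, diffL_cons, add_assoc]; ring
  · intro y hy
    apply hh
    have e : y - h = a + (y - (h + a)) := by abel
    rw [e]
    exact (norm_add_le _ _).trans (by linarith)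

theorem diffL_bound (l : List (ι → ℝ)) : ∀ (h : ι → ℝ) (r : ℝ), ‖h‖ + (l.map norm).sum ≤ r →
    |diffL l F.f h| ≤ 2 ^ l.length * F.f (fun _ => r) := by
  induction l with
  | nil =>
    intro h r hr
    simp only [diffL, List.length_nil, pow_zero, one_mul]
    rw [abs_of_nonneg (F.f_nonneg _)]
    refine F.f_mono fun i => ?_
    exact (le_abs_self _).trans ((norm_le_pi_norm h i).trans (by simpa using hr))
  | cons a l ih =>
    intro h r hr
    simp only [List.map_cons, List.sum_cons] at hr
    have := norm_nonneg a
    have h1 := ih (h + a) r (by linarith [norm_add_le h a])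
    have h2 := ih h r (by linarith)
    rw [diffL_cons, List.length_cons, pow_succ]
    refine (abs_sub _ _).trans ?_
    linarith

theorem M_linear {l : List (ι → ℝ)} (hl : l.length + 1 = n) :
    ∃ φ : (ι → ℝ) →ₗ[ℝ] ℝ, ∀ a, F.M (a :: l) = φ a := by
  let g : (ι → ℝ) →+ ℝ := AddMonoidHom.mk' (fun a => F.M (a :: l)) (fun a b => F.M_add hl a b)
  have hg : Continuous g := by
    obtain ⟨h, hh⟩ := F.exists_ball (1 + (l.map norm).sum)
    refine AddMonoidHom.continuous_of_isBounded_nhds_zero g (Metric.closedBall_mem_nhds 0 one_pos) ?_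
    refine isBounded_iff_forall_norm_le.2 ⟨2 ^ (l.length + 1) * F.f (fun _ => ‖h‖ + (1 + (l.map norm).sum)), ?_⟩
    rintro _ ⟨a, ha, rfl⟩
    have ha' : ‖a‖ ≤ 1 := by simpa using ha
    change |F.M (a :: l)| ≤ _
    rw [F.M_eq (l := a :: l) (h := h) (by simpa using hl) (F.good_of_ball (by simpa using ha') hh)]
    refine F.diffL_bound (a :: l) h _ (by simpa using ha')
  exact ⟨(g.toRealLinearMap hg).toLinearMap, fun a => rfl⟩

theorem M_smul {l : List (ι → ℝ)} (hl : l.length + 1 = n) (t : ℝ) (a : ι → ℝ) :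
    F.M ((t • a) :: l) = t * F.M (a :: l) := by
  obtain ⟨φ, hφ⟩ := F.M_linear hl
  rw [hφ, hφ, map_smul, smul_eq_mul]

theorem M_ell {l : List (ι → ℝ)} (v : EuclideanSpace ℝ (Fin n)) :
    F.M (F.ell v :: l) = 0 := by
  unfold M
  rw [diffL_cons, F.diffL_ell, sub_self]

/-- Coordinate vectors. -/
def e (i : ι) : ι → ℝ := Pi.single i 1

theorem M_notface {I : Finset ι} (hI : ¬ F.face I) (l : List (ι → ℝ)) (hl : I.card + l.length = n) :
    F.M (I.toList.map e ++ l) = 0 := by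
  obtain ⟨h, hh⟩ := F.exists_ball (((I.toList.map e ++ l).map norm).sum + 1)
  have hmap : (I.toList.map e : List (ι → ℝ)) = (I.toList.map (fun i => (i, (1:ℝ)))).map vec := by
    rw [List.map_map]; rfl
  have hfst : (I.toList.map (fun i => (i, (1:ℝ)))).map Prod.fst = I.toList := by
    rw [List.map_map]; exact List.map_id _
  rw [F.M_eq (l := I.toList.map e ++ l) (h := h) (by simpa using hl) (F.good_of_ball (by linarith) hh),
    diffL_append]
  apply diffL_eq_zero_of_ball
  intro y hy
  rw [hmap]
  refine F.diffL_notface _ (by rw [hfst]; exact I.nodup_toList) (by rw [hfst]; simpa using hI) y 1 zero_le_one ?_ ?_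
  · intro z hz
    apply hh
    have e : z - h = (z - y) + (y - h) := by abel
    rw [e]
    refine (norm_add_le _ _).trans ?_
    rw [List.map_append, List.sum_append]
    have : 0 ≤ ((I.toList.map (Fan.e (ι := ι))).map norm).sum := List.sum_nonneg (by simp)
    linarith
  · intro p hp
    obtain ⟨i, _, rfl⟩ := List.mem_map.1 hp
    simp

theorem M_pos {S : Finset ι} (hS : S ∈ F.B) : 0 < F.M (S.toList.map e) := by
  obtain ⟨h, hh⟩ := F.exists_ball (((S.toList.map (e (ι := ι))).map norm).sum + 1)
  have hmap : (S.toList.map e : List (ι → ℝ)) = (S.toList.map (fun i => (i, (1:ℝ)))).map vec := by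
    rw [List.map_map]; rfl
  rw [F.M_eq (l := S.toList.map e) (h := h) (by simpa using F.card S hS) (F.good_of_ball (by linarith) hh), hmap]
  refine F.diffL_pos hS h fun y hy => hh y (hy.trans ?_)
  have : 0 ≤ ((S.toList.map (Fan.e (ι := ι))).map norm).sum := List.sum_nonneg (by simp)
  linarith

theorem P_add {c d : ι → ℝ} (hc : c ∈ F.T) (hd : d ∈ F.T) : F.P c + F.P d = F.P (c + d) := by
  apply Set.Subset.antisymm
  · rintro _ ⟨x, hx, y, hy, rfl⟩ i
    rw [inner_add_right]
    exact add_le_add (hx i) (hy i)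
  · intro x hx
    by_contra hcon
    obtain ⟨g, r, h1, h2⟩ := geometric_hahn_banach_closed_point
      ((F.convex_P c).add (F.convex_P d)) ((F.isCompact_P c).add (F.isCompact_P d)).isClosed hcon
    set w := (InnerProductSpace.toDual ℝ (EuclideanSpace ℝ (Fin n))).symm g with hw
    have hg : ∀ y, g y = inner ℝ w y := fun y => by
      rw [hw, InnerProductSpace.toDual_symm_apply]
    obtain ⟨S, hS, α, h0, hz, hwe⟩ := F.cover w
    have h3 := h1 _ ⟨_, F.X_mem hc hS, _, F.X_mem hd hS, rfl⟩
    have h4 : g x ≤ g (F.X S c + F.X S d) := by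
      rw [hg, hg, hwe, sum_inner, sum_inner]
      refine Finset.sum_le_sum fun i _ => ?_
      rw [real_inner_smul_left, real_inner_smul_left]
      by_cases hi : i ∈ S
      · rw [inner_add_right, F.tight S hS i hi, F.tight S hS i hi]
        exact mul_le_mul_of_nonneg_left (hx i) (h0 i)
      · simp [hz i hi]
    linarith

theorem T_sum {κ : Type*} {s : Finset κ} (hs : s.Nonempty) (a : κ → ι → ℝ) (ha : ∀ k, a k ∈ F.T) :
    ∑ k ∈ s, a k ∈ F.T := by
  classical
  induction hs using Finset.Nonempty.cons_induction with
  | singleton k => simpa using ha k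
  | cons k s hk hs ih => rw [Finset.sum_cons]; exact F.T_add (ha k) ih

theorem P_sum {κ : Type*} {s : Finset κ} (hs : s.Nonempty) (a : κ → ι → ℝ) (ha : ∀ k, a k ∈ F.T) :
    ∑ k ∈ s, F.P (a k) = F.P (∑ k ∈ s, a k) := by
  classical
  induction hs using Finset.Nonempty.cons_induction with
  | singleton k => simp
  | cons k s hk hs ih =>
    rw [Finset.sum_cons, Finset.sum_cons, ih, F.P_add (ha k) (F.T_sum hs a ha)]

theorem f_tendsto {a h : ι → ℝ} (ha : a ∈ F.T) (hh : h ∈ F.T) :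
    Filter.Tendsto (fun η : ℝ => F.f (η • h + a)) (nhdsWithin 0 (Set.Ioi 0)) (nhds (F.f a)) := by
  obtain ⟨p, -, hp⟩ := F.exists_relint ha F.face_empty
  obtain ⟨q, -, hq⟩ := F.exists_relint hh F.face_empty
  set a' := a + F.ell (-p) with ha'
  set h' := h + F.ell (-q) with hh'
  have pa : ∀ i, 0 < a' i := fun i => by
    have := hp i (by simp)
    simp only [ha', ell, Pi.add_apply, inner_neg_right]; linarith
  have ph : ∀ i, 0 < h' i := fun i => by
    have := hq i (by simp)
    simp only [hh', ell, Pi.add_apply, inner_neg_right]; linarith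
  obtain ⟨C, hC⟩ := Finite.bddAbove_range (fun i => h' i / a' i)
  have hC' : ∀ i, h' i ≤ |C| * a' i := fun i => by
    have := hC ⟨i, rfl⟩
    simp only at this
    rw [div_le_iff₀ (pa i)] at this
    exact this.trans (mul_le_mul_of_nonneg_right (le_abs_self C) (pa i).le)
  have e1 : ∀ η : ℝ, F.f (η • h + a) = F.f (η • h' + a') := fun η => by
    have : η • h' + a' = (η • h + a) + F.ell (η • (-q) + (-p)) := by
      rw [F.ell_add, F.ell_smul, hh', ha', smul_add]; abel
    rw [this, F.f_ell]
  have e2 : F.f a = F.f a' := by rw [ha', F.f_ell]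
  simp_rw [e1]
  rw [e2]
  have hlim : Filter.Tendsto (fun η : ℝ => (1 + |C| * η) ^ n * F.f a') (nhdsWithin 0 (Set.Ioi 0))
      (nhds (F.f a')) := by
    have : Continuous fun η : ℝ => (1 + |C| * η) ^ n * F.f a' := by fun_prop
    have := (this.tendsto 0).mono_left (nhdsWithin_le_nhds (s := Set.Ioi 0))
    simpa using this
  refine tendsto_of_tendsto_of_tendsto_of_le_of_le' tendsto_const_nhds hlim ?_ ?_
  · filter_upwards [self_mem_nhdsWithin] with η hη
    have hη : 0 < η := hη
    refine F.f_mono fun i => ?_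
    have := mul_pos hη (ph i)
    simp only [Pi.add_apply, Pi.smul_apply, smul_eq_mul]; linarith
  · filter_upwards [self_mem_nhdsWithin] with η hη
    have hη : 0 < η := hη
    rw [← F.f_smul a' (t := 1 + |C| * η) (by positivity)]
    refine F.f_mono fun i => ?_
    have := mul_le_mul_of_nonneg_left (hC' i) hη.le
    simp only [Pi.add_apply, Pi.smul_apply, smul_eq_mul]; linarith

theorem diffL_finset {κ : Type*} [DecidableEq κ] (s : Finset κ) (a : κ → ι → ℝ) (f : (ι → ℝ) → ℝ) :
    ∀ h, diffL (s.toList.map a) f h =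
      ∑ t ∈ s.powerset, (-1 : ℝ) ^ (s.card + t.card) * f (h + ∑ k ∈ t, a k) := by
  induction s using Finset.induction_on with
  | empty => intro h; simp [diffL]
  | insert k s hk ih =>
    intro h
    have hp := (Finset.toList_insert hk).map a
    rw [diffL_perm hp, List.map_cons, diffL_cons, ih, ih, Finset.sum_powerset_insert hk,
      sub_eq_add_neg, ← Finset.sum_neg_distrib, add_comm]
    congr 1
    · refine Finset.sum_congr rfl fun t ht => ?_
      rw [Finset.card_insert_of_notMem hk]; ring
    · refine Finset.sum_congr rfl fun t ht => ?_
      have hkt : k ∉ t := fun h => hk (Finset.mem_powerset.1 ht h)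
      rw [Finset.card_insert_of_notMem hk, Finset.card_insert_of_notMem hkt, Finset.sum_insert hkt, ← add_assoc h]
      ring

theorem ptsL_T (l : List (ι → ℝ)) (hl : ∀ a ∈ l, a ∈ F.T) : ∀ h ∈ F.T, F.good l h := by
  induction l with
  | nil => intro h hh y hy; rw [show y = 0 from hy, add_zero]; exact hh
  | cons a l ih =>
    rintro h hh _ ⟨_, ⟨t, ht, rfl⟩, y, hy, rfl⟩
    simp only
    rw [← add_assoc]
    refine ih (fun b hb => hl b (List.mem_cons_of_mem _ hb)) _ ?_ y hy
    rcases ht.1.eq_or_lt with h0 | h0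
    · rw [← h0, zero_smul, add_zero]; exact hh
    · exact F.T_add hh (F.T_smul (hl a List.mem_cons_self) h0)

theorem M_volume (hn : 1 ≤ n) (a : Fin n → ι → ℝ) (ha : ∀ k, a k ∈ F.T) :
    F.M (Finset.univ.toList.map a) =
      ∑ S : Finset (Fin n), (-1 : ℝ) ^ (n + S.card) * (volume (∑ k ∈ S, F.P (a k))).toReal := by
  obtain ⟨h, hh⟩ := F.ne
  have hh : h ∈ F.T := hh
  have h1 : ∀ η : ℝ, 0 < η → F.M (Finset.univ.toList.map a) =
      ∑ S : Finset (Fin n), (-1 : ℝ) ^ (n + S.card) * F.f (η • h + ∑ k ∈ S, a k) := by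
    intro η hη
    rw [F.M_eq (h := η • h) (by simp) (F.ptsL_T _ (by
      intro b hb; obtain ⟨k, -, rfl⟩ := List.mem_map.1 hb; exact ha k) _ (F.T_smul hh hη)), diffL_finset]
    simp
  have h2 : Filter.Tendsto (fun η : ℝ => ∑ S : Finset (Fin n), (-1 : ℝ) ^ (n + S.card) *
      F.f (η • h + ∑ k ∈ S, a k)) (nhdsWithin 0 (Set.Ioi 0))
      (nhds (∑ S : Finset (Fin n), (-1 : ℝ) ^ (n + S.card) * (volume (∑ k ∈ S, F.P (a k))).toReal)) := by
    refine tendsto_finsetSum _ fun S _ => Filter.Tendsto.const_mul _ ?_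
    rcases S.eq_empty_or_nonempty with rfl | hS
    · have : (volume (∑ k ∈ (∅ : Finset (Fin n)), F.P (a k))).toReal = 0 := by
        have : Nonempty (Fin n) := ⟨⟨0, hn⟩⟩
        rw [Finset.sum_empty, ← Set.singleton_zero, measure_singleton, ENNReal.toReal_zero]
      rw [this]
      have hlim : Filter.Tendsto (fun η : ℝ => η ^ n * F.f h) (nhdsWithin 0 (Set.Ioi 0)) (nhds 0) := by
        have : Continuous fun η : ℝ => η ^ n * F.f h := by fun_prop
        have := (this.tendsto 0).mono_left (nhdsWithin_le_nhds (s := Set.Ioi 0))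
        rw [zero_pow (by omega), zero_mul] at this
        exact this
      refine hlim.congr' ?_
      filter_upwards [self_mem_nhdsWithin] with η hη
      rw [Finset.sum_empty, add_zero, F.f_smul h hη]
    · rw [F.P_sum hS a ha]
      exact F.f_tendsto (F.T_sum hS a ha) hh
  refine tendsto_nhds_unique (tendsto_const_nhds.congr' ?_) h2
  filter_upwards [self_mem_nhdsWithin] with η hη
  exact h1 η hη

theorem diffL_replicate (a : ι → ℝ) (k : ℕ) : ∀ (f : (ι → ℝ) → ℝ) (m : ℕ),
    diffL (List.replicate k a) f ((m : ℝ) • a) = (fwdDiff 1)^[k] (fun m : ℕ => f ((m : ℝ) • a)) m := by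
  induction k with
  | zero => intro f m; rfl
  | succ k ih =>
    intro f m
    rw [List.replicate_succ, Function.iterate_succ_apply]
    simp only [diffL]
    rw [ih]
    have : (fun m : ℕ => f ((m : ℝ) • a + a) - f ((m : ℝ) • a)) = fwdDiff 1 (fun m : ℕ => f ((m : ℝ) • a)) := by
      funext m
      simp only [fwdDiff]
      push_cast
      rw [add_smul, one_smul]
    rw [this]

theorem M_diag {a : ι → ℝ} (ha : a ∈ F.T) : F.M (List.replicate n a) = n.factorial * F.f a := by
  rw [F.M_eq (h := a) (by simp) (F.ptsL_T _ (fun b hb => by rw [List.eq_of_mem_replicate hb]; exact ha) a ha)]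
  have h1 := diffL_replicate a n F.f 1
  rw [Nat.cast_one, one_smul] at h1
  rw [h1, fwdDiff_iter_eq_sum_shift]
  have h2 : (n.factorial : ℝ) = (fwdDiff 1)^[n] (fun x : ℝ => x ^ n) 1 := by
    rw [fwdDiff_iter_eq_factorial]; simp
  rw [h2, fwdDiff_iter_eq_sum_shift, Finset.sum_mul]
  refine Finset.sum_congr rfl fun k _ => ?_
  rw [F.f_smul a (by positivity)]
  simp [zsmul_eq_mul, mul_assoc]

end Fan

set_option linter.unusedSectionVars false
set_option linter.unusedVariables false
open scoped Pointwise
open MeasureTheory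

section pf
variable {κ : Type*} [Fintype κ] [DecidableEq κ]

theorem lap_identity (Q : κ → κ → ℝ) (hQ : ∀ i j, Q i j = Q j i) (g x : κ → ℝ) (hg : ∀ i, g i ≠ 0) :
    ∑ i, (∑ j, Q i j * g j) * x i ^ 2 / g i - ∑ i, ∑ j, Q i j * x i * x j =
      1 / 2 * ∑ i, ∑ j, Q i j * g i * g j * (x i / g i - x j / g j) ^ 2 := by
  have e1 : ∀ i j, Q i j * g i * g j * (x i / g i - x j / g j) ^ 2 =
      Q i j * g j * x i ^ 2 / g i + Q j i * g i * x j ^ 2 / g j - 2 * (Q i j * x i * x j) := by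
    intro i j
    rw [hQ j i]
    have := hg i
    have := hg j
    field_simp
    ring
  have e2 : ∑ i, (∑ j, Q i j * g j) * x i ^ 2 / g i = ∑ i, ∑ j, Q i j * g j * x i ^ 2 / g i := by
    refine Finset.sum_congr rfl fun i _ => ?_
    rw [Finset.sum_mul, Finset.sum_div]
  have e3 : ∑ i, ∑ j, Q j i * g i * x j ^ 2 / g j = ∑ i, ∑ j, Q i j * g j * x i ^ 2 / g i := Finset.sum_comm
  simp_rw [e1, Finset.sum_sub_distrib, Finset.sum_add_distrib, ← Finset.mul_sum]
  rw [e2, e3]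
  ring

theorem pf_lemma (Q : κ → κ → ℝ) (hQ : ∀ i j, Q i j = Q j i) (hoff : ∀ i j, i ≠ j → 0 ≤ Q i j)
    (c : κ → ℝ) (hc : ∀ i, 0 < c i) (hb : ∀ i, 0 < ∑ j, Q i j * c j)
    (hconn : ∀ A : Finset κ, A.Nonempty → Aᶜ.Nonempty → ∃ i ∈ A, ∃ j ∈ Aᶜ, 0 < Q i j)
    (hboch : ∀ x : κ → ℝ, ∑ i, ∑ j, Q i j * x i * x j ≤
      ∑ i, c i * (∑ j, Q i j * x j) ^ 2 / (∑ j, Q i j * c j))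
    (x : κ → ℝ) (hx : ∑ i, (∑ j, Q i j * c j) * x i = 0) : ∑ i, ∑ j, Q i j * x i * x j ≤ 0 := by
  set b : κ → ℝ := fun i => ∑ j, Q i j * c j with hbdef
  set w : κ → ℝ := fun i => b i / c i with hw
  have hwpos : ∀ i, 0 < w i := fun i => div_pos (hb i) (hc i)
  have hwc : ∀ i, w i * c i = b i := fun i => div_mul_cancel₀ _ (hc i).ne'
  have hlap : ∀ y : κ → ℝ, ∑ i, w i * y i ^ 2 - ∑ i, ∑ j, Q i j * y i * y j =
      1 / 2 * ∑ i, ∑ j, Q i j * c i * c j * (y i / c i - y j / c j) ^ 2 := by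
    intro y
    rw [← lap_identity Q hQ c y (fun i => (hc i).ne')]
    congr 1
    refine Finset.sum_congr rfl fun i _ => ?_
    simp only [hw, hbdef]; ring
  have hterm : ∀ (y : κ → ℝ) i j, 0 ≤ Q i j * c i * c j * (y i / c i - y j / c j) ^ 2 := by
    intro y i j
    by_cases hij : i = j
    · subst hij; simp
    · have := hoff i j hij
      have := hc i
      have := hc j
      positivity
  have hpsd : ∀ y : κ → ℝ, 0 ≤ ∑ i, w i * y i ^ 2 - ∑ i, ∑ j, Q i j * y i * y j := by
    intro y
    rw [hlap]
    have : 0 ≤ ∑ i, ∑ j, Q i j * c i * c j * (y i / c i - y j / c j) ^ 2 :=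
      Finset.sum_nonneg fun i _ => Finset.sum_nonneg fun j _ => hterm y i j
    linarith
  have hker : ∀ y : κ → ℝ, ∑ i, w i * y i ^ 2 - ∑ i, ∑ j, Q i j * y i * y j = 0 →
      ∀ i k, y i / c i = y k / c k := by
    intro y hy
    rw [hlap] at hy
    have hz : ∑ i, ∑ j, Q i j * c i * c j * (y i / c i - y j / c j) ^ 2 = 0 := by linarith
    have hz' : ∀ i j, Q i j * c i * c j * (y i / c i - y j / c j) ^ 2 = 0 := by
      intro i j
      have h1 := (Finset.sum_eq_zero_iff_of_nonneg
        (fun i _ => Finset.sum_nonneg fun j _ => hterm y i j)).1 hz i (Finset.mem_univ i)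
      exact (Finset.sum_eq_zero_iff_of_nonneg (fun j _ => hterm y i j)).1 h1 j (Finset.mem_univ j)
    intro i k
    by_contra hne
    obtain ⟨a, ha, d, hd, hpos⟩ := hconn (Finset.univ.filter fun l => y l / c l = y i / c i)
      ⟨i, by simp⟩ ⟨k, by simp [Ne.symm hne]⟩
    have := hz' a d
    have ha' : y a / c a = y i / c i := by simpa using ha
    have hd' : y d / c d ≠ y i / c i := by simpa using hd
    have hne2 : y a / c a - y d / c d ≠ 0 := by rw [ha']; exact sub_ne_zero.2 (Ne.symm hd')
    have h1 := hc a
    have h2 := hc d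
    have : 0 < Q a d * c a * c d * (y a / c a - y d / c d) ^ 2 := by positivity
    linarith
  -- solve L y = W x
  let L : (κ → ℝ) →ₗ[ℝ] (κ → ℝ) :=
    { toFun := fun y i => w i * y i - ∑ j, Q i j * y j + (∑ j, b j * y j) * b i
      map_add' := fun y z => by
        funext i
        simp only [Pi.add_apply, mul_add, Finset.sum_add_distrib]; ring
      map_smul' := fun t y => by
        funext i
        simp only [Pi.smul_apply, smul_eq_mul, RingHom.id_apply]
        have h1 : ∑ j, Q i j * (t * y j) = t * ∑ j, Q i j * y j := by
          rw [Finset.mul_sum]; exact Finset.sum_congr rfl fun j _ => by ring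
        have h2 : ∑ j, b j * (t * y j) = t * ∑ j, b j * y j := by
          rw [Finset.mul_sum]; exact Finset.sum_congr rfl fun j _ => by ring
        rw [h1, h2]; ring }
  have hLq : ∀ y z : κ → ℝ, ∑ i, z i * L y i = ∑ i, w i * y i * z i - ∑ i, ∑ j, Q i j * z i * y j +
      (∑ j, b j * y j) * (∑ j, b j * z j) := by
    intro y z
    simp only [L, LinearMap.coe_mk, AddHom.coe_mk, mul_add, mul_sub, Finset.sum_add_distrib,
      Finset.sum_sub_distrib, Finset.mul_sum]
    congr 1
    · congr 1
      · exact Finset.sum_congr rfl fun j _ => by ring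
      · exact Finset.sum_congr rfl fun j _ => Finset.sum_congr rfl fun k _ => by ring
    · refine Finset.sum_congr rfl fun j _ => ?_
      rw [Finset.sum_mul, Finset.mul_sum, Finset.sum_mul]
      exact Finset.sum_congr rfl fun k _ => by ring
  have hLinj : Function.Injective L := by
    rw [← LinearMap.ker_eq_bot, LinearMap.ker_eq_bot']
    intro y hy
    have h1 := hLq y y
    rw [hy] at h1
    simp only [Pi.zero_apply, mul_zero, Finset.sum_const_zero] at h1
    have h2 := hpsd y
    have h3 : ∑ i, w i * y i * y i = ∑ i, w i * y i ^ 2 := Finset.sum_congr rfl fun j _ => by ring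
    rw [h3] at h1
    have h4 := mul_self_nonneg (∑ j, b j * y j)
    have h5 := hker y (by linarith)
    have h6 : ∑ j, b j * y j = 0 := mul_self_eq_zero.1 (by linarith)
    funext k
    have h7 : ∀ i, y i = y k / c k * c i := fun i => by
      rw [← h5 i k, div_mul_cancel₀ _ (hc i).ne']
    have h8 : y k / c k * ∑ j, b j * c j = 0 := by
      rw [← h6, Finset.mul_sum]
      exact Finset.sum_congr rfl fun j _ => by rw [h7 j]; ring
    have h9 : 0 < ∑ j, b j * c j :=
      Finset.sum_pos (fun j _ => mul_pos (hb j) (hc j)) ⟨k, Finset.mem_univ k⟩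
    rcases mul_eq_zero.1 h8 with h | h
    · rw [h7 k, h]; simp
    · exact absurd h h9.ne'
  obtain ⟨y, hy⟩ := (LinearMap.injective_iff_surjective.1 hLinj) (fun i => w i * x i)
  have hb0 : (∑ j, b j * y j) * (∑ j, b j * c j) = 0 := by
    have h1 := hLq y c
    rw [hy] at h1
    have h2 : ∑ i, c i * (w i * x i) = 0 := by
      rw [← hx]; exact Finset.sum_congr rfl fun j _ => by
        change _ = b j * x j
        rw [← hwc]; ring
    have h3 : ∑ i, w i * y i * c i = ∑ i, ∑ j, Q i j * c i * y j := by
      rw [Finset.sum_comm]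
      refine Finset.sum_congr rfl fun i _ => ?_
      have : ∑ j, Q j i * c j * y i = b i * y i := by
        simp only [hbdef]
        rw [Finset.sum_mul]; exact Finset.sum_congr rfl fun j _ => by rw [hQ i j]
      rw [this, ← hwc]; ring
    rw [h2, h3] at h1
    linarith
  have hby : ∑ j, b j * y j = 0 := by
    rcases mul_eq_zero.1 hb0 with h | h
    · exact h
    · have : IsEmpty κ := by
        by_contra hne
        rw [not_isEmpty_iff] at hne
        have : 0 < ∑ j, b j * c j :=
          Finset.sum_pos (fun j _ => mul_pos (hb j) (hc j)) Finset.univ_nonempty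
        linarith
      simp
  have hQy : ∀ i, ∑ j, Q i j * y j = w i * (y i - x i) := by
    intro i
    have := congrFun hy i
    simp only [L, LinearMap.coe_mk, AddHom.coe_mk, hby, zero_mul, add_zero] at this
    linarith
  have hB := hboch y
  have e1 : ∑ i, c i * (∑ j, Q i j * y j) ^ 2 / (∑ j, Q i j * c j) = ∑ i, w i * (y i - x i) ^ 2 := by
    refine Finset.sum_congr rfl fun i _ => ?_
    rw [hQy]
    change c i * (w i * (y i - x i)) ^ 2 / b i = _
    rw [← hwc i]
    have := (hc i).ne'
    have := (hwpos i).ne'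
    field_simp
  have e2 : ∀ z : κ → ℝ, ∑ i, ∑ j, Q i j * z i * y j = ∑ i, w i * (y i - x i) * z i := by
    intro z
    refine Finset.sum_congr rfl fun i _ => ?_
    rw [← hQy, Finset.sum_mul]; exact Finset.sum_congr rfl fun j _ => by ring
  rw [e1, e2 y] at hB
  have hP := hpsd (fun i => x i - y i)
  have e3 : ∑ i, ∑ j, Q i j * (x i - y i) * (x j - y j) = ∑ i, ∑ j, Q i j * x i * x j
      - 2 * ∑ i, ∑ j, Q i j * x i * y j + ∑ i, ∑ j, Q i j * y i * y j := by
    have e4 : ∑ i, ∑ j, Q i j * x i * y j = ∑ i, ∑ j, Q i j * y i * x j := by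
      rw [Finset.sum_comm]
      exact Finset.sum_congr rfl fun i _ => Finset.sum_congr rfl fun j _ => by rw [hQ]; ring
    rw [two_mul]
    nth_rewrite 2 [e4]
    simp only [← Finset.sum_add_distrib, ← Finset.sum_sub_distrib]
    exact Finset.sum_congr rfl fun i _ => Finset.sum_congr rfl fun j _ => by ring
  rw [e3, e2 x, e2 y] at hP
  have f1 : ∑ i, w i * (y i - x i) ^ 2 = ∑ i, w i * y i ^ 2 - 2 * ∑ i, w i * x i * y i + ∑ i, w i * x i ^ 2 := by
    rw [Finset.mul_sum, ← Finset.sum_sub_distrib, ← Finset.sum_add_distrib]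
    exact Finset.sum_congr rfl fun i _ => by ring
  have f2 : ∑ i, w i * (x i - y i) ^ 2 = ∑ i, w i * y i ^ 2 - 2 * ∑ i, w i * x i * y i + ∑ i, w i * x i ^ 2 := by
    rw [Finset.mul_sum, ← Finset.sum_sub_distrib, ← Finset.sum_add_distrib]
    exact Finset.sum_congr rfl fun i _ => by ring
  have f3 : ∑ i, w i * (y i - x i) * y i = ∑ i, w i * y i ^ 2 - ∑ i, w i * x i * y i := by
    rw [← Finset.sum_sub_distrib]
    exact Finset.sum_congr rfl fun i _ => by ring
  have f4 : ∑ i, w i * (y i - x i) * x i = ∑ i, w i * x i * y i - ∑ i, w i * x i ^ 2 := by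
    rw [← Finset.sum_sub_distrib]
    exact Finset.sum_congr rfl fun i _ => by ring
  rw [f1, f3] at hB
  rw [f2, f3, f4] at hP
  linarith

end pf

set_option linter.unusedSectionVars false
set_option linter.unusedVariables false
open scoped Pointwise
open MeasureTheory

namespace Fan
variable {n : ℕ} {ι : Type*} [Fintype ι] [DecidableEq ι] (F : Fan n ι)

/-- Mixed form restricted to a face. -/
noncomputable def N (l : List (ι → ℝ)) (I : Finset ι) : ℝ := F.M (l ++ I.toList.map e)

theorem N_perm {l l' : List (ι → ℝ)} (p : l.Perm l') (I : Finset ι) : F.N l I = F.N l' I :=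
  F.M_perm (p.append_right _)

theorem N_ell (v : EuclideanSpace ℝ (Fin n)) (l : List (ι → ℝ)) (I : Finset ι) :
    F.N (F.ell v :: l) I = 0 := F.M_ell v

theorem N_add {l : List (ι → ℝ)} {I : Finset ι} (hl : l.length + 1 + I.card = n) (a b : ι → ℝ) :
    F.N ((a + b) :: l) I = F.N (a :: l) I + F.N (b :: l) I :=
  F.M_add (by simp; omega) a b

theorem N_smul {l : List (ι → ℝ)} {I : Finset ι} (hl : l.length + 1 + I.card = n) (t : ℝ) (a : ι → ℝ) :
    F.N ((t • a) :: l) I = t * F.N (a :: l) I :=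
  F.M_smul (by simp; omega) t a

theorem N_e {i : ι} {I : Finset ι} (hi : i ∉ I) (l : List (ι → ℝ)) :
    F.N (e i :: l) I = F.N l (insert i I) := by
  apply F.M_perm
  have h1 := ((Finset.toList_insert hi).map (e (ι := ι))).symm
  exact List.perm_middle.symm.trans (h1.append_left l)

theorem N_notface {I : Finset ι} (hI : ¬ F.face I) (l : List (ι → ℝ)) (hl : l.length + I.card = n) :
    F.N l I = 0 := by
  have := F.M_notface hI l (by omega)
  rw [← this]
  exact F.M_perm List.perm_append_comm

open Classical in
/-- Link of a face. -/
noncomputable def J (I : Finset ι) : Finset ι := Finset.univ.filter fun i => i ∉ I ∧ F.face (insert i I)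

theorem mem_J {I : Finset ι} {i : ι} : i ∈ F.J I ↔ i ∉ I ∧ F.face (insert i I) := by simp [J]

theorem N_expand {I : Finset ι} {l : List (ι → ℝ)} (hl : l.length + 1 + I.card = n) (x : ι → ℝ)
    (hx : ∀ i ∈ I, x i = 0) : F.N (x :: l) I = ∑ i ∈ F.J I, x i * F.N (e i :: l) I := by
  obtain ⟨φ, hφ⟩ := F.M_linear (l := l ++ I.toList.map e) (by simp; omega)
  have h1 : ∀ a, F.N (a :: l) I = φ a := hφ
  simp_rw [h1]
  have h2 : x = ∑ i, x i • e i := by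
    funext k
    simp [e, Finset.sum_apply, Pi.single_apply]
  conv_lhs => rw [h2, map_sum]
  simp_rw [map_smul, smul_eq_mul]
  symm
  refine Finset.sum_subset (Finset.subset_univ _) fun i _ hi => ?_
  by_cases hiI : i ∈ I
  · rw [hx i hiI, zero_mul]
  · rw [← h1, F.N_e hiI, F.N_notface, mul_zero]
    · intro h; exact hi (F.mem_J.2 ⟨hiI, h⟩)
    · rw [Finset.card_insert_of_notMem hiI]; omega

theorem N_sub_ell {I : Finset ι} {l : List (ι → ℝ)} (hl : l.length + 1 + I.card = n) (x : ι → ℝ)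
    (v : EuclideanSpace ℝ (Fin n)) : F.N ((x + F.ell v) :: l) I = F.N (x :: l) I := by
  rw [F.N_add hl, F.N_ell, add_zero]

theorem J_nonempty {I : Finset ι} (hI : F.face I) (hc : I.card < n) : (F.J I).Nonempty := by
  obtain ⟨S, hS, h⟩ := hI
  obtain ⟨i, hi, hiI⟩ : ∃ i ∈ S, i ∉ I := by
    by_contra hcon
    push Not at hcon
    have := Finset.card_le_card (show S ⊆ I from hcon)
    rw [F.card S hS] at this
    omega
  exact ⟨i, F.mem_J.2 ⟨hiI, S, hS, Finset.insert_subset hi h⟩⟩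

theorem N_pos (cs : List (ι → ℝ)) : ∀ (I : Finset ι), F.face I → (∀ c ∈ cs, c ∈ F.T) →
    cs.length + I.card = n → 0 < F.N cs I := by
  induction cs with
  | nil =>
    intro I hI _ hl
    obtain ⟨S, hS, h⟩ := hI
    have : I = S := Finset.eq_of_subset_of_card_le h (by rw [F.card S hS]; simp at hl; omega)
    rw [this]
    exact F.M_pos hS
  | cons c cs ih =>
    intro I hI hT hl
    simp only [List.length_cons] at hl
    obtain ⟨p, h1, h2⟩ := F.exists_relint (hT c List.mem_cons_self) hI
    rw [← F.N_sub_ell (by omega) c (-p), F.N_expand (by omega) _ (fun i hi => by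
      simp [ell, h1 i hi])]
    refine Finset.sum_pos (fun i hi => ?_) (F.J_nonempty hI (by omega))
    obtain ⟨hiI, hif⟩ := F.mem_J.1 hi
    refine mul_pos ?_ ?_
    · have := h2 i hiI
      simp [ell]; linarith
    · rw [F.N_e hiI]
      refine ih _ hif (fun d hd => hT d (List.mem_cons_of_mem _ hd)) ?_
      rw [Finset.card_insert_of_notMem hiI]; omega

theorem N_swap (a b : ι → ℝ) (l : List (ι → ℝ)) (I : Finset ι) : F.N (a :: b :: l) I = F.N (b :: a :: l) I :=
  F.N_perm (List.Perm.swap _ _ _) I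

/-- The quadratic form. -/
noncomputable def Qf (l : List (ι → ℝ)) (I : Finset ι) (hl : l.length + 2 + I.card = n) :
    (ι → ℝ) →ₗ[ℝ] (ι → ℝ) →ₗ[ℝ] ℝ :=
  LinearMap.mk₂ ℝ (fun x y => F.N (x :: y :: l) I)
    (fun a b y => F.N_add (by simp; omega) a b)
    (fun t a y => F.N_smul (by simp; omega) t a)
    (fun y a b => by
      simp only [F.N_swap y]
      exact F.N_add (by simp; omega) a b)
    (fun t y a => by
      simp only [F.N_swap y]
      exact F.N_smul (by simp; omega) t a)

theorem Qf_apply (l : List (ι → ℝ)) (I : Finset ι) (hl : l.length + 2 + I.card = n) (x y : ι → ℝ) :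
    F.Qf l I hl x y = F.N (x :: y :: l) I := rfl

theorem Qf_symm (l : List (ι → ℝ)) (I : Finset ι) (hl : l.length + 2 + I.card = n) (x y : ι → ℝ) :
    F.Qf l I hl x y = F.Qf l I hl y x := F.N_swap x y l I

end Fan

section forms
variable {V : Type*} [AddCommGroup V] [Module ℝ V] (q : V →ₗ[ℝ] V →ₗ[ℝ] ℝ)

theorem hyp_change (hs : ∀ x y, q x y = q y x) {c d : V} (hcd : 0 < q c d) (hcc : 0 ≤ q c c)
    (H : ∀ x, q x d = 0 → q x x ≤ 0) (x : V) (hx : q x c = 0) : q x x ≤ 0 := by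
  set t := q x d / q c d with ht
  have h1 : q (x - t • c) d = 0 := by
    simp only [map_sub, map_smul, LinearMap.sub_apply, LinearMap.smul_apply, smul_eq_mul]
    rw [ht, div_mul_cancel₀ _ hcd.ne', sub_self]
  have h2 := H _ h1
  simp only [map_sub, map_smul, LinearMap.sub_apply, LinearMap.smul_apply, smul_eq_mul] at h2
  rw [hs c x, hx] at h2
  nlinarith [sq_nonneg t]

theorem hyp_cs (hs : ∀ x y, q x y = q y x) {c : V} (hcc : 0 < q c c) (H : ∀ x, q x c = 0 → q x x ≤ 0) (x : V) :
    q x x * q c c ≤ q x c ^ 2 := by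
  set t := q x c / q c c with ht
  have ht' : t * q c c = q x c := by rw [ht, div_mul_cancel₀ _ hcc.ne']
  have h1 : q (x - t • c) c = 0 := by
    simp only [map_sub, map_smul, LinearMap.sub_apply, LinearMap.smul_apply, smul_eq_mul]
    rw [ht', sub_self]
  have h2 := H _ h1
  simp only [map_sub, map_smul, LinearMap.sub_apply, LinearMap.smul_apply, smul_eq_mul] at h2
  rw [hs c x] at h2
  have h3 : q x x ≤ t * q x c := by
    have : t * (t * q c c) = t * q x c := by rw [ht']
    nlinarith
  calc q x x * q c c ≤ (t * q x c) * q c c := mul_le_mul_of_nonneg_right h3 hcc.le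
    _ = q x c ^ 2 := by rw [mul_right_comm, ht']; ring
end forms

namespace Fan
variable {n : ℕ} {ι : Type*} [Fintype ι] [DecidableEq ι] (F : Fan n ι)

theorem eq_zero_of_inner_nonpos {v : EuclideanSpace ℝ (Fin n)} (h : ∀ j, inner ℝ (F.u j) v ≤ 0) : v = 0 := by
  obtain ⟨S, hS, α, h0, hz, hw⟩ := F.cover v
  have : inner ℝ v v ≤ 0 := by
    nth_rewrite 1 [hw]
    rw [sum_inner]
    refine Finset.sum_nonpos fun i _ => ?_
    rw [real_inner_smul_left]
    exact mul_nonpos_of_nonneg_of_nonpos (h0 i) (h i)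
  exact inner_self_eq_zero.1 (le_antisymm this real_inner_self_nonneg)

theorem connected {c : ι → ℝ} (hc : c ∈ F.T) {I : Finset ι} (hI : F.face I) (hcard : I.card + 2 ≤ n)
    (A : Finset ι) (hA : ∃ i ∈ A, i ∈ F.J I) (hA' : ∃ i ∈ F.J I, i ∉ A) :
    ∃ i ∈ F.J I, i ∈ A ∧ ∃ j ∈ F.J I, j ∉ A ∧ F.face (insert i (insert j I)) := by
  obtain ⟨p, hp1, hp2⟩ := F.exists_relint hc hI
  let W : Submodule ℝ (EuclideanSpace ℝ (Fin n)) := (Submodule.span ℝ (I.image F.u : Set (EuclideanSpace ℝ (Fin n))))ᗮ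
  have hWI : ∀ v ∈ W, ∀ i ∈ I, inner ℝ (F.u i) v = 0 := by
    intro v hv i hi
    exact (Submodule.mem_orthogonal _ _).1 hv _ (Submodule.subset_span (by
      rw [Finset.coe_image]; exact ⟨i, hi, rfl⟩))
  have hWmem : ∀ v, (∀ i ∈ I, inner ℝ (F.u i) v = 0) → v ∈ W := by
    intro v hv
    rw [Submodule.mem_orthogonal]
    intro w hw
    induction hw using Submodule.span_induction with
    | mem x hx =>
      rw [Finset.coe_image] at hx
      obtain ⟨i, hi, rfl⟩ := hx
      exact hv i hi
    | zero => simp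
    | add x y _ _ hx hy => rw [inner_add_left, hx, hy, add_zero]
    | smul a x _ hx => rw [real_inner_smul_left, hx, mul_zero]
  have hrank : 1 < Module.rank ℝ W := by
    have h1 := Submodule.finrank_add_finrank_orthogonal
      (Submodule.span ℝ (I.image F.u : Set (EuclideanSpace ℝ (Fin n))))
    have h2 : Module.finrank ℝ (Submodule.span ℝ (I.image F.u : Set (EuclideanSpace ℝ (Fin n)))) ≤ I.card :=
      (finrank_span_finset_le_card (I.image F.u)).trans Finset.card_image_le
    rw [finrank_euclideanSpace, Fintype.card_fin] at h1
    have h3 : 1 < Module.finrank ℝ W := by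
      change 1 < Module.finrank ℝ (Submodule.span ℝ (I.image F.u : Set (EuclideanSpace ℝ (Fin n))))ᗮ
      omega
    rw [← Module.finrank_eq_rank]
    exact_mod_cast h3
  have hpre := (isConnected_compl_singleton_of_one_lt_rank hrank (0 : W)).isPreconnected
  rw [isPreconnected_closed_iff] at hpre
  -- normalized functionals
  set d : ι → ℝ := fun i => c i - inner ℝ (F.u i) p with hd
  have hdpos : ∀ i, i ∉ I → 0 < d i := fun i hi => by
    have := hp2 i hi; simp only [hd]; linarith
  let G : ι → W → ℝ := fun i v => inner ℝ (F.u i) (v : EuclideanSpace ℝ (Fin n)) / d i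
  have hG : ∀ i, Continuous (G i) := fun i => by
    have : Continuous fun v : W => (inner ℝ (F.u i) (v : EuclideanSpace ℝ (Fin n)) : ℝ) := by fun_prop
    exact this.div_const _
  let U : ι → Set W := fun i => {v | ∀ j, j ∉ I → G j v ≤ G i v}
  have hUcl : ∀ i, IsClosed (U i) := fun i => by
    have : U i = ⋂ j, ⋂ (_ : j ∉ I), {v | G j v ≤ G i v} := by ext; simp [U]
    rw [this]
    exact isClosed_iInter fun j => isClosed_iInter fun _ => isClosed_le (hG j) (hG i)
  -- key facts: for nonzero v, the maximum value is positive, and gives a point of P c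
  have hkey : ∀ v : W, v ≠ 0 → ∀ K : Finset ι, (∀ i ∈ K, i ∉ I ∧ v ∈ U i) → K.Nonempty → F.face (K ∪ I) := by
    intro v hv K hK hKne
    obtain ⟨i, hi⟩ := hKne
    have hpos : 0 < G i v := by
      by_contra hcon
      push Not at hcon
      apply hv
      apply Subtype.ext
      apply F.eq_zero_of_inner_nonpos
      intro j
      by_cases hj : j ∈ I
      · rw [hWI v v.2 j hj]
      · have h1 := ((hK i hi).2 j hj).trans hcon
        simp only [G] at h1
        have h2 := mul_nonpos_of_nonpos_of_nonneg h1 (hdpos j hj).le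
        rwa [div_mul_cancel₀ _ (hdpos j hj).ne'] at h2
    have hin : ∀ j, inner ℝ (F.u j) (p + (G i v)⁻¹ • (v : EuclideanSpace ℝ (Fin n))) =
        inner ℝ (F.u j) p + (G i v)⁻¹ * inner ℝ (F.u j) (v : EuclideanSpace ℝ (Fin n)) := fun j => by
      rw [inner_add_right, inner_smul_right]
    refine F.face_of_tight hc (x := p + (G i v)⁻¹ • (v : EuclideanSpace ℝ (Fin n))) ?_ ?_
    · intro j
      rw [hin]
      by_cases hj : j ∈ I
      · rw [hWI v v.2 j hj, hp1 j hj]; simp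
      · have h1 := (hK i hi).2 j hj
        have h2 : inner ℝ (F.u j) (v : EuclideanSpace ℝ (Fin n)) ≤ G i v * d j := by
          have := mul_le_mul_of_nonneg_right h1 (hdpos j hj).le
          simpa only [G, div_mul_cancel₀ _ (hdpos j hj).ne'] using this
        have h3 : (G i v)⁻¹ * inner ℝ (F.u j) (v : EuclideanSpace ℝ (Fin n)) ≤ d j := by
          rw [inv_mul_le_iff₀ hpos]; exact h2
        simp only [hd] at h3
        linarith
    · intro j hj
      rw [hin]
      rcases Finset.mem_union.1 hj with hj | hj
      · have hjI := (hK j hj).1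
        have h1 : G j v = G i v := le_antisymm ((hK i hi).2 j hjI) ((hK j hj).2 i (hK i hi).1)
        have h2 : inner ℝ (F.u j) (v : EuclideanSpace ℝ (Fin n)) = G i v * d j := by
          rw [← h1]; simp only [G, div_mul_cancel₀ _ (hdpos j hjI).ne']
        rw [h2, inv_mul_cancel_left₀ hpos.ne']
        simp only [hd]; ring
      · rw [hWI v v.2 j hj, hp1 j hj]; simp
  have hUne : ∀ i ∈ F.J I, ∃ v : W, v ≠ 0 ∧ v ∈ U i := by
    intro i hi
    obtain ⟨hiI, hif⟩ := F.mem_J.1 hi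
    obtain ⟨x, hx1, hx2⟩ := F.exists_relint hc hif
    have hW : x - p ∈ W := hWmem _ fun k hk => by
      rw [inner_sub_right, hx1 k (Finset.mem_insert_of_mem hk), hp1 k hk, sub_self]
    have hxi := hx1 i (Finset.mem_insert_self _ _)
    have hGi : G i ⟨x - p, hW⟩ = 1 := by
      simp only [G, inner_sub_right, hxi]
      exact div_self (hdpos i hiI).ne'
    refine ⟨⟨x - p, hW⟩, ?_, ?_⟩
    · intro h0
      rw [h0] at hGi
      simp [G] at hGi
    · intro j hj
      rw [hGi]
      simp only [G, inner_sub_right]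
      rw [div_le_one (hdpos j hj)]
      have : inner ℝ (F.u j) x ≤ c j := by
        by_cases hji : j = i
        · rw [hji, hxi]
        · exact (hx2 j (by simp [hji, hj])).le
      simp only [hd]; linarith
  have hmax : ∀ v : W, v ≠ 0 → ∃ i, i ∉ I ∧ v ∈ U i := by
    intro v hv
    have hne : (Finset.univ.filter fun i => i ∉ I).Nonempty := by
      obtain ⟨i, -, hi⟩ := hA
      exact ⟨i, by simpa using (F.mem_J.1 hi).1⟩
    obtain ⟨i, hi, hmx⟩ := Finset.exists_max_image _ (fun i => G i v) hne
    exact ⟨i, by simpa using hi, fun j hj => hmx j (by simpa using hj)⟩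
  obtain ⟨a, haA, haJ⟩ := hA
  obtain ⟨b, hbJ, hbA⟩ := hA'
  obtain ⟨va, hva, hvaU⟩ := hUne a haJ
  obtain ⟨vb, hvb, hvbU⟩ := hUne b hbJ
  obtain ⟨v, hv0, hv1, hv2⟩ := hpre
    (⋃ i, ⋃ (_ : i ∉ I ∧ i ∈ A), U i) (⋃ i, ⋃ (_ : i ∉ I ∧ i ∉ A), U i)
    (isClosed_iUnion_of_finite fun i => isClosed_iUnion_of_finite fun _ => hUcl i)
    (isClosed_iUnion_of_finite fun i => isClosed_iUnion_of_finite fun _ => hUcl i)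
    (by
      intro v hv
      obtain ⟨i, hi, hvi⟩ := hmax v hv
      by_cases hiA : i ∈ A
      · exact Or.inl (Set.mem_iUnion₂.2 ⟨i, ⟨hi, hiA⟩, hvi⟩)
      · exact Or.inr (Set.mem_iUnion₂.2 ⟨i, ⟨hi, hiA⟩, hvi⟩))
    ⟨va, hva, Set.mem_iUnion₂.2 ⟨a, ⟨(F.mem_J.1 haJ).1, haA⟩, hvaU⟩⟩
    ⟨vb, hvb, Set.mem_iUnion₂.2 ⟨b, ⟨(F.mem_J.1 hbJ).1, hbA⟩, hvbU⟩⟩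
  obtain ⟨i, ⟨hiI, hiA⟩, hvi⟩ := Set.mem_iUnion₂.1 hv1
  obtain ⟨j, ⟨hjI, hjA⟩, hvj⟩ := Set.mem_iUnion₂.1 hv2
  have hf := hkey v hv0 {i, j} (by
    intro k hk
    rcases Finset.mem_insert.1 hk with rfl | hk
    · exact ⟨hiI, hvi⟩
    · rw [Finset.mem_singleton] at hk; subst hk; exact ⟨hjI, hvj⟩) ⟨i, by simp⟩
  have heq : ({i, j} : Finset ι) ∪ I = insert i (insert j I) := by ext k; simp [or_assoc]
  rw [heq] at hf
  have sub : ∀ K, K ⊆ insert i (insert j I) → F.face K := fun K hK => by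
    obtain ⟨S, hS, h⟩ := hf; exact ⟨S, hS, hK.trans h⟩
  refine ⟨i, F.mem_J.2 ⟨hiI, sub _ ?_⟩, hiA, j, F.mem_J.2 ⟨hjI, sub _ (Finset.subset_insert _ _)⟩, hjA, hf⟩
  exact Finset.insert_subset_insert _ (Finset.subset_insert _ _)

end Fan

set_option linter.unusedSectionVars false
set_option linter.unusedVariables false
open scoped Pointwise
open MeasureTheory

namespace Fan
variable {n : ℕ} {ι : Type*} [Fintype ι] [DecidableEq ι] (F : Fan n ι)

theorem N_expand1 {I : Finset ι} {l : List (ι → ℝ)} (hl : l.length + 2 + I.card = n) (z y : ι → ℝ)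
    (hy : ∀ i ∈ I, y i = 0) :
    F.N (z :: y :: l) I = ∑ j : {i // i ∈ F.J I}, F.N (z :: e j.1 :: l) I * y j.1 := by
  rw [F.N_swap, F.N_expand (by simp; omega) y hy, ← Finset.sum_coe_sort]
  exact Finset.sum_congr rfl fun i _ => by rw [F.N_swap, mul_comm]

theorem N_expand2 {I : Finset ι} {l : List (ι → ℝ)} (hl : l.length + 2 + I.card = n) (x y : ι → ℝ)
    (hx : ∀ i ∈ I, x i = 0) (hy : ∀ i ∈ I, y i = 0) :
    F.N (x :: y :: l) I = ∑ i : {i // i ∈ F.J I}, ∑ j : {i // i ∈ F.J I},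
      F.N (e i.1 :: e j.1 :: l) I * x i.1 * y j.1 := by
  rw [F.N_expand (by simp; omega) x hx, ← Finset.sum_coe_sort]
  refine Finset.sum_congr rfl fun i _ => ?_
  rw [F.N_expand1 hl _ y hy, Finset.mul_sum]
  exact Finset.sum_congr rfl fun j _ => by ring

theorem N_offdiag {I : Finset ι} {l : List (ι → ℝ)} (hl : l.length + 2 + I.card = n) (hT : ∀ c ∈ l, c ∈ F.T)
    {i j : ι} (hi : i ∉ I) (hj : j ∉ I) (hij : i ≠ j) :
    F.N (e i :: e j :: l) I = F.N l (insert j (insert i I)) ∧ 0 ≤ F.N (e i :: e j :: l) I ∧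
    (F.face (insert i (insert j I)) → 0 < F.N (e i :: e j :: l) I) ∧
    (0 < F.N (e i :: e j :: l) I → F.face (insert i (insert j I))) := by
  have hj' : j ∉ insert i I := by simp [hj, Ne.symm hij]
  have h1 : F.N (e i :: e j :: l) I = F.N l (insert j (insert i I)) := by
    rw [F.N_e hi, F.N_e hj']
  have hc : (insert j (insert i I)).card = I.card + 2 := by
    rw [Finset.card_insert_of_notMem hj', Finset.card_insert_of_notMem hi]
  rw [Finset.insert_comm i j, h1]
  have h2 : F.face (insert j (insert i I)) → 0 < F.N l (insert j (insert i I)) := fun h =>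
    F.N_pos l _ h hT (by omega)
  have h3 : ¬ F.face (insert j (insert i I)) → F.N l (insert j (insert i I)) = 0 := fun h =>
    F.N_notface h l (by omega)
  refine ⟨rfl, ?_, h2, fun h => ?_⟩
  · by_cases h : F.face (insert j (insert i I))
    · exact (h2 h).le
    · rw [h3 h]
  · by_contra hh
    rw [h3 hh] at h
    exact lt_irrefl _ h

/-- Hyperbolicity of the mixed form on a face. -/
def Hyp (cs : List (ι → ℝ)) : Prop := ∀ I, F.face I → (∀ c ∈ cs, c ∈ F.T) → cs.length + 2 + I.card = n →
  ∀ c ∈ F.T, ∀ x, F.N (x :: c :: cs) I = 0 → F.N (x :: x :: cs) I ≤ 0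

theorem Hyp_cs {cs : List (ι → ℝ)} (H : F.Hyp cs) {I : Finset ι} (hI : F.face I) (hT : ∀ c ∈ cs, c ∈ F.T)
    (hl : cs.length + 2 + I.card = n) {c : ι → ℝ} (hc : c ∈ F.T) (x : ι → ℝ) :
    F.N (x :: x :: cs) I * F.N (c :: c :: cs) I ≤ F.N (x :: c :: cs) I ^ 2 := by
  refine hyp_cs (F.Qf cs I hl) (F.Qf_symm cs I hl) (c := c) ?_ (H I hI hT hl c hc) x
  refine F.N_pos _ I hI ?_ (by simp; omega)
  simpa [hc] using hT

theorem N_sub_ell2 {I : Finset ι} {l : List (ι → ℝ)} (hl : l.length + 2 + I.card = n) (x y : ι → ℝ)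
    (v w : EuclideanSpace ℝ (Fin n)) :
    F.N ((x + F.ell v) :: (y + F.ell w) :: l) I = F.N (x :: y :: l) I := by
  rw [F.N_sub_ell (by simp; omega), F.N_swap, F.N_sub_ell (by simp; omega), F.N_swap]

theorem hyp_step (c : ι → ℝ) (cs : List (ι → ℝ)) (ih : F.Hyp cs) : F.Hyp (c :: cs) := by
  intro I hI hT hl d hd x hx
  have hl' : cs.length + 3 + I.card = n := by simp at hl; omega
  have hcT : c ∈ F.T := hT c List.mem_cons_self
  have hcsT : ∀ a ∈ cs, a ∈ F.T := fun a ha => hT a (List.mem_cons_of_mem _ ha)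
  refine hyp_change (F.Qf (c :: cs) I hl) (F.Qf_symm _ I hl) (c := d) (d := c) ?_ ?_ ?_ x hx
  · exact F.N_pos _ I hI (by simpa [hd, hcT] using hcsT) (by simp; omega)
  · exact (F.N_pos (d :: d :: c :: cs) I hI (by simpa [hd, hcT] using hcsT) (by simp; omega)).le
  clear hx x
  intro x hx
  rw [Qf_apply] at hx ⊢
  obtain ⟨p, hp1, hp2⟩ := F.exists_relint hcT hI
  obtain ⟨r, hr⟩ := F.exists_inner hI x
  set x' : ι → ℝ := x + F.ell (-r) with hx'
  set c' : ι → ℝ := c + F.ell (-p) with hc'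
  have hx'I : ∀ i ∈ I, x' i = 0 := fun i hi => by simp [hx', ell, hr i hi]
  have hc'I : ∀ i ∈ I, c' i = 0 := fun i hi => by simp [hc', ell, hp1 i hi]
  have hc'pos : ∀ i, i ∉ I → 0 < c' i := fun i hi => by
    have := hp2 i hi
    simp [hc', ell]; linarith
  rw [← F.N_sub_ell2 hl x x (-r) (-r), F.N_expand2 hl _ _ hx'I hx'I]
  rw [← F.N_sub_ell2 hl x c (-r) (-p), F.N_expand2 hl _ _ hx'I hc'I] at hx
  have hQc : ∀ i : {i // i ∈ F.J I}, ∑ j : {i // i ∈ F.J I}, F.N (e i.1 :: e j.1 :: c :: cs) I * c' j.1 =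
      F.N (c :: c :: cs) (insert i.1 I) := by
    intro i
    rw [← F.N_expand1 hl _ c' hc'I, F.N_swap, hc', F.N_sub_ell (by simp; omega), F.N_swap,
      F.N_e (F.mem_J.1 i.2).1]
  have hcardins : ∀ i : {i // i ∈ F.J I}, (insert i.1 I).card = I.card + 1 := fun i =>
    Finset.card_insert_of_notMem (F.mem_J.1 i.2).1
  refine pf_lemma (fun i j : {i // i ∈ F.J I} => F.N (e i.1 :: e j.1 :: c :: cs) I)
    (fun i j => F.N_swap _ _ _ _) ?_ (fun i => c' i.1) ?_ ?_ ?_ ?_ (fun i => x' i.1) ?_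
  · intro i j hij
    exact (F.N_offdiag hl hT (F.mem_J.1 i.2).1 (F.mem_J.1 j.2).1 (fun h => hij (Subtype.ext h))).2.1
  · intro i
    exact hc'pos _ (F.mem_J.1 i.2).1
  · intro i
    rw [hQc i]
    exact F.N_pos _ _ (F.mem_J.1 i.2).2 (by simpa [hcT] using hcsT) (by rw [hcardins]; simp; omega)
  · intro A hA hA'
    obtain ⟨i, hi, hiA, j, hj, hjA, hf⟩ := F.connected hcT hI (by omega) (A.map (Function.Embedding.subtype _))
      (by
        obtain ⟨a, ha⟩ := hA
        exact ⟨a.1, by simpa using ha, a.2⟩)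
      (by
        obtain ⟨a, ha⟩ := hA'
        exact ⟨a.1, a.2, by simpa using ha⟩)
    refine ⟨⟨i, hi⟩, by simpa [hi] using hiA, ⟨j, hj⟩, by simpa [hj] using hjA, ?_⟩
    refine (F.N_offdiag hl hT (F.mem_J.1 hi).1 (F.mem_J.1 hj).1 ?_).2.2.1 hf
    rintro rfl
    exact hjA hiA
  · intro z
    let Z : ι → ℝ := fun i => if h : i ∈ F.J I then z ⟨i, h⟩ else 0
    have hZ : ∀ i : {i // i ∈ F.J I}, Z i.1 = z i := fun i => by simp [Z, i.2]
    have hZI : ∀ i ∈ I, Z i = 0 := fun i hi => by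
      have : i ∉ F.J I := fun h => (F.mem_J.1 h).1 hi
      simp [Z, this]
    have h1 := F.N_expand2 hl Z Z hZI hZI
    simp only [hZ] at h1
    rw [← h1]
    have h2 : F.N (Z :: Z :: c :: cs) I = F.N (c' :: Z :: Z :: cs) I := by
      rw [hc', F.N_sub_ell (by simp; omega)]
      apply F.N_perm
      exact (List.perm_middle (l₁ := [Z, Z]))
    rw [h2, F.N_expand (by simp; omega) c' hc'I, ← Finset.sum_coe_sort]
    refine Finset.sum_le_sum fun i _ => ?_
    rw [F.N_e (F.mem_J.1 i.2).1, mul_div_assoc]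
    refine mul_le_mul_of_nonneg_left ?_ (hc'pos _ (F.mem_J.1 i.2).1).le
    have h3 := F.Hyp_cs ih (F.mem_J.1 i.2).2 hcsT (by rw [hcardins]; omega) hcT Z
    have h4 := F.N_expand1 hl (e i.1) Z hZI
    simp only [hZ] at h4
    rw [hQc i, ← h4, le_div_iff₀ (F.N_pos _ _ (F.mem_J.1 i.2).2 (by simpa [hcT] using hcsT)
      (by rw [hcardins]; simp; omega))]
    rw [F.N_e (F.mem_J.1 i.2).1]
    exact h3
  · rw [← hx]
    refine Finset.sum_congr rfl fun i _ => ?_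
    rw [Finset.sum_mul]
    exact Finset.sum_congr rfl fun j _ => by ring
end Fan

set_option linter.unusedSectionVars false
set_option linter.unusedVariables false
open scoped Pointwise
open MeasureTheory

theorem two_three (a b c a' b' c' : ℝ) (hc : c ≠ 0) : ∃ α β γ : ℝ, (α ≠ 0 ∨ β ≠ 0) ∧
    a * α + b * β + c * γ = 0 ∧ a' * α + b' * β + c' * γ = 0 := by
  by_cases h : a' * c - c' * a = 0 ∧ b' * c - c' * b = 0
  · refine ⟨1, 0, -a / c, Or.inl one_ne_zero, ?_, ?_⟩
    · field_simp; ring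
    · field_simp; linarith [h.1]
  · refine ⟨b' * c - c' * b, -(a' * c - c' * a), -(a * (b' * c - c' * b) - b * (a' * c - c' * a)) / c, ?_, ?_, ?_⟩
    · by_contra hh
      push Not at hh
      exact h ⟨by linarith [hh.2], hh.1⟩
    · field_simp; ring
    · field_simp; ring

section planar
variable {κ : Type*} [Fintype κ] [DecidableEq κ]

theorem planar_lemma (Q : κ → κ → ℝ) (hQ : ∀ i j, Q i j = Q j i) (hoff : ∀ i j, i ≠ j → 0 ≤ Q i j)
    (g g' : κ → ℝ) (hg : ∀ i, g i ≠ 0) (hQg : ∀ i, ∑ j, Q i j * g j = 0) (hQg' : ∀ i, ∑ j, Q i j * g' j = 0)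
    (hτ : ∀ i j, i ≠ j → 0 < Q i j → g i < 0 → 0 < g j → g j * g' i - g i * g' j ≠ 0)
    (huniq : ∀ i j k l, i ≠ j → 0 < Q i j → g i < 0 → 0 < g j → k ≠ l → 0 < Q k l → g k < 0 → 0 < g l →
      0 < (g j * g' i - g i * g' j) * (g l * g' k - g k * g' l) → i = k ∧ j = l)
    (x c : κ → ℝ) (hxc : ∑ i, ∑ j, Q i j * x i * c j = 0) (hcc : 0 < ∑ i, ∑ j, Q i j * c i * c j) :
    ∑ i, ∑ j, Q i j * x i * x j ≤ 0 := by
  by_contra hxx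
  push Not at hxx
  have key : ∀ σ : ℝ, ∃ a b d : ℝ, d ≠ 0 ∧ ∀ i j, i ≠ j → 0 < Q i j → g i < 0 → 0 < g j →
      0 < σ * (g j * g' i - g i * g' j) → ∀ α β γ, a * α + b * β + d * γ = 0 →
      (α * x i + β * c i + γ * g' i) * g j = (α * x j + β * c j + γ * g' j) * g i := by
    intro σ
    by_cases hex : ∃ i j, i ≠ j ∧ 0 < Q i j ∧ g i < 0 ∧ 0 < g j ∧ 0 < σ * (g j * g' i - g i * g' j)
    · obtain ⟨k, l, h1, h2, h3, h4, h5⟩ := hex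
      refine ⟨x k * g l - x l * g k, c k * g l - c l * g k, g l * g' k - g k * g' l,
        hτ k l h1 h2 h3 h4, ?_⟩
      intro i j g1 g2 g3 g4 g5 α β γ h
      obtain ⟨rfl, rfl⟩ := huniq i j k l g1 g2 g3 g4 h1 h2 h3 h4 (by
        have h6 := mul_pos h5 g5
        have h7 : 0 < σ ^ 2 * ((g j * g' i - g i * g' j) * (g l * g' k - g k * g' l)) := by
          calc 0 < _ := h6
            _ = _ := by ring
        exact pos_of_mul_pos_right h7 (sq_nonneg _))
      linarith
    · refine ⟨0, 0, 1, one_ne_zero, ?_⟩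
      intro i j g1 g2 g3 g4 g5
      exact absurd ⟨i, j, g1, g2, g3, g4, g5⟩ hex
  obtain ⟨a1, b1, d1, hd1, h1⟩ := key 1
  obtain ⟨a2, b2, d2, hd2, h2⟩ := key (-1)
  obtain ⟨α, β, γ, hαβ, e1, e2⟩ := two_three a1 b1 d1 a2 b2 d2 hd1
  set y : κ → ℝ := fun i => α * x i + β * c i + γ * g' i with hy
  have hcross : ∀ i j, i ≠ j → 0 < Q i j → g i < 0 → 0 < g j → y i * g j = y j * g i := by
    intro i j g1 g2 g3 g4
    rcases lt_or_gt_of_ne (hτ i j g1 g2 g3 g4) with h | h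
    · exact h2 i j g1 g2 g3 g4 (by linarith) α β γ e2
    · exact h1 i j g1 g2 g3 g4 (by linarith) α β γ e1
  have hle : ∑ i, ∑ j, Q i j * y i * y j ≤ 0 := by
    have hlap := lap_identity Q hQ g y hg
    have h0 : ∑ i, (∑ j, Q i j * g j) * y i ^ 2 / g i = 0 :=
      Finset.sum_eq_zero fun i _ => by rw [hQg]; simp
    have hnn : 0 ≤ ∑ i, ∑ j, Q i j * g i * g j * (y i / g i - y j / g j) ^ 2 := by
      refine Finset.sum_nonneg fun i _ => Finset.sum_nonneg fun j _ => ?_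
      by_cases hij : i = j
      · subst hij; simp
      rcases (hoff i j hij).eq_or_lt with h | h
      · rw [← h]; simp
      have hz : y i * g j = y j * g i → y i / g i - y j / g j = 0 := fun h => by
        rw [sub_eq_zero, div_eq_div_iff (hg i) (hg j)]; exact h
      rcases lt_or_gt_of_ne (hg i) with hi | hi <;> rcases lt_or_gt_of_ne (hg j) with hj | hj
      · have := mul_pos_of_neg_of_neg hi hj
        rw [mul_assoc (Q i j)]; positivity
      · rw [hz (hcross i j hij h hi hj)]; simp
      · rw [hz (hcross j i (Ne.symm hij) (hQ i j ▸ h) hj hi).symm]; simp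
      · positivity
    rw [h0] at hlap
    linarith
  have hexp : ∑ i, ∑ j, Q i j * y i * y j = α ^ 2 * ∑ i, ∑ j, Q i j * x i * x j +
      β ^ 2 * ∑ i, ∑ j, Q i j * c i * c j := by
    have t1 : ∀ i j, Q i j * y i * y j = α ^ 2 * (Q i j * x i * x j) + β ^ 2 * (Q i j * c i * c j) +
        α * β * (Q i j * x i * c j) + α * β * (Q j i * x j * c i) + (γ * y i) * (Q i j * g' j) +
        (γ * (α * x j + β * c j)) * (Q j i * g' i) := by
      intro i j; rw [hQ j i]; simp only [hy]; ring
    have t2 : ∑ i, ∑ j, Q j i * x j * c i = 0 := by rw [Finset.sum_comm]; exact hxc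
    have t3 : ∑ i, ∑ j, (γ * y i) * (Q i j * g' j) = 0 :=
      Finset.sum_eq_zero fun i _ => by rw [← Finset.mul_sum, hQg', mul_zero]
    have t4 : ∑ i, ∑ j, (γ * (α * x j + β * c j)) * (Q j i * g' i) = 0 := by
      rw [Finset.sum_comm]
      exact Finset.sum_eq_zero fun i _ => by rw [← Finset.mul_sum, hQg', mul_zero]
    simp_rw [t1, Finset.sum_add_distrib]
    rw [t3, t4]
    simp_rw [← Finset.mul_sum]
    rw [t2, hxc]; ring
  rw [hexp] at hle
  rcases hαβ with h | h
  · have := mul_pos (pow_pos (abs_pos.2 h) 2) hxx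
    rw [sq_abs] at this
    have := mul_nonneg (sq_nonneg β) hcc.le
    linarith
  · have := mul_pos (pow_pos (abs_pos.2 h) 2) hcc
    rw [sq_abs] at this
    have := mul_nonneg (sq_nonneg α) hxx.le
    linarith
end planar

theorem exists_generic_t {κ : Type*} (J : Finset κ) (a b : κ → ℝ) (h : ∀ j ∈ J, a j ≠ 0 ∨ b j ≠ 0) :
    ∃ t : ℝ, ∀ j ∈ J, a j + t * b j ≠ 0 := by
  have hfin : (⋃ j ∈ J, {t : ℝ | a j + t * b j = 0}).Finite := by
    refine Set.Finite.biUnion J.finite_toSet fun j hj => ?_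
    refine Set.Subsingleton.finite fun s hs t ht => ?_
    simp only [Set.mem_ofPred_eq] at hs ht
    have hb : b j ≠ 0 := by
      intro hb
      rw [hb] at hs
      rcases h j hj with h | h
      · exact h (by linarith)
      · exact h hb
    have : (s - t) * b j = 0 := by linarith
    rcases mul_eq_zero.1 this with h | h
    · linarith
    · exact absurd h hb
  obtain ⟨t, ht⟩ := hfin.infinite_compl.nonempty
  refine ⟨t, fun j hj h => ht ?_⟩
  simp only [Set.mem_iUnion]
  exact ⟨j, hj, h⟩

namespace Fan
variable {n : ℕ} {ι : Type*} [Fintype ι] [DecidableEq ι] (F : Fan n ι)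

theorem hyp_base : F.Hyp [] := by
  intro I hI hT hl c hc x hx
  have hl' : 2 + I.card = n := by simpa using hl
  obtain ⟨p, hp1, hp2⟩ := F.exists_relint hc hI
  obtain ⟨r, hr⟩ := F.exists_inner hI x
  set x' : ι → ℝ := x + F.ell (-r) with hx'
  set c' : ι → ℝ := c + F.ell (-p) with hc'
  have hx'I : ∀ i ∈ I, x' i = 0 := fun i hi => by simp [hx', ell, hr i hi]
  have hc'I : ∀ i ∈ I, c' i = 0 := fun i hi => by simp [hc', ell, hp1 i hi]
  have hcc : 0 < F.N [c, c] I := F.N_pos _ I hI (by simp [hc]) (by simp; omega)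
  rw [← F.N_sub_ell2 hl x x (-r) (-r), F.N_expand2 hl _ _ hx'I hx'I]
  rw [← F.N_sub_ell2 hl x c (-r) (-p), F.N_expand2 hl _ _ hx'I hc'I] at hx
  rw [← F.N_sub_ell2 hl c c (-p) (-p), F.N_expand2 hl _ _ hc'I hc'I] at hcc
  obtain ⟨S0, hS0, hIS0⟩ := hI
  have hcard : (S0 \ I).card = 2 := by
    rw [Finset.card_sdiff_of_subset hIS0, F.card S0 hS0]; omega
  obtain ⟨a, b, hab, hS0I⟩ := Finset.card_eq_two.1 hcard
  have haS : a ∈ S0 ∧ a ∉ I := by rw [← Finset.mem_sdiff, hS0I]; simp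
  have hbS : b ∈ S0 ∧ b ∉ I := by rw [← Finset.mem_sdiff, hS0I]; simp
  set va := F.X S0 (e a) with hva
  set vb := F.X S0 (e b) with hvb
  have hdec : ∀ y : EuclideanSpace ℝ (Fin n), (∀ i ∈ I, inner ℝ (F.u i) y = 0) →
      y = (inner ℝ (F.u a) y : ℝ) • va + (inner ℝ (F.u b) y : ℝ) • vb := by
    intro y hy
    refine F.eq_of_inner hS0 fun i hi => ?_
    rw [inner_add_right, real_inner_smul_right, real_inner_smul_right, hva, hvb, F.tight S0 hS0 i hi,
      F.tight S0 hS0 i hi]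
    by_cases hiI : i ∈ I
    · have h1 : i ≠ a := fun h => haS.2 (h ▸ hiI)
      have h2 : i ≠ b := fun h => hbS.2 (h ▸ hiI)
      simp [e, h1, h2, hy i hiI]
    · have : i ∈ S0 \ I := Finset.mem_sdiff.2 ⟨hi, hiI⟩
      rw [hS0I] at this
      simp only [Finset.mem_insert, Finset.mem_singleton] at this
      rcases this with rfl | rfl
      · simp [e, hab]
      · simp [e, hab.symm]
  have hvaI : ∀ i ∈ I, inner ℝ (F.u i) va = 0 := fun i hi => by
    rw [hva, F.tight S0 hS0 i (hIS0 hi)]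
    have h1 : i ≠ a := fun h => haS.2 (h ▸ hi)
    simp [e, h1]
  have hvbI : ∀ i ∈ I, inner ℝ (F.u i) vb = 0 := fun i hi => by
    rw [hvb, F.tight S0 hS0 i (hIS0 hi)]
    have h1 : i ≠ b := fun h => hbS.2 (h ▸ hi)
    simp [e, h1]
  obtain ⟨t, ht⟩ := exists_generic_t (F.J I) (fun j => inner ℝ (F.u j) va) (fun j => inner ℝ (F.u j) vb) (by
    intro j hj
    by_contra hcon
    push Not at hcon
    obtain ⟨hjI, hjf⟩ := F.mem_J.1 hj
    obtain ⟨y, hy⟩ := F.exists_inner hjf (e j)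
    have h1 : inner ℝ (F.u j) y = 1 := by
      rw [hy j (Finset.mem_insert_self _ _)]; simp [e]
    rw [hdec y fun i hi => by
      rw [hy i (Finset.mem_insert_of_mem hi)]
      have : i ≠ j := fun h => hjI (h ▸ hi)
      simp [e, this], inner_add_right, real_inner_smul_right, real_inner_smul_right, hcon.1, hcon.2] at h1
    simp at h1)
  set v := va + t • vb with hv
  have hvI : ∀ i ∈ I, inner ℝ (F.u i) v = 0 := fun i hi => by
    rw [hv, inner_add_right, real_inner_smul_right, hvaI i hi, hvbI i hi]; simp
  have hdec' : ∀ y : EuclideanSpace ℝ (Fin n), (∀ i ∈ I, inner ℝ (F.u i) y = 0) →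
      ∃ s s' : ℝ, y = s • v + s' • vb := by
    intro y hy
    refine ⟨inner ℝ (F.u a) y, inner ℝ (F.u b) y - inner ℝ (F.u a) y * t, ?_⟩
    conv_lhs => rw [hdec y hy]
    rw [hv]; module
  set g : {i // i ∈ F.J I} → ℝ := fun j => inner ℝ (F.u j.1) v with hgdef
  set g' : {i // i ∈ F.J I} → ℝ := fun j => inner ℝ (F.u j.1) vb with hg'def
  -- value of crossing functional
  have hpair : ∀ (i j : {i // i ∈ F.J I}) (y : EuclideanSpace ℝ (Fin n)) (s s' : ℝ), y = s • v + s' • vb →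
      g j * inner ℝ (F.u i.1) y - g i * inner ℝ (F.u j.1) y = s' * (g j * g' i - g i * g' j) := by
    intro i j y s s' hy
    rw [hy]
    simp only [inner_add_right, real_inner_smul_right]
    simp only [hgdef, hg'def]
    ring
  have hnJ : ∀ i : {i // i ∈ F.J I}, i.1 ∉ I := fun i => (F.mem_J.1 i.2).1
  have hfc : ∀ i j : {i // i ∈ F.J I}, i ≠ j → 0 < F.N [e i.1, e j.1] I →
      insert i.1 (insert j.1 I) ∈ F.B := by
    intro i j hij h
    have hij' : i.1 ≠ j.1 := fun h => hij (Subtype.ext h)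
    obtain ⟨S, hS, hsub⟩ := (F.N_offdiag hl hT (hnJ i) (hnJ j) hij').2.2.2 h
    have : insert i.1 (insert j.1 I) = S := Finset.eq_of_subset_of_card_le hsub (by
      rw [F.card S hS, Finset.card_insert_of_notMem (by simp [hij', hnJ i]),
        Finset.card_insert_of_notMem (hnJ j)]
      omega)
    rw [this]; exact hS
  refine planar_lemma (fun i j : {i // i ∈ F.J I} => F.N [e i.1, e j.1] I)
    (fun i j => F.N_swap _ _ _ _) ?_ g g' (fun i => ht i.1 i.2 ∘ fun h => ?_) ?_ ?_ ?_ ?_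
    (fun i => x' i.1) (fun i => c' i.1) hx hcc
  · intro i j hij
    exact (F.N_offdiag hl hT (hnJ i) (hnJ j) (fun h => hij (Subtype.ext h))).2.1
  · rw [← h]
    simp only [hgdef, hv, inner_add_right, real_inner_smul_right]
  · intro i
    have := F.N_expand1 hl (e i.1) (F.ell v) hvI
    rw [F.N_swap, F.N_ell] at this
    exact this.symm
  · intro i
    have := F.N_expand1 hl (e i.1) (F.ell vb) hvbI
    rw [F.N_swap, F.N_ell] at this
    exact this.symm
  · intro i j hij hQ hi hj hτ
    have hS := hfc i j hij hQ
    have hij' : i.1 ≠ j.1 := fun h => hij (Subtype.ext h)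
    obtain ⟨y, hy⟩ := F.exists_inner (I := insert i.1 (insert j.1 I)) ⟨_, hS, subset_rfl⟩ (e i.1)
    have hyi : inner ℝ (F.u i.1) y = 1 := by rw [hy _ (by simp)]; simp [e]
    have hyj : inner ℝ (F.u j.1) y = 0 := by rw [hy _ (by simp)]; simp [e, hij'.symm]
    obtain ⟨s, s', hs⟩ := hdec' y fun k hk => by
      rw [hy _ (by simp [hk])]
      have : k ≠ i.1 := fun h => hnJ i (h ▸ hk)
      simp [e, this]
    have := hpair i j y s s' hs
    rw [hτ, hyi, hyj] at this
    simp at this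
    exact hj.ne' this
  · intro i j k l hij hQ hi hj hkl hQ' hk hl2 hpos
    have hS1 := hfc i j hij hQ
    have hS2 := hfc k l hkl hQ'
    have hij' : i.1 ≠ j.1 := fun h => hij (Subtype.ext h)
    have hkl' : k.1 ≠ l.1 := fun h => hkl (Subtype.ext h)
    set S1 := insert i.1 (insert j.1 I) with hS1d
    set S2 := insert k.1 (insert l.1 I) with hS2d
    by_cases hEq : S1 = S2
    · have h1 : i.1 = k.1 ∨ i.1 = l.1 := by
        have : i.1 ∈ S2 := by rw [← hEq, hS1d]; simp
        rw [hS2d] at this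
        simpa [hnJ i] using this
      have h2 : j.1 = k.1 ∨ j.1 = l.1 := by
        have : j.1 ∈ S2 := by rw [← hEq, hS1d]; simp
        rw [hS2d] at this
        simpa [hnJ j] using this
      constructor
      · rcases h1 with h | h
        · exact Subtype.ext h
        · rw [Subtype.ext h] at hi; linarith
      · rcases h2 with h | h
        · rw [Subtype.ext h] at hj; linarith
        · exact Subtype.ext h
    · exfalso
      have main : ∀ (i j : {i // i ∈ F.J I}) (S S' : Finset ι), S ∈ F.B → S' ∈ F.B → S ≠ S' →
          S = insert i.1 (insert j.1 I) → I ⊆ S' → g i < 0 → 0 < g j →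
          0 < g j * inner ℝ (F.u i.1) (F.X S c - F.X S' c) - g i * inner ℝ (F.u j.1) (F.X S c - F.X S' c) := by
        intro i j S S' hS hS' hne hSd hIS' hi hj
        have hiS : i.1 ∈ S := by rw [hSd]; simp
        have hjS : j.1 ∈ S := by rw [hSd]; simp
        have a1 : 0 ≤ inner ℝ (F.u i.1) (F.X S c - F.X S' c) := by
          rw [inner_sub_right, F.tight S hS _ hiS]
          have := F.X_mem hc hS' i.1
          linarith
        have a2 : 0 ≤ inner ℝ (F.u j.1) (F.X S c - F.X S' c) := by
          rw [inner_sub_right, F.tight S hS _ hjS]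
          have := F.X_mem hc hS' j.1
          linarith
        have a3 : i.1 ∉ S' ∨ j.1 ∉ S' := by
          by_contra hcon
          push Not at hcon
          apply hne
          refine Finset.eq_of_subset_of_card_le ?_ (by rw [F.card S hS, F.card S' hS'])
          rw [hSd]
          exact Finset.insert_subset hcon.1 (Finset.insert_subset hcon.2 hIS')
        rcases a3 with h | h
        · have : 0 < inner ℝ (F.u i.1) (F.X S c - F.X S' c) := by
            rw [inner_sub_right, F.tight S hS _ hiS]
            have := hc S' hS' i.1 h
            linarith
          nlinarith [mul_pos hj this, mul_nonneg (neg_nonneg.2 hi.le) a2]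
        · have : 0 < inner ℝ (F.u j.1) (F.X S c - F.X S' c) := by
            rw [inner_sub_right, F.tight S hS _ hjS]
            have := hc S' hS' j.1 h
            linarith
          nlinarith [mul_pos (neg_pos.2 hi) this, mul_nonneg hj.le a1]
      have hI1 : I ⊆ S1 := fun k hk => by rw [hS1d]; simp [hk]
      have hI2 : I ⊆ S2 := fun k hk => by rw [hS2d]; simp [hk]
      have m1 := main i j S1 S2 hS1 hS2 hEq hS1d hI2 hi hj
      have m2 := main k l S2 S1 hS2 hS1 (Ne.symm hEq) hS2d hI1 hk hl2
      obtain ⟨s, s', hs⟩ := hdec' (F.X S1 c - F.X S2 c) fun k hk => by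
        rw [inner_sub_right, F.tight S1 hS1 k (hI1 hk), F.tight S2 hS2 k (hI2 hk), sub_self]
      have hs2 : F.X S2 c - F.X S1 c = (-s) • v + (-s') • vb := by
        rw [← neg_sub, hs]; module
      rw [hpair i j _ s s' hs] at m1
      rw [hpair k l _ _ _ hs2] at m2
      nlinarith [mul_pos m1 m2, mul_nonneg (sq_nonneg s') hpos.le]

theorem hyp_all (cs : List (ι → ℝ)) : F.Hyp cs := by
  induction cs with
  | nil => exact F.hyp_base
  | cons c cs ih => exact F.hyp_step c cs ih
end Fan

set_option linter.unusedSectionVars false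
set_option linter.unusedVariables false
open scoped Pointwise
open MeasureTheory

theorem idx_lt (n m : ℕ) (j : Fin n) (h : (j : ℕ) < m - 1) : (j : ℕ) < m :=
  lt_of_lt_of_le h (Nat.sub_le m 1)

theorem idx_top (m : ℕ) (hm : 1 ≤ m) : m - 1 < m := Nat.sub_lt hm Nat.one_pos


namespace Fan
variable {n : ℕ} {ι : Type*} [Fintype ι] [DecidableEq ι] (F : Fan n ι)

theorem N_empty (l : List (ι → ℝ)) : F.N l ∅ = F.M l := by simp [N]

theorem M_pos' (l : List (ι → ℝ)) (hl : l.length = n) (hT : ∀ c ∈ l, c ∈ F.T) : 0 < F.M l := by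
  rw [← F.N_empty]
  exact F.N_pos l ∅ F.face_empty hT (by simpa using hl)

theorem fenchel (l : List (ι → ℝ)) (hl : l.length + 2 = n) (hT : ∀ c ∈ l, c ∈ F.T) {a b c : ι → ℝ}
    (ha : a ∈ F.T) (hb : b ∈ F.T) (hc : c ∈ F.T) :
    F.M (a :: a :: l) * F.M (b :: c :: l) ≤ 2 * F.M (a :: b :: l) * F.M (a :: c :: l) := by
  have hl' : l.length + 2 + (∅ : Finset ι).card = n := by simpa using hl
  have hp : ∀ x ∈ F.T, ∀ y ∈ F.T, 0 < F.M (x :: y :: l) := fun x hx y hy =>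
    F.M_pos' _ (by simpa using hl) (by simpa [hx, hy] using hT)
  set q := F.Qf l ∅ hl' with hq
  have hqM : ∀ x y, q x y = F.M (x :: y :: l) := fun x y => by rw [hq, Qf_apply, N_empty]
  have hs : ∀ x y, q x y = q y x := F.Qf_symm l ∅ hl'
  rw [← hqM, ← hqM, ← hqM, ← hqM]
  have hcs : ∀ x, q x x * q a a ≤ q x a ^ 2 := fun x =>
    F.Hyp_cs (F.hyp_all l) F.face_empty hT hl' ha x
  have haa : 0 < q a a := by rw [hqM]; exact hp a ha a ha
  have hab : 0 < q a b := by rw [hqM]; exact hp a ha b hb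
  have hac : 0 < q a c := by rw [hqM]; exact hp a ha c hc
  have hbb : 0 < q b b := by rw [hqM]; exact hp b hb b hb
  have hccp : 0 < q c c := by rw [hqM]; exact hp c hc c hc
  have h := hcs (q a c • b + q a b • c)
  simp only [map_add, map_smul, LinearMap.add_apply, LinearMap.smul_apply, smul_eq_mul] at h
  rw [hs c b, hs b a, hs c a] at h
  have h1 : 2 * (q a c * q a b) * (q b c * q a a) ≤ (2 * (q a c * q a b)) * (2 * q a b * q a c) := by
    have e1 : 0 ≤ q a c ^ 2 * q b b * q a a := by positivity
    have e2 : 0 ≤ q a b ^ 2 * q c c * q a a := by positivity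
    nlinarith
  have := le_of_mul_le_mul_left h1 (by positivity)
  linarith

theorem iter_fenchel {a b : ι → ℝ} (ha : a ∈ F.T) (hb : b ∈ F.T) (bs : List (ι → ℝ)) :
    ∀ r : ℕ, bs.length + 1 + r = n → (∀ c ∈ bs, c ∈ F.T) →
    F.M (List.replicate n a) * F.M (b :: (bs ++ List.replicate r a)) ≤
      2 ^ bs.length * F.M (bs ++ List.replicate (r + 1) a) * F.M (b :: List.replicate (n - 1) a) := by
  induction bs with
  | nil =>
    intro r hr _
    have h1 : r + 1 = n := by simp at hr; omega
    have h2 : n - 1 = r := by omega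
    simp [h1, h2]
  | cons b1 bs ih =>
    intro r hr hT
    simp only [List.length_cons] at hr
    have hb1 : b1 ∈ F.T := hT b1 List.mem_cons_self
    have hbs : ∀ c ∈ bs, c ∈ F.T := fun c hc => hT c (List.mem_cons_of_mem _ hc)
    have h1 := ih (r + 1) (by omega) hbs
    set l := bs ++ List.replicate r a with hl
    have hlT : ∀ c ∈ l, c ∈ F.T := by
      intro c hc
      rw [hl, List.mem_append] at hc
      rcases hc with h | h
      · exact hbs c h
      · rw [List.eq_of_mem_replicate h]; exact ha
    have hll : l.length + 2 = n := by simp [hl]; omega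
    have h2 := F.fenchel l hll hlT ha hb1 hb
    have p1 : (bs ++ List.replicate (r + 1) a).Perm (a :: l) := by
      rw [List.replicate_succ]; exact List.perm_middle
    have p2 : (bs ++ List.replicate (r + 1 + 1) a).Perm (a :: a :: l) := by
      rw [List.replicate_succ]; exact List.perm_middle.trans (p1.cons a)
    have e1 : F.M (b :: (bs ++ List.replicate (r + 1) a)) = F.M (a :: b :: l) :=
      F.M_perm ((p1.cons b).trans (List.Perm.swap _ _ _))
    have e2 : F.M (bs ++ List.replicate (r + 1 + 1) a) = F.M (a :: a :: l) := F.M_perm p2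
    have e3 : F.M (b :: (b1 :: bs ++ List.replicate r a)) = F.M (b1 :: b :: l) :=
      F.M_perm (List.Perm.swap _ _ _)
    have e4 : F.M (b1 :: bs ++ List.replicate (r + 1) a) = F.M (a :: b1 :: l) :=
      F.M_perm ((p1.cons b1).trans (List.Perm.swap _ _ _))
    rw [e1, e2] at h1
    rw [e3, e4, List.length_cons, pow_succ]
    have q1 : 0 < F.M (a :: a :: l) := F.M_pos' _ (by simpa using hll) (by simpa [ha] using hlT)
    have q2 : 0 < F.M (a :: b1 :: l) := F.M_pos' _ (by simpa using hll) (by simpa [ha, hb1] using hlT)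
    have q3 : 0 < F.M (List.replicate n a) := F.M_pos' _ (by simp) (by
      intro c hc; rw [List.eq_of_mem_replicate hc]; exact ha)
    refine le_of_mul_le_mul_left ?_ q1
    calc F.M (a :: a :: l) * (F.M (List.replicate n a) * F.M (b1 :: b :: l))
        = F.M (List.replicate n a) * (F.M (a :: a :: l) * F.M (b1 :: b :: l)) := by ring
      _ ≤ F.M (List.replicate n a) * (2 * F.M (a :: b1 :: l) * F.M (a :: b :: l)) :=
          mul_le_mul_of_nonneg_left h2 q3.le
      _ = 2 * F.M (a :: b1 :: l) * (F.M (List.replicate n a) * F.M (a :: b :: l)) := by ring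
      _ ≤ 2 * F.M (a :: b1 :: l) * (2 ^ bs.length * F.M (a :: a :: l) * F.M (b :: List.replicate (n - 1) a)) :=
          mul_le_mul_of_nonneg_left h1 (by positivity)
      _ = _ := by ring

theorem mixed_P (hn : 1 ≤ n) (c : Fin n → ι → ℝ) (hc : ∀ k, c k ∈ F.T) :
    mixedVolume (fun j => F.P (c j)) = (n.factorial : ℝ)⁻¹ * F.M (List.ofFn c) := by
  rw [mixedVolume, ← F.M_volume hn c hc]
  congr 1
  apply F.M_perm
  rw [List.ofFn_eq_map]
  refine List.Perm.map c ?_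
  rw [List.perm_ext_iff_of_nodup (Finset.nodup_toList _) (List.nodup_finRange n)]
  simp

theorem fenchel_P (m : ℕ) (hm : 1 ≤ m) (hmn : m ≤ n) (a : ι → ℝ) (b : Fin m → ι → ℝ) (ha : a ∈ F.T)
    (hb : ∀ k, b k ∈ F.T) :
    (volume (F.P a)).toReal *
      mixedVolume (fun j : Fin n => if h : (j : ℕ) < m then F.P (b ⟨(j : ℕ), h⟩) else F.P a) ≤
    2 ^ (m - 1) *
      mixedVolume (fun j : Fin n =>
        if h : (j : ℕ) < m - 1 then F.P (b ⟨(j : ℕ), idx_lt n m j h⟩) else F.P a) *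
      mixedVolume (fun j : Fin n => if (j : ℕ) = 0 then F.P (b ⟨m - 1, idx_top m hm⟩) else F.P a) := by
  obtain ⟨k, rfl⟩ : ∃ k, m = k + 1 := ⟨m - 1, by omega⟩
  have hn : 1 ≤ n := by omega
  simp only [Nat.add_sub_cancel]
  have f1 : (fun j : Fin n => if h : (j : ℕ) < k + 1 then F.P (b ⟨(j : ℕ), h⟩) else F.P a) =
      fun j : Fin n => F.P (if h : (j : ℕ) < k + 1 then (b ⟨(j : ℕ), h⟩) else a) := by
    funext j; split_ifs <;> rfl
  have f2 : (fun j : Fin n => if h : (j : ℕ) < k then F.P (b ⟨(j : ℕ), by omega⟩) else F.P a) =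
      fun j : Fin n => F.P (if h : (j : ℕ) < k then (b ⟨(j : ℕ), by omega⟩) else a) := by
    funext j; split_ifs <;> rfl
  have f3 : (fun j : Fin n => if (j : ℕ) = 0 then F.P (b ⟨k, by omega⟩) else F.P a) =
      fun j : Fin n => F.P (if (j : ℕ) = 0 then (b ⟨k, by omega⟩) else a) := by
    funext j; split_ifs <;> rfl
  rw [f1, f2, f3, F.mixed_P hn _ (fun j => by split_ifs; exacts [hb _, ha]),
    F.mixed_P hn _ (fun j => by split_ifs; exacts [hb _, ha]),
    F.mixed_P hn _ (fun j => by split_ifs; exacts [hb _, ha])]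
  set bs : List (ι → ℝ) := List.ofFn (fun j : Fin k => b ⟨j, by omega⟩) with hbs
  have hbsl : bs.length = k := by simp [hbs]
  have l1 : F.M (List.ofFn fun j : Fin n => if h : (j : ℕ) < k + 1 then (b ⟨(j : ℕ), h⟩) else a) =
      F.M (b ⟨k, by omega⟩ :: (bs ++ List.replicate (n - (k + 1)) a)) := by
    apply F.M_perm
    refine List.Perm.trans (l₂ := bs ++ b ⟨k, by omega⟩ :: List.replicate (n - (k + 1)) a) ?_ List.perm_middle
    apply List.Perm.of_eq
    apply List.ext_getElem
    · simp [hbsl]; omega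
    · intro i h1 h2
      simp only [List.getElem_ofFn, List.getElem_append, hbsl, hbs, List.length_ofFn, List.getElem_cons,
        List.getElem_replicate]
      split_ifs <;> first | rfl | omega | (congr 1; apply Fin.ext; simp; omega)
  have l2 : (List.ofFn fun j : Fin n => if h : (j : ℕ) < k then (b ⟨(j : ℕ), by omega⟩) else a) =
      bs ++ List.replicate (n - (k + 1) + 1) a := by
    apply List.ext_getElem
    · simp [hbsl]; omega
    · intro i h1 h2
      simp only [List.getElem_ofFn, List.getElem_append, hbsl, hbs, List.length_ofFn, List.getElem_replicate]
  have l3 : (List.ofFn fun j : Fin n => if (j : ℕ) = 0 then (b ⟨k, by omega⟩) else a) =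
      b ⟨k, by omega⟩ :: List.replicate (n - 1) a := by
    apply List.ext_getElem
    · simp; omega
    · intro i h1 h2
      simp only [List.getElem_ofFn, List.getElem_cons, List.getElem_replicate]
      split_ifs <;> rfl
  rw [l1, l2, l3]
  have h := F.iter_fenchel ha (hb ⟨k, by omega⟩) bs (n - (k + 1)) (by omega) (by
    intro c hc
    rw [hbs, List.mem_ofFn] at hc
    obtain ⟨i, rfl⟩ := hc
    exact hb _)
  rw [F.M_diag ha, hbsl] at h
  have hf : (0 : ℝ) < n.factorial := by exact_mod_cast n.factorial_pos
  change F.f a * _ ≤ _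
  have := mul_le_mul_of_nonneg_left h (show (0 : ℝ) ≤ ((n.factorial : ℝ)⁻¹) ^ 2 by positivity)
  calc _ = ((n.factorial : ℝ)⁻¹) ^ 2 * (n.factorial * F.f a *
        F.M (b ⟨k, by omega⟩ :: (bs ++ List.replicate (n - (k + 1)) a))) := by field_simp
    _ ≤ _ := this
    _ = _ := by ring
end Fan

set_option linter.unusedSectionVars false
set_option linter.unusedVariables false
open scoped Pointwise
open MeasureTheory

theorem small_step {κ : Type*} [Finite κ] (a b h : κ → ℝ) (H : ∀ i, a i < h i ∨ (a i = h i ∧ b i ≤ 0)) :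
    ∃ δ : ℝ, 0 < δ ∧ ∀ i, a i + δ * b i ≤ h i := by
  have : ∀ᶠ δ : ℝ in nhdsWithin 0 (Set.Ioi 0), ∀ i, a i + δ * b i ≤ h i := by
    rw [Filter.eventually_all]
    intro i
    rcases H i with h1 | ⟨h1, h2⟩
    · have hc : Continuous fun δ : ℝ => a i + δ * b i := by fun_prop
      have := (hc.tendsto 0).eventually_lt_const (u := h i) (by simpa using h1)
      exact (this.filter_mono nhdsWithin_le_nhds).mono fun _ h => h.le
    · filter_upwards [self_mem_nhdsWithin] with δ hδ
      have : δ * b i ≤ 0 := mul_nonpos_of_nonneg_of_nonpos (le_of_lt hδ) h2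
      linarith
  obtain ⟨δ, h1, h2⟩ := (this.and self_mem_nhdsWithin).exists
  exact ⟨δ, h2, h1⟩

section sep
variable {E : Type*} [NormedAddCommGroup E] [InnerProductSpace ℝ E]

theorem mem_openSegment_pm (x v : E) {s t : ℝ} (hs : 0 < s) (ht : 0 < t) :
    x ∈ openSegment ℝ (x - s • v) (x + t • v) := by
  refine ⟨t / (s + t), s / (s + t), by positivity, by positivity, by field_simp; ring, ?_⟩
  have : (t / (s + t)) • (x - s • v) + (s / (s + t)) • (x + t • v) =
      ((t + s) / (s + t)) • x + ((s * t - t * s) / (s + t)) • v := by module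
  rw [this, add_comm t s, div_self (by positivity), mul_comm s t]
  simp

theorem convex_inner_le (w : E) (r : ℝ) : Convex ℝ {x : E | inner ℝ w x ≤ r} :=
  convex_halfSpace_le ⟨fun x y => inner_add_right _ _ _, fun t x => real_inner_smul_right _ _ _⟩ r

theorem convex_inner_le' (w : E) (r : ℝ) : Convex ℝ {x : E | inner ℝ x w ≤ r} :=
  convex_halfSpace_le ⟨fun x y => inner_add_left _ _ _, fun t x => real_inner_smul_left _ _ _⟩ r

theorem hull_inner_le {X : Set E} {w : E} {r : ℝ} (h : ∀ x ∈ X, inner ℝ w x ≤ r) :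
    ∀ x ∈ convexHull ℝ X, inner ℝ w x ≤ r :=
  fun x hx => convexHull_min (t := {x : E | inner ℝ w x ≤ r}) h (convex_inner_le w r) hx

variable [FiniteDimensional ℝ E]
theorem sep_point {C : Set E} (hc : Convex ℝ C) (hcl : IsClosed C) {x : E} (hx : x ∉ C) :
    ∃ (w : E) (r : ℝ), (∀ a ∈ C, inner ℝ w a < r) ∧ r < inner ℝ w x := by
  obtain ⟨f, u, h1, h2⟩ := geometric_hahn_banach_closed_point hc hcl hx
  have : CompleteSpace E := FiniteDimensional.complete ℝ E
  refine ⟨(InnerProductSpace.toDual ℝ E).symm f, u, fun a ha => ?_, ?_⟩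
  · rw [InnerProductSpace.toDual_symm_apply]; exact h1 a ha
  · rw [InnerProductSpace.toDual_symm_apply]; exact h2

open Classical in
theorem H_rep (X : Finset E) (h0 : (0 : E) ∈ interior (convexHull ℝ (X : Set E))) :
    ∃ U : Finset E, convexHull ℝ (X : Set E) = {x | ∀ u ∈ U, inner ℝ u x ≤ 1} := by
  set D : Set E := {w | ∀ x ∈ X, inner ℝ w x ≤ 1} with hD
  have hDhull : ∀ w ∈ D, ∀ x ∈ convexHull ℝ (X : Set E), inner ℝ w x ≤ 1 := fun w hw =>
    hull_inner_le hw
  have hDeq : D = ⋂ x ∈ X, {w : E | inner ℝ w x ≤ 1} := by ext; simp [hD]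
  have hDconv : Convex ℝ D := by
    rw [hDeq]
    exact convex_iInter fun x => convex_iInter fun _ => convex_inner_le' x 1
  have hDclosed : IsClosed D := by
    rw [hDeq]
    exact isClosed_biInter fun x _ => isClosed_le (by fun_prop) (by fun_prop)
  obtain ⟨ρ, hρ, hball⟩ := Metric.mem_nhds_iff.1 (mem_interior_iff_mem_nhds.1 h0)
  have hDbdd : Bornology.IsBounded D := by
    refine (Metric.isBounded_iff_subset_closedBall 0).2 ⟨2 / ρ, fun w hw => ?_⟩
    rw [mem_closedBall_zero_iff]
    by_cases hw0 : w = 0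
    · rw [hw0, norm_zero]; positivity
    have hwn : 0 < ‖w‖ := norm_pos_iff.2 hw0
    have h1 := hDhull w hw ((ρ / 2 / ‖w‖) • w) (hball (by
      rw [mem_ball_zero_iff, norm_smul, Real.norm_of_nonneg (by positivity), div_mul_cancel₀ _ hwn.ne']
      linarith))
    rw [real_inner_smul_right, real_inner_self_eq_norm_sq] at h1
    have h2 : ρ / 2 / ‖w‖ * ‖w‖ ^ 2 = ρ / 2 * ‖w‖ := by field_simp
    rw [h2] at h1
    rw [le_div_iff₀ hρ]
    linarith
  have hDcomp : IsCompact D := Metric.isCompact_of_isClosed_isBounded hDclosed hDbdd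
  have hfin : (Set.extremePoints ℝ D).Finite := by
    refine Set.Finite.of_finite_image (f := fun w => X.filter fun x => inner ℝ w x = 1) ?_ ?_
    · refine (X.powerset.finite_toSet).subset ?_
      rintro _ ⟨w, -, rfl⟩
      exact Finset.mem_coe.2 (Finset.mem_powerset.2 (Finset.filter_subset _ _))
    · intro w hw w' hw' hww
      simp only [Finset.ext_iff, Finset.mem_filter] at hww
      rw [mem_extremePoints] at hw hw'
      obtain ⟨δ, hδ, hδ'⟩ := small_step (fun x : X => inner ℝ w x.1) (fun x : X => inner ℝ (w - w') x.1)
        (fun _ => 1) (fun x => by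
          rcases (hw.1 x.1 x.2).lt_or_eq with h | h
          · exact Or.inl h
          · refine Or.inr ⟨h, ?_⟩
            have := ((hww x.1).1 ⟨x.2, h⟩).2
            rw [inner_sub_left, h, this]; simp)
      have hm : w - δ • (w' - w) ∈ D := fun x hx => by
        have := hδ' ⟨x, hx⟩
        simp only at this
        rw [inner_sub_left] at this
        rw [inner_sub_left, real_inner_smul_left, inner_sub_left]
        linarith
      have hm2 : w + (1 : ℝ) • (w' - w) ∈ D := by simpa using hw'.1
      have := (hw.2 _ hm _ hm2 (mem_openSegment_pm w (w' - w) hδ one_pos)).2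
      simpa using this.symm
  refine ⟨hfin.toFinset, ?_⟩
  apply Set.Subset.antisymm
  · intro x hx u hu
    rw [Set.Finite.mem_toFinset, mem_extremePoints] at hu
    exact hDhull u hu.1 x hx
  · intro x hx
    by_contra hcon
    have hcl : IsClosed (convexHull ℝ (X : Set E)) :=
      (X.finite_toSet.isCompact_convexHull ℝ).isClosed
    obtain ⟨w, r, h1, h2⟩ := sep_point (convex_convexHull ℝ _) hcl hcon
    have hr : 0 < r := by
      have := h1 0 (interior_subset h0)
      simpa using this
    have hwD : r⁻¹ • w ∈ D := fun y hy => by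
      rw [real_inner_smul_left, inv_mul_le_iff₀ hr, mul_one]
      exact (h1 y (subset_convexHull ℝ _ hy)).le
    have hsub : D ⊆ {w : E | inner ℝ w x ≤ 1} := by
      rw [← closure_convexHull_extremePoints hDcomp hDconv]
      refine closure_minimal (convexHull_min ?_ (convex_inner_le' x 1))
        (isClosed_le (by fun_prop) (by fun_prop))
      intro u hu
      exact hx u (by simpa using hu)
    have := hsub hwD
    simp only [Set.mem_ofPred_eq] at this
    rw [real_inner_smul_left, inv_mul_le_iff₀ hr, mul_one] at this
    linarith
end sep

set_option linter.unusedSectionVars false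
set_option linter.unusedVariables false
open scoped Pointwise
open MeasureTheory

section mk
variable {n : ℕ} {ι : Type*} [Fintype ι] [DecidableEq ι] (u : ι → EuclideanSpace ℝ (Fin n))

/-- Index sets of bases. -/
def goodS (S : Finset ι) : Prop := S.card = n ∧ LinearIndependent ℝ (fun i : S => u i)

variable {u}
theorem good_unique {S : Finset ι} (hS : goodS u S) {v w : EuclideanSpace ℝ (Fin n)}
    (h : ∀ i ∈ S, inner ℝ (u i) v = inner ℝ (u i) w) : v = w := by
  have hsp := hS.2.span_eq_top_of_card_eq_finrank' (by simp [hS.1])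
  have : v - w ∈ (Submodule.span ℝ (Set.range fun i : S => u i))ᗮ := by
    rw [Submodule.mem_orthogonal]
    intro z hz
    induction hz using Submodule.span_induction with
    | mem x hx =>
      obtain ⟨i, rfl⟩ := hx
      rw [inner_sub_right, h i.1 i.2, sub_self]
    | zero => simp
    | add x y _ _ hx hy => rw [inner_add_left, hx, hy, add_zero]
    | smul a x _ hx => rw [real_inner_smul_left, hx, mul_zero]
  rw [hsp, Submodule.top_orthogonal_eq_bot, Submodule.mem_bot] at this
  exact sub_eq_zero.1 this

theorem good_X {S : Finset ι} (hS : goodS u S) :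
    ∃ X : (ι → ℝ) →ₗ[ℝ] EuclideanSpace ℝ (Fin n), ∀ i ∈ S, ∀ c, inner ℝ (u i) (X c) = c i := by
  let L : EuclideanSpace ℝ (Fin n) →ₗ[ℝ] (S → ℝ) :=
    { toFun := fun v i => inner ℝ (u i) v
      map_add' := fun v w => by funext i; simp [inner_add_right]
      map_smul' := fun t v => by funext i; simp [inner_smul_right] }
  have hinj : Function.Injective L := fun v w h =>
    good_unique hS fun i hi => congrFun h ⟨i, hi⟩
  have hd : Module.finrank ℝ (EuclideanSpace ℝ (Fin n)) = Module.finrank ℝ (S → ℝ) := by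
    simp [hS.1]
  let e := L.linearEquivOfInjective hinj hd
  refine ⟨e.symm.toLinearMap ∘ₗ LinearMap.funLeft ℝ ℝ (fun i : S => i.1), fun i hi c => ?_⟩
  have h1 : L (e.symm (LinearMap.funLeft ℝ ℝ (fun i : S => i.1) c)) = LinearMap.funLeft ℝ ℝ (fun i : S => i.1) c :=
    e.apply_symm_apply _
  exact congrFun h1 ⟨i, hi⟩

theorem exists_vertex (h : ι → ℝ) (hcomp : IsCompact {x | ∀ i, inner ℝ (u i) x ≤ h i})
    (hne : {x | ∀ i, inner ℝ (u i) x ≤ h i}.Nonempty) (w : EuclideanSpace ℝ (Fin n)) :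
    ∃ x, (∀ i, inner ℝ (u i) x ≤ h i) ∧ (∀ y, (∀ i, inner ℝ (u i) y ≤ h i) → inner ℝ w y ≤ inner ℝ w x) ∧
      ∃ S, goodS u S ∧ ∀ i ∈ S, inner ℝ (u i) x = h i := by
  obtain ⟨x0, hx0, hmax⟩ := hcomp.exists_isMaxOn hne
    (f := fun x => inner ℝ w x) (Continuous.continuousOn (by fun_prop))
  set Fc : Set (EuclideanSpace ℝ (Fin n)) :=
    {x | ∀ i, inner ℝ (u i) x ≤ h i} ∩ {x | inner ℝ w x = inner ℝ w x0} with hFc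
  have hFcomp : IsCompact Fc := hcomp.inter_right (isClosed_eq (by fun_prop) (by fun_prop))
  obtain ⟨x, hx⟩ := hFcomp.extremePoints_nonempty ⟨x0, hx0, rfl⟩
  rw [mem_extremePoints] at hx
  obtain ⟨⟨hxP, hxw⟩, hxe⟩ := hx
  have hxw' : inner ℝ w x = inner ℝ w x0 := hxw
  have hmax' : ∀ y, (∀ i, inner ℝ (u i) y ≤ h i) → inner ℝ w y ≤ inner ℝ w x := fun y hy => by
    rw [hxw']; exact hmax hy
  refine ⟨x, hxP, hmax', ?_⟩
  set Act := {i // inner ℝ (u i) x = h i} with hAct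
  let vv : Act → EuclideanSpace ℝ (Fin n) := fun i => u i.1
  have hspan : Submodule.span ℝ (Set.range vv) = ⊤ := by
    rw [← Submodule.orthogonal_eq_bot_iff, Submodule.eq_bot_iff]
    intro v hv
    rw [Submodule.mem_orthogonal] at hv
    have hv' : ∀ i, inner ℝ (u i) x = h i → inner ℝ (u i) v = 0 := fun i hi =>
      hv _ (Submodule.subset_span ⟨⟨i, hi⟩, rfl⟩)
    have key : ∀ v : EuclideanSpace ℝ (Fin n), (∀ i, inner ℝ (u i) x = h i → inner ℝ (u i) v = 0) →
        ∃ δ : ℝ, 0 < δ ∧ ∀ i, inner ℝ (u i) (x + δ • v) ≤ h i := by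
      intro v hv
      obtain ⟨δ, hδ, hh⟩ := small_step (fun i => inner ℝ (u i) x) (fun i => inner ℝ (u i) v) h (fun i => by
        rcases (hxP i).lt_or_eq with h1 | h1
        · exact Or.inl h1
        · exact Or.inr ⟨h1, (hv i h1).le⟩)
      refine ⟨δ, hδ, fun i => ?_⟩
      rw [inner_add_right, real_inner_smul_right]
      exact hh i
    obtain ⟨s, hs, h1⟩ := key (-v) (fun i hi => by rw [inner_neg_right, hv' i hi, neg_zero])
    obtain ⟨t, ht, h2⟩ := key v hv'
    have h1' : ∀ i, inner ℝ (u i) (x - s • v) ≤ h i := fun i => by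
      have := h1 i; rwa [smul_neg, ← sub_eq_add_neg] at this
    have m1 := hmax' _ h1'
    have m2 := hmax' _ h2
    rw [inner_sub_right, real_inner_smul_right] at m1
    rw [inner_add_right, real_inner_smul_right] at m2
    have hwv : inner ℝ w v = 0 := by
      apply le_antisymm
      · by_contra hcon
        push Not at hcon
        have := mul_pos ht hcon
        linarith
      · by_contra hcon
        push Not at hcon
        have := mul_pos_of_neg_of_neg hcon (neg_neg_of_pos hs)
        linarith
    have e1 : x - s • v ∈ Fc := ⟨h1', by
      change inner ℝ w (x - s • v) = _
      rw [inner_sub_right, real_inner_smul_right, hwv, mul_zero, sub_zero, hxw']⟩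
    have e2 : x + t • v ∈ Fc := ⟨h2, by
      change inner ℝ w (x + t • v) = _
      rw [inner_add_right, real_inner_smul_right, hwv, mul_zero, add_zero, hxw']⟩
    have := (hxe _ e1 _ e2 (mem_openSegment_pm x v hs ht)).2
    simpa [ht.ne'] using this
  obtain ⟨κ', a, ha, hsp, hli⟩ := exists_linearIndependent' ℝ vv
  have : Finite κ' := Finite.of_injective a ha
  have := Fintype.ofFinite κ'
  have hinj : Function.Injective fun k : κ' => (a k).1 := fun k l hkl => ha (Subtype.ext hkl)
  let S : Finset ι := Finset.univ.map ⟨fun k : κ' => (a k).1, hinj⟩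
  have hmem : ∀ k : κ', (a k).1 ∈ S := fun k => by simp [S]
  let eqv : κ' ≃ S := Equiv.ofBijective (fun k => ⟨(a k).1, hmem k⟩) ⟨fun k l hkl => hinj (by simpa using hkl), by
    rintro ⟨i, hi⟩
    simp only [S, Finset.mem_map, Finset.mem_univ, true_and, Function.Embedding.coeFn_mk] at hi
    obtain ⟨k, hk⟩ := hi
    exact ⟨k, Subtype.ext hk⟩⟩
  refine ⟨S, ⟨?_, ?_⟩, ?_⟩
  · rw [hspan] at hsp
    have b := Module.Basis.mk hli hsp.ge
    have h1 := Module.finrank_eq_card_basis b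
    rw [finrank_euclideanSpace, Fintype.card_fin] at h1
    rw [Finset.card_map, h1, Finset.card_univ]
  · exact (linearIndependent_equiv' eqv (f := fun i : S => u i) (g := vv ∘ a) rfl).1 hli
  · intro i hi
    obtain ⟨k, hk⟩ := eqv.surjective ⟨i, hi⟩
    have : (a k).1 = i := congrArg Subtype.val hk
    rw [← this]
    exact (a k).2

open Classical in
theorem mkFan (X : Finset ι → (ι → ℝ) →ₗ[ℝ] EuclideanSpace ℝ (Fin n))
    (hX : ∀ S, goodS u S → ∀ i ∈ S, ∀ c, inner ℝ (u i) (X S c) = c i) (h : ι → ℝ)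
    (hcomp : IsCompact {x | ∀ i, inner ℝ (u i) x ≤ h i})
    (hne : {x | ∀ i, inner ℝ (u i) x ≤ h i}.Nonempty)
    (hgen : ∀ S, goodS u S → ∀ j, j ∉ S → inner ℝ (u j) (X S h) ≠ h j) :
    ∃ F : Fan n ι, F.u = u ∧ F.X = X ∧ ∀ S, S ∈ F.B ↔ goodS u S ∧ ∀ i, inner ℝ (u i) (X S h) ≤ h i := by
  let B : Finset (Finset ι) := Finset.univ.filter fun S => goodS u S ∧ ∀ i, inner ℝ (u i) (X S h) ≤ h i
  have hB : ∀ S, S ∈ B ↔ goodS u S ∧ ∀ i, inner ℝ (u i) (X S h) ≤ h i := fun S => by simp [B]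
  refine ⟨⟨u, B, X, fun S hS => hX S ((hB S).1 hS).1, fun S hS => ((hB S).1 hS).1.1, ?_, ⟨h, ?_⟩⟩, rfl, rfl, hB⟩
  · intro w
    obtain ⟨x, hxP, hmax, S, hS, hact⟩ := exists_vertex (u := u) h hcomp hne w
    have hxX : x = X S h := good_unique hS fun i hi => by rw [hact i hi, hX S hS i hi]
    have hxX' : ∀ j, j ∉ S → inner ℝ (u j) x < h j := fun j hj =>
      lt_of_le_of_ne (hxP j) (by rw [hxX]; exact hgen S hS j hj)
    refine ⟨S, (hB S).2 ⟨hS, fun i => hxX ▸ hxP i⟩, fun i => inner ℝ w (X S (Fan.e i)), ?_, ?_, ?_⟩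
    · intro i
      by_cases hi : i ∈ S
      · obtain ⟨δ, hδ, hh⟩ := small_step (fun j => inner ℝ (u j) x) (fun j => inner ℝ (u j) (-(X S (Fan.e i)))) h
          (fun j => by
            by_cases hj : j ∈ S
            · refine Or.inr ⟨hact j hj, ?_⟩
              rw [inner_neg_right, hX S hS j hj]
              simp only [Fan.e, Pi.single_apply]
              split_ifs <;> simp
            · exact Or.inl (hxX' j hj))
        have := hmax (x + δ • (-(X S (Fan.e i)))) (fun j => by
          rw [inner_add_right, real_inner_smul_right]; exact hh j)
        rw [inner_add_right, real_inner_smul_right, inner_neg_right] at this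
        by_contra hcon
        push Not at hcon
        have := mul_pos hδ (neg_pos.2 hcon)
        linarith
      · have : X S (Fan.e i) = 0 := good_unique hS fun j hj => by
          rw [hX S hS j hj, inner_zero_right]
          have : j ≠ i := fun h => hi (h ▸ hj)
          simp [Fan.e, this]
        change 0 ≤ inner ℝ w (X S (Fan.e i))
        rw [this, inner_zero_right]
    · intro i hi
      have : X S (Fan.e i) = 0 := good_unique hS fun j hj => by
        rw [hX S hS j hj, inner_zero_right]
        have : j ≠ i := fun h => hi (h ▸ hj)
        simp [Fan.e, this]
      simp only [this, inner_zero_right]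
    · apply ext_inner_right ℝ
      intro y
      have hy : y = X S (∑ i, (inner ℝ (u i) y : ℝ) • Fan.e i) := good_unique hS fun j hj => by
        rw [hX S hS j hj]
        simp [Fan.e, Finset.sum_apply, Pi.single_apply]
      conv_lhs => rw [hy]
      rw [map_sum, inner_sum, sum_inner]
      refine Finset.sum_congr rfl fun i _ => ?_
      rw [map_smul, real_inner_smul_right, real_inner_smul_left, mul_comm]
  · intro S hS j hj
    obtain ⟨h1, h2⟩ := (hB S).1 hS
    exact lt_of_le_of_ne (h2 j) (hgen S h1 j hj)
end mk

set_option linter.unusedSectionVars false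
set_option linter.unusedVariables false
open scoped Pointwise
open MeasureTheory

open Classical in
theorem fan_approx {n : ℕ} {κ : Type*} [Fintype κ] [Nonempty κ] (Y : κ → Finset (EuclideanSpace ℝ (Fin n)))
    (hY : ∀ k, (0 : EuclideanSpace ℝ (Fin n)) ∈ interior (convexHull ℝ (Y k : Set (EuclideanSpace ℝ (Fin n)))))
    {ε : ℝ} (hε : 0 < ε) :
    ∃ (ι : Type) (_ : Fintype ι) (_ : DecidableEq ι) (F : Fan n ι) (c : κ → ι → ℝ), (∀ k, c k ∈ F.T) ∧
      ∀ k, convexHull ℝ (Y k : Set (EuclideanSpace ℝ (Fin n))) ⊆ F.P (c k) ∧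
        F.P (c k) ⊆ (1 + ε) • convexHull ℝ (Y k : Set (EuclideanSpace ℝ (Fin n))) := by
  set R : κ → Set (EuclideanSpace ℝ (Fin n)) := fun k => convexHull ℝ (Y k : Set (EuclideanSpace ℝ (Fin n))) with hR
  have hR0 : ∀ k, (0 : EuclideanSpace ℝ (Fin n)) ∈ R k := fun k => interior_subset (hY k)
  have hRn : ∀ k, R k ∈ nhds (0 : EuclideanSpace ℝ (Fin n)) := fun k => mem_interior_iff_mem_nhds.1 (hY k)
  have hRcl : ∀ k, IsClosed (R k) := fun k => ((Y k).finite_toSet.isCompact_convexHull ℝ).isClosed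
  have hYne : ∀ k, (Y k).Nonempty := fun k => by
    have : (R k).Nonempty := ⟨0, hR0 k⟩
    simpa [hR] using this
  have hsum : convexHull ℝ ((∑ k, Y k : Finset (EuclideanSpace ℝ (Fin n))) : Set (EuclideanSpace ℝ (Fin n))) =
      ∑ k, R k := by
    rw [Finset.coe_sum, convexHull_sum]
  have hRsub : ∀ k, R k ⊆ ∑ k, R k := by
    intro k x hx
    rw [Set.mem_finsetSum]
    refine ⟨fun l => if l = k then x else 0, fun {l} _ => ?_, by simp⟩
    by_cases h : l = k
    · subst h; simpa using hx
    · simpa [h] using hR0 l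
  obtain ⟨k0⟩ := (inferInstance : Nonempty κ)
  have hQ0 : (0 : EuclideanSpace ℝ (Fin n)) ∈ interior
      (convexHull ℝ ((∑ k, Y k : Finset (EuclideanSpace ℝ (Fin n))) : Set (EuclideanSpace ℝ (Fin n)))) := by
    rw [hsum]
    exact interior_mono (hRsub k0) (hY k0)
  obtain ⟨U, hU⟩ := H_rep _ hQ0
  have hQcomp : IsCompact (∑ k, R k) := by
    rw [← hsum]
    exact (Finset.finite_toSet _).isCompact_convexHull ℝ
  rw [hsum] at hU
  obtain ⟨ι, instF, u, hu0, hU'⟩ : ∃ (ι : Type) (_ : Fintype ι) (u : ι → EuclideanSpace ℝ (Fin n)),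
      (∀ i, u i ≠ 0) ∧ ∀ x, x ∈ ∑ k, R k ↔ ∀ i, inner ℝ (u i) x ≤ 1 := by
    refine ⟨{w // w ∈ U.filter (· ≠ 0)}, Finset.Subtype.fintype _, fun i => i.1,
      fun i => (Finset.mem_filter.1 i.2).2, ?_⟩
    intro x
    rw [hU]
    constructor
    · intro h i
      exact h i.1 (Finset.mem_filter.1 i.2).1
    · intro h w hw
      by_cases hw0 : w = 0
      · rw [hw0, inner_zero_left]; exact zero_le_one
      · exact h ⟨w, Finset.mem_filter.2 ⟨hw, hw0⟩⟩
  -- support numbers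
  let hs : κ → ι → ℝ := fun k i => (Y k).sup' (hYne k) fun y => inner ℝ (u i) y
  have hs_le : ∀ k i, ∀ x ∈ R k, inner ℝ (u i) x ≤ hs k i := fun k i =>
    hull_inner_le fun y hy => Finset.le_sup' (fun y => (inner ℝ (u i) y : ℝ)) hy
  have hs_at : ∀ k i, ∃ y ∈ R k, hs k i = inner ℝ (u i) y := fun k i => by
    obtain ⟨y, hy, h⟩ := Finset.exists_mem_eq_sup' (hYne k) fun y => (inner ℝ (u i) y : ℝ)
    exact ⟨y, subset_convexHull ℝ _ hy, h⟩
  have hs_pos : ∀ k i, 0 < hs k i := by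
    intro k i
    have hcont : Continuous fun t : ℝ => t • u i := by fun_prop
    have h1 : ∀ᶠ t : ℝ in nhdsWithin 0 (Set.Ioi 0), t • u i ∈ R k :=
      (hcont.continuousAt.eventually_mem (s := R k) (by simpa using hRn k)).filter_mono nhdsWithin_le_nhds
    obtain ⟨t, h2, h3⟩ := (h1.and self_mem_nhdsWithin).exists
    have := hs_le k i _ h2
    rw [real_inner_smul_right] at this
    exact lt_of_lt_of_le (mul_pos h3 (real_inner_self_pos.2 (hu0 i))) this
  let c1 : ι → ℝ := fun i => ∑ k, hs k i
  have hc1pos : ∀ i, 0 < c1 i := fun i => Finset.sum_pos (fun k _ => hs_pos k i) ⟨k0, Finset.mem_univ _⟩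
  have hc1le : ∀ i, c1 i ≤ 1 := by
    intro i
    choose y hy hy' using fun k => hs_at k i
    have : ∑ k, y k ∈ ∑ k, R k := by
      rw [Set.mem_finsetSum]; exact ⟨y, fun {k} _ => hy k, rfl⟩
    have := (hU' _).1 this i
    rw [inner_sum] at this
    simpa only [c1, hy'] using this
  -- coordinates
  let X : Finset ι → (ι → ℝ) →ₗ[ℝ] EuclideanSpace ℝ (Fin n) := fun S =>
    if h : goodS u S then (good_X h).choose else 0
  have hX : ∀ S, goodS u S → ∀ i ∈ S, ∀ c, inner ℝ (u i) (X S c) = c i := by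
    intro S hS
    simp only [X, dif_pos hS]
    exact (good_X hS).choose_spec
  have hXc : ∀ S, Continuous (X S) := fun S => (X S).continuous_of_finiteDimensional
  -- generic right-hand side
  have hopen : ∀ᶠ h : ι → ℝ in nhds c1, (∀ i, 0 < h i) ∧
      ∀ S, (∀ i, inner ℝ (u i) (X S h) ≤ h i) → ∀ i, inner ℝ (u i) (X S c1) ≤ c1 i := by
    refine Filter.Eventually.and ?_ ?_
    · rw [Filter.eventually_all]
      intro i
      exact (continuous_apply i).continuousAt.eventually_const_lt (hc1pos i)
    · rw [Filter.eventually_all]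
      intro S
      by_cases hcl : ∀ i, inner ℝ (u i) (X S c1) ≤ c1 i
      · exact Filter.Eventually.of_forall fun _ _ => hcl
      · push Not at hcl
        obtain ⟨i, hi⟩ := hcl
        have hcont : Continuous fun h : ι → ℝ => (inner ℝ (u i) (X S h) : ℝ) := by
          have := hXc S
          fun_prop
        filter_upwards [((continuous_apply i).tendsto c1).eventually_lt (hcont.tendsto c1) hi] with h hh hcon
        exact absurd (hcon i) (not_le.2 hh)
  have hdense : Dense (⋂ p : {p : Finset ι × ι // goodS u p.1 ∧ p.2 ∉ p.1},
      {h : ι → ℝ | inner ℝ (u p.1.2) (X p.1.1 h) ≠ h p.1.2}) := by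
    have hφ : ∀ p : {p : Finset ι × ι // goodS u p.1 ∧ p.2 ∉ p.1}, ∃ φ : (ι → ℝ) →ₗ[ℝ] ℝ,
        Function.Surjective φ ∧ {h : ι → ℝ | inner ℝ (u p.1.2) (X p.1.1 h) ≠ h p.1.2} = φ ⁻¹' {0}ᶜ := by
      rintro ⟨⟨S, j⟩, hS, hj⟩
      simp only at hS hj ⊢
      let φ : (ι → ℝ) →ₗ[ℝ] ℝ := LinearMap.proj j - (innerₗ _ (u j)) ∘ₗ (X S)
      have hφ : ∀ h, φ h = h j - inner ℝ (u j) (X S h) := fun h => rfl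
      refine ⟨φ, ?_, ?_⟩
      · intro r
        refine ⟨r • Fan.e j, ?_⟩
        have h0 : X S (Fan.e j) = 0 := good_unique hS fun i hi => by
          rw [hX S hS i hi, inner_zero_right]
          have : i ≠ j := fun h => hj (h ▸ hi)
          simp [Fan.e, this]
        rw [map_smul, hφ, h0, inner_zero_right]
        simp [Fan.e]
      · ext h
        simp only [Set.mem_ofPred_eq, Set.mem_preimage, Set.mem_compl_iff, Set.mem_singleton_iff, hφ, sub_eq_zero]
        exact ⟨fun h1 h2 => h1 h2.symm, fun h1 h2 => h1 h2.symm⟩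
    refine dense_iInter_of_isOpen (fun p => ?_) fun p => ?_
    · obtain ⟨φ, -, h2⟩ := hφ p
      rw [h2]
      exact isOpen_compl_singleton.preimage φ.continuous_of_finiteDimensional
    · obtain ⟨φ, h1, h2⟩ := hφ p
      rw [h2]
      exact (dense_compl_singleton (0 : ℝ)).preimage (φ.isOpenMap_of_finiteDimensional h1)
  obtain ⟨h0, hh1, hh2, hh3⟩ := hdense.inter_nhds_nonempty hopen
  have hgen : ∀ S, goodS u S → ∀ j, j ∉ S → inner ℝ (u j) (X S h0) ≠ h0 j := by
    intro S hS j hj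
    have := Set.mem_iInter.1 hh1 ⟨(S, j), hS, hj⟩
    exact this
  have hcomp : IsCompact {x | ∀ i, inner ℝ (u i) x ≤ h0 i} := by
    set t : ℝ := 1 + ∑ i, h0 i with ht
    have htp : 0 < t := by
      have := Finset.sum_nonneg (s := Finset.univ) fun i _ => (hh2 i).le
      linarith
    refine (hQcomp.smul t).of_isClosed_subset ?_ ?_
    · have : {x | ∀ i, inner ℝ (u i) x ≤ h0 i} = ⋂ i, {x | inner ℝ (u i) x ≤ h0 i} := by ext; simp
      rw [this]
      exact isClosed_iInter fun i => isClosed_le (by fun_prop) (by fun_prop)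
    · intro x hx
      rw [Set.mem_smul_set_iff_inv_smul_mem₀ htp.ne', hU']
      intro i
      rw [real_inner_smul_right, inv_mul_le_iff₀ htp, mul_one]
      have h1 := Finset.single_le_sum (f := h0) (fun i _ => (hh2 i).le) (Finset.mem_univ i)
      have h2 := hx i
      linarith
  obtain ⟨F, hFu, hFX, hFB⟩ := mkFan X hX h0 hcomp ⟨0, fun i => by
    rw [inner_zero_right]; exact (hh2 i).le⟩ hgen
  -- the key claim
  have hA : ∀ S ∈ F.B, ∀ k, X S (hs k) ∈ R k := by
    intro S hS k
    obtain ⟨hg, hin⟩ := (hFB S).1 hS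
    have h1 : X S c1 ∈ ∑ k, R k := (hU' _).2 fun i => (hh3 S hin i).trans (hc1le i)
    rw [Set.mem_finsetSum] at h1
    obtain ⟨g, hgR, hgs⟩ := h1
    have : g k = X S (hs k) := good_unique hg fun i hi => by
      rw [hX S hg i hi]
      have e1 : ∑ k, inner ℝ (u i) (g k) = ∑ k, hs k i := by
        rw [← inner_sum, hgs, hX S hg i hi]
      exact (Finset.sum_eq_sum_iff_of_le fun k _ => hs_le k i _ (hgR (Finset.mem_univ k))).1 e1 k (Finset.mem_univ k)
    rw [← this]
    exact hgR (Finset.mem_univ k)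
  have hη : ∀ᶠ η : ℝ in nhdsWithin 0 (Set.Ioi 0), ∀ k, ∀ S, (ε⁻¹ * η) • X S h0 ∈ R k := by
    rw [Filter.eventually_all]
    intro k
    rw [Filter.eventually_all]
    intro S
    have hcont : Continuous fun η : ℝ => (ε⁻¹ * η) • X S h0 := by fun_prop
    exact (hcont.continuousAt.eventually_mem (s := R k) (by simpa using hRn k)).filter_mono nhdsWithin_le_nhds
  obtain ⟨η, hη1, hη2⟩ := (hη.and self_mem_nhdsWithin).exists
  have hη2 : 0 < η := hη2
  refine ⟨ι, inferInstance, inferInstance, F, fun k => hs k + η • h0, ?_, ?_⟩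
  · intro k S hS j hj
    rw [hFu, hFX, map_add, map_smul, inner_add_right, real_inner_smul_right]
    have h1 := hs_le k j _ (hA S hS k)
    obtain ⟨hg, hin⟩ := (hFB S).1 hS
    have h2 := lt_of_le_of_ne (hin j) (hgen S hg j hj)
    have h3 := mul_lt_mul_of_pos_left h2 hη2
    simp only [Pi.add_apply, Pi.smul_apply, smul_eq_mul]
    linarith
  · intro k
    refine ⟨fun x hx i => ?_, fun x hx => ?_⟩
    · rw [hFu]
      have h1 := hs_le k i x hx
      have h2 := mul_pos hη2 (hh2 i)
      simp only [Pi.add_apply, Pi.smul_apply, smul_eq_mul]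
      linarith
    · have hε1 : 0 < 1 + ε := by linarith
      rw [Set.mem_smul_set_iff_inv_smul_mem₀ hε1.ne']
      by_contra hcon
      obtain ⟨w, r, h1, h2⟩ := sep_point (convex_convexHull ℝ _) (hRcl k) hcon
      rw [real_inner_smul_right, lt_inv_mul_iff₀ hε1] at h2
      obtain ⟨S, hS, α, hα, hz, hw⟩ := F.cover w
      obtain ⟨hg, hin⟩ := (hFB S).1 hS
      have h3 : inner ℝ w x ≤ inner ℝ w (X S (hs k + η • h0)) := by
        rw [hw, sum_inner, sum_inner]
        refine Finset.sum_le_sum fun i _ => ?_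
        rw [real_inner_smul_left, real_inner_smul_left]
        by_cases hi : i ∈ S
        · refine mul_le_mul_of_nonneg_left ?_ (hα i)
          rw [hFu, hX S hg i hi]
          have := hx i
          rwa [hFu] at this
        · rw [hz i hi, zero_mul, zero_mul]
      have h4 : X S (hs k + η • h0) = X S (hs k) + ε • ((ε⁻¹ * η) • X S h0) := by
        rw [map_add, map_smul, smul_smul, ← mul_assoc, mul_inv_cancel₀ hε.ne', one_mul]
      rw [h4, inner_add_right, real_inner_smul_right] at h3
      have h5 := h1 _ (hA S hS k)
      have h6 := mul_lt_mul_of_pos_left (h1 _ (hη1 k S)) hε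
      linarith

set_option linter.unusedSectionVars false
set_option linter.unusedVariables false
open scoped Pointwise
open MeasureTheory

theorem inner_approx {n : ℕ} {K : Set (EuclideanSpace ℝ (Fin n))} (hKc : IsCompact K) (hK : Convex ℝ K)
    (h0 : (0 : EuclideanSpace ℝ (Fin n)) ∈ interior K) {δ : ℝ} (hδ : 0 < δ) (hδ1 : δ < 1) :
    ∃ X : Finset (EuclideanSpace ℝ (Fin n)),
      (1 - δ) • K ⊆ convexHull ℝ (X : Set (EuclideanSpace ℝ (Fin n))) ∧
      convexHull ℝ (X : Set (EuclideanSpace ℝ (Fin n))) ⊆ K ∧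
      (0 : EuclideanSpace ℝ (Fin n)) ∈ interior (convexHull ℝ (X : Set (EuclideanSpace ℝ (Fin n)))) := by
  have hn : K ∈ nhds (0 : EuclideanSpace ℝ (Fin n)) := mem_interior_iff_mem_nhds.1 h0
  obtain ⟨ρ, hρ, hball⟩ := Metric.nhds_basis_closedBall.mem_iff.1 hn
  obtain ⟨t, htK, htf, hcov⟩ := hKc.finite_cover_balls (mul_pos hδ hρ)
  have hd : 0 < 1 - δ := by linarith
  have hsub : (1 - δ) • K ⊆ convexHull ℝ t := by
    intro y hy
    by_contra hcon
    obtain ⟨w, r, h1, h2⟩ := sep_point (convex_convexHull ℝ t) (htf.isCompact_convexHull ℝ).isClosed hcon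
    obtain ⟨y0, hy0, hmax⟩ := hKc.exists_isMaxOn ⟨0, interior_subset h0⟩
      (f := fun y => (inner ℝ w y : ℝ)) (by fun_prop)
    obtain ⟨z, hz, rfl⟩ := hy
    have h3 : inner ℝ w z ≤ inner ℝ w y0 := hmax hz
    have h4 : ρ * ‖w‖ ≤ inner ℝ w y0 := by
      by_cases hw : w = 0
      · simp [hw]
      have hwp : 0 < ‖w‖ := norm_pos_iff.2 hw
      have hm : (ρ / ‖w‖) • w ∈ K := hball (by
        rw [mem_closedBall_zero_iff, norm_smul, Real.norm_of_nonneg (by positivity), div_mul_cancel₀ _ hwp.ne'])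
      have h5 : inner ℝ w ((ρ / ‖w‖) • w) ≤ inner ℝ w y0 := hmax hm
      rw [real_inner_smul_right, real_inner_self_eq_norm_sq] at h5
      have : ρ / ‖w‖ * ‖w‖ ^ 2 = ρ * ‖w‖ := by field_simp
      linarith
    obtain ⟨x, hx, hxb⟩ := Set.mem_iUnion₂.1 (hcov hy0)
    have h6 := h1 x (subset_convexHull ℝ t hx)
    have h7 : inner ℝ w (y0 - x) ≤ ‖w‖ * (δ * ρ) := by
      refine (real_inner_le_norm _ _).trans (mul_le_mul_of_nonneg_left ?_ (norm_nonneg _))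
      rw [Metric.mem_ball, dist_eq_norm] at hxb
      exact hxb.le
    rw [inner_sub_right] at h7
    simp only [real_inner_smul_right] at h2
    have h8 := mul_le_mul_of_nonneg_left h3 hd.le
    have h9 := mul_le_mul_of_nonneg_left h4 hδ.le
    linarith
  refine ⟨htf.toFinset, by simpa using hsub, by simpa using convexHull_min htK hK, ?_⟩
  rw [mem_interior_iff_mem_nhds]
  refine Filter.mem_of_superset ((set_smul_mem_nhds_zero_iff hd.ne').2 hn) (by simpa using hsub)

theorem body_approx {n : ℕ} {κ : Type*} [Fintype κ] [Nonempty κ] (K : κ → Set (EuclideanSpace ℝ (Fin n)))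
    (hKc : ∀ k, IsCompact (K k)) (hK : ∀ k, Convex ℝ (K k))
    (h0 : ∀ k, (0 : EuclideanSpace ℝ (Fin n)) ∈ interior (K k)) {δ : ℝ} (hδ : 0 < δ) (hδ1 : δ < 1) :
    ∃ (ι : Type) (_ : Fintype ι) (_ : DecidableEq ι) (F : Fan n ι) (c : κ → ι → ℝ), (∀ k, c k ∈ F.T) ∧
      ∀ k, (1 - δ) • K k ⊆ F.P (c k) ∧ F.P (c k) ⊆ (1 + δ) • K k := by
  choose Y hY1 hY2 hY3 using fun k => inner_approx (hKc k) (hK k) (h0 k) hδ hδ1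
  obtain ⟨ι, i1, i2, F, c, hc, h⟩ := fan_approx Y hY3 hδ
  exact ⟨ι, i1, i2, F, c, hc, fun k => ⟨(hY1 k).trans (h k).1,
    (h k).2.trans (Set.smul_set_mono (hY2 k))⟩⟩

theorem mv_translate {n : ℕ} (K : Fin n → Set (EuclideanSpace ℝ (Fin n))) (t : Fin n → EuclideanSpace ℝ (Fin n)) :
    mixedVolume (fun i => {t i} + K i) = mixedVolume K := by
  unfold mixedVolume
  congr 1
  refine Finset.sum_congr rfl fun S _ => ?_
  rw [Finset.sum_add_distrib]
  have : ∑ i ∈ S, ({t i} : Set (EuclideanSpace ℝ (Fin n))) = {∑ i ∈ S, t i} := by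
    classical
    induction S using Finset.induction_on with
    | empty => simp; rfl
    | insert a s ha ih => rw [Finset.sum_insert ha, Finset.sum_insert ha, ih (Finset.mem_univ _), Set.singleton_add_singleton]
  rw [this, Set.singleton_add, Set.image_add_left, measure_preimage_add]

theorem sum_mono_set {n : ℕ} {ι : Type*} (S : Finset ι) (K L : ι → Set (EuclideanSpace ℝ (Fin n)))
    (h : ∀ i, K i ⊆ L i) : ∑ i ∈ S, K i ⊆ ∑ i ∈ S, L i := by
  classical
  induction S using Finset.induction_on with
  | empty => simp
  | insert a s ha ih => rw [Finset.sum_insert ha, Finset.sum_insert ha]; exact Set.add_subset_add (h a) ih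

theorem sum_compact_set {n : ℕ} {ι : Type*} (S : Finset ι) (K : ι → Set (EuclideanSpace ℝ (Fin n)))
    (h : ∀ i, IsCompact (K i)) : IsCompact (∑ i ∈ S, K i) := by
  classical
  induction S using Finset.induction_on with
  | empty => simp only [Finset.sum_empty]; exact isCompact_singleton
  | insert a s ha ih => rw [Finset.sum_insert ha]; exact (h a).add ih

theorem sum_smul_set {n : ℕ} {ι : Type*} (S : Finset ι) (K : ι → Set (EuclideanSpace ℝ (Fin n))) (r : ℝ) :
    ∑ i ∈ S, r • K i = r • ∑ i ∈ S, K i := (Finset.smul_sum).symm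

theorem vol_smul_toReal {n : ℕ} (S : Set (EuclideanSpace ℝ (Fin n))) {r : ℝ} (hr : 0 ≤ r) :
    (volume (r • S)).toReal = r ^ n * (volume S).toReal := by
  rw [Measure.addHaar_smul, ENNReal.toReal_mul, finrank_euclideanSpace_fin,
    abs_of_nonneg (by positivity), ENNReal.toReal_ofReal (by positivity)]

theorem vol_tendsto {n : ℕ} {ι : Type*} (S : Finset ι) (K : ι → Set (EuclideanSpace ℝ (Fin n)))
    (hK : ∀ i, IsCompact (K i)) (L : ℕ → ι → Set (EuclideanSpace ℝ (Fin n))) (δ : ℕ → ℝ)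
    (hδ : Filter.Tendsto δ Filter.atTop (nhds 0)) (hδ0 : ∀ j, 0 < δ j) (hδ1 : ∀ j, δ j < 1)
    (h : ∀ j i, (1 - δ j) • K i ⊆ L j i ∧ L j i ⊆ (1 + δ j) • K i) :
    Filter.Tendsto (fun j => (volume (∑ i ∈ S, L j i)).toReal) Filter.atTop
      (nhds (volume (∑ i ∈ S, K i)).toReal) := by
  have hc := sum_compact_set S K hK
  have l1 : Filter.Tendsto (fun j => (1 - δ j) ^ n * (volume (∑ i ∈ S, K i)).toReal) Filter.atTop
      (nhds (volume (∑ i ∈ S, K i)).toReal) := by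
    have := (((hδ.const_sub 1).pow n).mul_const (volume (∑ i ∈ S, K i)).toReal)
    simpa using this
  have l2 : Filter.Tendsto (fun j => (1 + δ j) ^ n * (volume (∑ i ∈ S, K i)).toReal) Filter.atTop
      (nhds (volume (∑ i ∈ S, K i)).toReal) := by
    have := (((hδ.const_add 1).pow n).mul_const (volume (∑ i ∈ S, K i)).toReal)
    simpa using this
  have hup : ∀ j, ∑ i ∈ S, L j i ⊆ (1 + δ j) • ∑ i ∈ S, K i := fun j => by
    rw [← sum_smul_set]; exact sum_mono_set S _ _ fun i => (h j i).2
  have hlo : ∀ j, (1 - δ j) • ∑ i ∈ S, K i ⊆ ∑ i ∈ S, L j i := fun j => by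
    rw [← sum_smul_set]; exact sum_mono_set S _ _ fun i => (h j i).1
  have hfin : ∀ j, volume ((1 + δ j) • ∑ i ∈ S, K i) ≠ ⊤ := fun j => (hc.smul _).measure_lt_top.ne
  refine tendsto_of_tendsto_of_tendsto_of_le_of_le l1 l2 (fun j => ?_) fun j => ?_
  · have h1 := hδ1 j
    simp only
    rw [← vol_smul_toReal _ (by linarith)]
    exact ENNReal.toReal_mono (ne_top_of_le_ne_top (hfin j) (measure_mono (hup j))) (measure_mono (hlo j))
  · have h1 := hδ0 j
    simp only
    rw [← vol_smul_toReal _ (by linarith)]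
    exact ENNReal.toReal_mono (hfin j) (measure_mono (hup j))

theorem mv_tendsto {n : ℕ} (K : Fin n → Set (EuclideanSpace ℝ (Fin n)))
    (hK : ∀ i, IsCompact (K i)) (L : ℕ → Fin n → Set (EuclideanSpace ℝ (Fin n))) (δ : ℕ → ℝ)
    (hδ : Filter.Tendsto δ Filter.atTop (nhds 0)) (hδ0 : ∀ j, 0 < δ j) (hδ1 : ∀ j, δ j < 1)
    (h : ∀ j i, (1 - δ j) • K i ⊆ L j i ∧ L j i ⊆ (1 + δ j) • K i) :
    Filter.Tendsto (fun j => mixedVolume (L j)) Filter.atTop (nhds (mixedVolume K)) := by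
  unfold mixedVolume
  exact (tendsto_finsetSum _ fun S _ => (vol_tendsto S K hK L δ hδ hδ0 hδ1 h).const_mul _).const_mul _

theorem fenchel_zero (n m : ℕ) (hm : 1 ≤ m) (hmn : m ≤ n)
    (A : Set (EuclideanSpace ℝ (Fin n))) (B : Fin m → Set (EuclideanSpace ℝ (Fin n)))
    (hA : IsConvexBody A) (hB : ∀ k, IsConvexBody (B k))
    (hA0 : (0 : EuclideanSpace ℝ (Fin n)) ∈ interior A)
    (hB0 : ∀ k, (0 : EuclideanSpace ℝ (Fin n)) ∈ interior (B k)) :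
    (volume A).toReal *
      mixedVolume (fun j : Fin n => if h : (j : ℕ) < m then B ⟨(j : ℕ), h⟩ else A) ≤
    2 ^ (m - 1) *
      mixedVolume (fun j : Fin n =>
        if h : (j : ℕ) < m - 1 then B ⟨(j : ℕ), idx_lt n m j h⟩ else A) *
      mixedVolume (fun j : Fin n => if (j : ℕ) = 0 then B ⟨m - 1, idx_top m hm⟩ else A) := by
  let K : Option (Fin m) → Set (EuclideanSpace ℝ (Fin n)) := fun o => o.elim A B
  have hK : ∀ o, IsConvexBody (K o) ∧ (0 : EuclideanSpace ℝ (Fin n)) ∈ interior (K o) := by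
    rintro (_ | k)
    · exact ⟨hA, hA0⟩
    · exact ⟨hB k, hB0 k⟩
  let δ : ℕ → ℝ := fun j => 1 / ((j : ℝ) + 1) / 2
  have hδ0 : ∀ j, 0 < δ j := fun j => by positivity
  have hδ1 : ∀ j, δ j < 1 := fun j => by
    have : 1 / ((j : ℝ) + 1) ≤ 1 := by
      rw [div_le_one (by positivity)]
      have : (0 : ℝ) ≤ j := j.cast_nonneg
      linarith
    simp only [δ]; linarith
  have hδ : Filter.Tendsto δ Filter.atTop (nhds 0) := by
    simpa [δ] using (tendsto_one_div_add_atTop_nhds_zero_nat (𝕜 := ℝ)).div_const 2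
  choose ι i1 i2 F c hc hap using fun j => body_approx K (fun o => (hK o).1.2.1) (fun o => (hK o).1.1)
    (fun o => (hK o).2) (hδ0 j) (hδ1 j)
  have hPA : ∀ j, (1 - δ j) • A ⊆ (F j).P (c j none) ∧ (F j).P (c j none) ⊆ (1 + δ j) • A :=
    fun j => hap j none
  have hPB : ∀ j k, (1 - δ j) • B k ⊆ (F j).P (c j (some k)) ∧ (F j).P (c j (some k)) ⊆ (1 + δ j) • B k :=
    fun j k => hap j (some k)
  have key := fun j => (F j).fenchel_P m hm hmn (c j none) (fun k => c j (some k)) (hc j none) fun k => hc j (some k)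
  have tA : Filter.Tendsto (fun j => (volume ((F j).P (c j none))).toReal) Filter.atTop
      (nhds (volume A).toReal) := by
    have := vol_tendsto (Finset.univ : Finset Unit) (fun _ => A) (fun _ => hA.2.1)
      (fun j _ => (F j).P (c j none)) δ hδ hδ0 hδ1 fun j _ => hPA j
    simpa using this
  refine le_of_tendsto_of_tendsto' (tA.mul (mv_tendsto _ ?_ _ δ hδ hδ0 hδ1 ?_))
    (((mv_tendsto _ ?_ _ δ hδ hδ0 hδ1 ?_).const_mul _).mul (mv_tendsto _ ?_ _ δ hδ hδ0 hδ1 ?_)) key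
  · intro i; split_ifs
    exacts [(hB _).2.1, hA.2.1]
  · intro j i; split_ifs
    exacts [hPB j _, hPA j]
  · intro i; split_ifs
    exacts [(hB _).2.1, hA.2.1]
  · intro j i; split_ifs
    exacts [hPB j _, hPA j]
  · intro i; split_ifs
    exacts [(hB _).2.1, hA.2.1]
  · intro j i; split_ifs
    exacts [hPB j _, hPA j]

theorem body_translate {n : ℕ} {K : Set (EuclideanSpace ℝ (Fin n))} (hK : IsConvexBody K) :
    ∃ t : EuclideanSpace ℝ (Fin n), IsConvexBody ({t} + K) ∧
      (0 : EuclideanSpace ℝ (Fin n)) ∈ interior ({t} + K) := by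
  obtain ⟨x, hx⟩ := hK.2.2
  have h0 : (0 : EuclideanSpace ℝ (Fin n)) ∈ interior ({-x} + K) := by
    have : ({-x} : Set (EuclideanSpace ℝ (Fin n))) + interior K ⊆ interior ({-x} + K) :=
      interior_maximal (Set.add_subset_add_left interior_subset) (isOpen_interior.add_left)
    exact this ⟨-x, rfl, x, hx, by simp⟩
  exact ⟨-x, ⟨(convex_singleton _).add hK.1, isCompact_singleton.add hK.2.1, ⟨0, h0⟩⟩, h0⟩

open scoped Pointwise
open MeasureTheory

theorem iterated_fenchel_step (n m : ℕ) (hm : 1 ≤ m) (hmn : m ≤ n)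
    (A : Set (EuclideanSpace ℝ (Fin n))) (B : Fin m → Set (EuclideanSpace ℝ (Fin n)))
    (hA : IsConvexBody A) (hB : ∀ k, IsConvexBody (B k)) :
    (volume A).toReal *
      mixedVolume (fun j : Fin n => if h : (j : ℕ) < m then B ⟨(j : ℕ), h⟩ else A) ≤
    2 ^ (m - 1) *
      mixedVolume (fun j : Fin n =>
        if h : (j : ℕ) < m - 1 then B ⟨(j : ℕ), by omega⟩ else A) *
      mixedVolume (fun j : Fin n => if (j : ℕ) = 0 then B ⟨m - 1, by omega⟩ else A) := by
  obtain ⟨t, hA', hA0⟩ := body_translate hA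
  choose s hB' hB0 using fun k => body_translate (hB k)
  have key := fenchel_zero n m hm hmn ({t} + A) (fun k => {s k} + B k) hA' hB' hA0 hB0
  have hv : volume ({t} + A) = volume A := by
    rw [Set.singleton_add, Set.image_add_left, measure_preimage_add]
  have e1 : mixedVolume (fun j : Fin n => if h : (j : ℕ) < m then {s ⟨(j : ℕ), h⟩} + B ⟨(j : ℕ), h⟩ else {t} + A) =
      mixedVolume (fun j : Fin n => if h : (j : ℕ) < m then B ⟨(j : ℕ), h⟩ else A) := by
    refine Eq.trans ?_ (mv_translate _ (fun j : Fin n => if h : (j : ℕ) < m then s ⟨(j : ℕ), h⟩ else t))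
    congr 1
    funext j
    split_ifs <;> rfl
  have e2 : mixedVolume (fun j : Fin n => if h : (j : ℕ) < m - 1 then
        {s ⟨(j : ℕ), by omega⟩} + B ⟨(j : ℕ), by omega⟩ else {t} + A) =
      mixedVolume (fun j : Fin n => if h : (j : ℕ) < m - 1 then B ⟨(j : ℕ), by omega⟩ else A) := by
    refine Eq.trans ?_ (mv_translate _ (fun j : Fin n => if h : (j : ℕ) < m - 1 then s ⟨(j : ℕ), by omega⟩ else t))
    congr 1
    funext j
    split_ifs <;> rfl
  have e3 : mixedVolume (fun j : Fin n => if (j : ℕ) = 0 then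
        {s ⟨m - 1, by omega⟩} + B ⟨m - 1, by omega⟩ else {t} + A) =
      mixedVolume (fun j : Fin n => if (j : ℕ) = 0 then B ⟨m - 1, by omega⟩ else A) := by
    refine Eq.trans ?_ (mv_translate _ (fun j : Fin n => if (j : ℕ) = 0 then s ⟨m - 1, by omega⟩ else t))
    congr 1
    funext j
    split_ifs <;> rfl
  rw [hv] at key
  rw [← e1, ← e2, ← e3]
  exact key
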